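/- For every ε > 0 there exists a positive integer q(ε) such that for every integer q ≥ q(ε) and all integers p₁, p₂, one has max(|ln 3 − p₁/q|, |π/√3 − p₂/q|) ≥ q^(−3.86042 − ε). -/

import Mathlib

section
open Filter Topology MeasureTheory Set

noncomputable def kerK (v : ℝ) : ℝ := ∫ σ in (-1:ℝ)..1, (1 - |σ|) * Real.cos (σ * v)

lemma kerK_cont : Continuous kerK := by
  unfold kerK
  apply intervalIntegral.continuous_parametric_intervalIntegral_of_continuous'
  fun_prop

lemma kerK_complex (v : ℝ) :
    ∫ σ in (-1:ℝ)..1, ((1 - |σ| : ℝ) : ℂ) * Complex.exp (Complex.I * σ * v) = (kerK v : ℂ) := by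
  have h1 : ∀ σ : ℝ, ((1 - |σ| : ℝ) : ℂ) * Complex.exp (Complex.I * σ * v)
      = (((1 - |σ|) * Real.cos (σ * v) : ℝ) : ℂ) + Complex.I * (((1 - |σ|) * Real.sin (σ * v) : ℝ) : ℂ) := by
    intro σ
    rw [show Complex.I * σ * v = ((σ * v : ℝ) : ℂ) * Complex.I by push_cast; ring, Complex.exp_mul_I]
    push_cast; ring
  simp_rw [h1]
  rw [intervalIntegral.integral_add, intervalIntegral.integral_const_mul,
    intervalIntegral.integral_ofReal, intervalIntegral.integral_ofReal]
  · have : ∫ σ in (-1:ℝ)..1, (1 - |σ|) * Real.sin (σ * v) = 0 := by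
      have h := intervalIntegral.integral_comp_neg (a := -1) (b := 1)
        (fun σ : ℝ => (1 - |σ|) * Real.sin (σ * v))
      simp only [abs_neg, neg_mul, Real.sin_neg, mul_neg, neg_neg,
        intervalIntegral.integral_neg] at h
      linarith
    rw [this]; simp [kerK]
  · exact (by fun_prop : Continuous _).intervalIntegrable _ _
  · exact (by fun_prop : Continuous _).intervalIntegrable _ _

lemma kerK_eq_two (v : ℝ) : kerK v = 2 * ∫ σ in (0:ℝ)..1, (1 - σ) * Real.cos (σ * v) := by
  unfold kerK
  have hc : Continuous fun σ : ℝ => (1 - |σ|) * Real.cos (σ * v) := by fun_prop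
  rw [← intervalIntegral.integral_add_adjacent_intervals (b := 0) (hc.intervalIntegrable _ _)
    (hc.intervalIntegrable _ _)]
  have h := intervalIntegral.integral_comp_neg (a := 0) (b := 1)
        (fun σ : ℝ => (1 - |σ|) * Real.cos (σ * v))
  simp only [abs_neg, neg_mul, Real.cos_neg, neg_zero] at h
  rw [← h, two_mul]
  congr 1 <;>
  · apply intervalIntegral.integral_congr
    intro σ hσ
    rw [uIcc_of_le zero_le_one] at hσ
    simp [abs_of_nonneg hσ.1]

lemma kerK_formula (v : ℝ) : v ^ 2 * kerK v = 2 * (1 - Real.cos v) := by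
  rw [kerK_eq_two]
  have : ∫ σ in (0:ℝ)..1, v ^ 2 * ((1 - σ) * Real.cos (σ * v)) =
      ((1 - 1) * v * Real.sin (1 * v) - Real.cos (1 * v)) -
      ((1 - 0) * v * Real.sin (0 * v) - Real.cos (0 * v)) := by
    apply intervalIntegral.integral_eq_sub_of_hasDerivAt
      (f := fun σ => (1 - σ) * v * Real.sin (σ * v) - Real.cos (σ * v))
    · intro σ _
      have h1 : HasDerivAt (fun σ : ℝ => σ * v) v σ := by simpa using (hasDerivAt_id σ).mul_const v
      have h2 : HasDerivAt (fun σ : ℝ => (1 - σ) * v) (-v) σ := by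
        simpa using ((hasDerivAt_id σ).const_sub 1).mul_const v
      have h3 := (h2.mul h1.sin).sub h1.cos
      refine h3.congr_deriv ?_
      ring
    · exact (by fun_prop : Continuous _).intervalIntegrable _ _
  rw [intervalIntegral.integral_const_mul] at this
  simp at this
  linarith

lemma kerK_zero : kerK 0 = 1 := by
  rw [kerK_eq_two]
  simp only [mul_zero, Real.cos_zero, mul_one]
  rw [intervalIntegral.integral_sub (by simp) (by simp)]
  simp; norm_num

lemma kerK_nonneg (v : ℝ) : 0 ≤ kerK v := by
  rcases eq_or_ne v 0 with rfl | hv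
  · rw [kerK_zero]; norm_num
  · have := kerK_formula v
    have h2 := Real.cos_le_one v
    have : 0 ≤ v ^ 2 * kerK v := by linarith
    exact nonneg_of_mul_nonneg_right this (by positivity)

lemma kerK_le (v : ℝ) : kerK v ≤ 6 * (1 + v ^ 2)⁻¹ := by
  have h1 : kerK v ≤ 2 := by
    unfold kerK
    calc _ ≤ ∫ σ in (-1:ℝ)..1, (1:ℝ) := by
          apply intervalIntegral.integral_mono_on (by norm_num)
          · exact (by fun_prop : Continuous _).intervalIntegrable _ _
          · simp
          · intro x hx
            have := Real.cos_le_one (x * v)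
            have h3 : |x| ≤ 1 := abs_le.2 hx
            have := abs_nonneg x
            nlinarith [Real.neg_one_le_cos (x * v)]
      _ = 2 := by simp; norm_num
  have h2 := kerK_formula v
  have h3 := Real.neg_one_le_cos v
  rw [← div_eq_mul_inv, le_div_iff₀ (by positivity)]
  nlinarith

lemma kerK_integrable : Integrable kerK := by
  refine (integrable_inv_one_add_sq.const_mul 6).mono' kerK_cont.aestronglyMeasurable ?_
  filter_upwards with v
  rw [Real.norm_of_nonneg (kerK_nonneg v)]
  exact kerK_le v

lemma kerK_pos : 0 < ∫ v, kerK v := by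
  rw [integral_pos_iff_support_of_nonneg kerK_nonneg kerK_integrable]
  exact (kerK_cont.isOpen_support).measure_pos volume ⟨0, by simp [kerK_zero]⟩

noncomputable def HH (u : ℝ) : ℝ := Chebyshev.psi (Real.exp u) * Real.exp (-u)

lemma HH_nonneg (u : ℝ) : 0 ≤ HH u := mul_nonneg (Chebyshev.psi_nonneg _) (Real.exp_pos _).le

lemma HH_le (u : ℝ) : HH u ≤ 8 := by
  unfold HH
  have := Chebyshev.psi_le_const_mul_self (Real.exp_pos u).le
  have h4 : Real.log 4 ≤ 4 := by
    have := Real.log_le_sub_one_of_pos (x := 4) (by norm_num); linarith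
  rw [Real.exp_neg, ← div_eq_mul_inv, div_le_iff₀ (Real.exp_pos u)]
  nlinarith [Real.exp_pos u]

lemma HH_neg {u : ℝ} (hu : u ≤ 0) : HH u = 0 := by
  unfold HH
  rw [Chebyshev.psi_eq_zero_of_le_one (by simpa using hu), zero_mul]

lemma HH_meas : Measurable HH := by
  unfold HH
  exact (Chebyshev.psi_mono.measurable.comp Real.measurable_exp).mul (by fun_prop)

lemma HH_mono {u v : ℝ} (h : u ≤ v) : HH u * Real.exp (u - v) ≤ HH v := by
  unfold HH
  have : Chebyshev.psi (Real.exp u) ≤ Chebyshev.psi (Real.exp v) :=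
    Chebyshev.psi_mono (Real.exp_le_exp.2 h)
  rw [mul_assoc, ← Real.exp_add, show -u + (u - v) = -v by ring]
  exact mul_le_mul_of_nonneg_right this (Real.exp_pos _).le

open ArithmeticFunction in
lemma LSeries_psi {s : ℂ} (hs : 1 < s.re) :
    LSeries (fun n => (vonMangoldt n : ℂ)) s =
      s * ∫ t in Set.Ioi (1 : ℝ), (Chebyshev.psi t : ℂ) * (t:ℂ) ^ (-(s + 1)) := by
  have key : ∀ n : ℕ, ∑ k ∈ Finset.Icc 1 n, vonMangoldt k = Chebyshev.psi n := by
    intro n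
    rw [Chebyshev.psi]
    simp
    rfl
  rw [LSeries_eq_mul_integral_of_nonneg (fun n => vonMangoldt n) zero_le_one hs ?_ (fun n => vonMangoldt_nonneg)]
  · congr 1
    apply integral_congr_ae
    filter_upwards with t
    rw [Chebyshev.psi_eq_psi_coe_floor, ← key]
    push_cast; rfl
  · simp_rw [key]
    refine Asymptotics.IsBigO.of_bound (Real.log 4 + 4) ?_
    filter_upwards with n
    rw [Real.rpow_one, Real.norm_of_nonneg (Chebyshev.psi_nonneg _), Real.norm_of_nonneg (by positivity)]
    exact Chebyshev.psi_le_const_mul_self (by positivity)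

lemma LSeries_HH {s : ℂ} (hs : 1 < s.re) :
    LSeries (fun n => (ArithmeticFunction.vonMangoldt n : ℂ)) s =
      s * ∫ u in Set.Ioi (0 : ℝ), (HH u : ℂ) * Complex.exp (-(s - 1) * u) := by
  rw [LSeries_psi hs]
  congr 1
  have him : Real.exp '' Ioi 0 = Ioi 1 := by
    ext x; constructor
    · rintro ⟨y, hy, rfl⟩; simpa using hy
    · intro hx
      exact ⟨Real.log x, Real.log_pos hx, Real.exp_log (by linarith [mem_Ioi.1 hx])⟩
  rw [← him, integral_image_eq_integral_abs_deriv_smul measurableSet_Ioi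
    (fun x _ => (Real.hasDerivAt_exp x).hasDerivWithinAt) Real.exp_injective.injOn]
  apply integral_congr_ae
  filter_upwards with u
  rw [abs_of_pos (Real.exp_pos u), Complex.real_smul]
  have : ((Real.exp u : ℝ) : ℂ) ^ (-(s + 1)) = Complex.exp (-(s+1) * u) := by
    rw [Complex.cpow_def_of_ne_zero (by exact_mod_cast (Real.exp_pos u).ne'), ← Complex.ofReal_log (Real.exp_pos u).le,
      Real.log_exp, mul_comm]
  rw [this, HH]
  push_cast
  rw [show Complex.exp u * (((Chebyshev.psi (Real.exp u) : ℝ) : ℂ) * Complex.exp (-(s + 1) * u))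
    = (Chebyshev.psi (Real.exp u) : ℝ) * (Complex.exp u * Complex.exp (-(s + 1) * u)) by ring,
    mul_assoc, ← Complex.exp_add, ← Complex.exp_add]
  congr 2; ring

end

section
open Filter Topology MeasureTheory Set

noncomputable def GG (δ τ : ℝ) : ℂ :=
  (ArithmeticFunction.vonMangoldt.LFunctionResidueClassAux (1 : ZMod 1) (1 + (max δ 0 : ℝ) + Complex.I * τ) - 1)
    / (1 + (max δ 0 : ℝ) + Complex.I * τ)

lemma GG_cont : Continuous fun p : ℝ × ℝ => GG p.1 p.2 := by
  unfold GG
  have hre : ∀ p : ℝ × ℝ, (1 + ((max p.1 0 : ℝ) : ℂ) + Complex.I * (p.2 : ℂ)).re = 1 + max p.1 0 := by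
    intro p; simp
  have hc : Continuous fun p : ℝ × ℝ => (1 + ((max p.1 0 : ℝ) : ℂ) + Complex.I * (p.2 : ℂ)) := by
    fun_prop
  apply Continuous.div _ hc
  · intro p h
    have := congrArg Complex.re h
    rw [hre] at this
    simp at this
    have := le_max_right p.1 0
    linarith
  · apply Continuous.sub _ continuous_const
    refine (ArithmeticFunction.vonMangoldt.continuousOn_LFunctionResidueClassAux (1 : ZMod 1)).comp_continuous hc ?_
    intro p
    simp only [mem_ofPred_eq, hre]
    linarith [le_max_right p.1 0]

lemma HH_lap_integrable {z : ℂ} (hz : 0 < z.re) :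
    Integrable (fun u : ℝ => (HH u : ℂ) * Complex.exp (-z * u)) (volume.restrict (Ioi 0)) := by
  have h0 := integrableOn_exp_mul_complex_Ioi (a := -z) (by simpa using hz) 0
  refine Integrable.bdd_mul (c := 8) h0 (Complex.measurable_ofReal.comp HH_meas).aestronglyMeasurable ?_
  filter_upwards with u
  rw [Complex.norm_real, Real.norm_of_nonneg (HH_nonneg u)]
  exact HH_le u

lemma lap {δ : ℝ} (hδ : 0 < δ) (τ : ℝ) :
    ∫ u in Ioi (0:ℝ), ((HH u - 1 : ℝ) : ℂ) * Complex.exp (-(δ + Complex.I * τ) * u) = GG δ τ := by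
  set z : ℂ := δ + Complex.I * τ with hz
  have hzre : z.re = δ := by simp [hz]
  have hz0 : z ≠ 0 := by intro h; rw [h] at hzre; simp at hzre; linarith
  have h0 := integrableOn_exp_mul_complex_Ioi (a := -z) (by simpa [hzre] using hδ) 0
  have h1 := integral_exp_mul_complex_Ioi (a := -z) (by simpa [hzre] using hδ) 0
  have h2 := LSeries_HH (s := 1 + z) (by simp [hzre, hδ])
  have h3 := ArithmeticFunction.vonMangoldt.eqOn_LFunctionResidueClassAux (a := (1 : ZMod 1)) isUnit_one
    (x := 1 + z) (by simp [hzre, hδ])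
  have hres : (fun n => ((ArithmeticFunction.vonMangoldt.residueClass (1 : ZMod 1) n : ℝ) : ℂ)) =
      fun n => ((ArithmeticFunction.vonMangoldt n : ℝ) : ℂ) := by
    ext n
    unfold ArithmeticFunction.vonMangoldt.residueClass
    rw [indicator_of_mem]
    exact Subsingleton.elim (α := ZMod 1) _ _
  simp only [hres] at h3
  rw [h2] at h3
  have h4 : ∀ u : ℝ, ((HH u - 1 : ℝ) : ℂ) * Complex.exp (-z * u)
    = (HH u : ℂ) * Complex.exp (-z * u) - Complex.exp (-z * u) := by intro u; push_cast; ring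
  simp_rw [h4]
  rw [integral_sub (HH_lap_integrable (by rw [hzre]; exact hδ)) h0, h1]
  unfold GG
  rw [max_eq_left hδ.le, show (1 : ℂ) + δ + Complex.I * τ = 1 + z by rw [hz]; ring, h3]
  have h5 : (1 + z) ≠ 0 := by
    intro h; have := congrArg Complex.re h; simp [hzre] at this; linarith
  rw [show (1 : ℂ) + z - 1 = z by ring]
  simp
  field_simp
  ring

lemma HH_bound (u : ℝ) : ‖((HH u - 1 : ℝ) : ℂ)‖ ≤ 9 := by
  rw [Complex.norm_real, Real.norm_eq_abs, abs_le]
  constructor <;> linarith [HH_nonneg u, HH_le u]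

lemma fub {δ : ℝ} (hδ : 0 < δ) (l v : ℝ) :
    ∫ σ in (-1:ℝ)..1, ((1 - |σ| : ℝ) : ℂ) * Complex.exp (Complex.I * σ * (l * v : ℝ)) * GG δ (l * σ) =
    ∫ u in Ioi (0:ℝ), ((HH u - 1 : ℝ) : ℂ) * Complex.exp (-δ * u) * kerK (l * (v - u)) := by
  simp_rw [← lap hδ, ← integral_const_mul]
  rw [intervalIntegral.integral_of_le (by norm_num), integral_integral_swap]
  · apply integral_congr_ae
    filter_upwards with u
    rw [← kerK_complex, ← intervalIntegral.integral_const_mul, intervalIntegral.integral_of_le (by norm_num)]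
    apply integral_congr_ae
    filter_upwards with σ
    have : Complex.exp (Complex.I * σ * (l * v : ℝ)) * Complex.exp (-(δ + Complex.I * (l * σ : ℝ)) * u)
      = Complex.exp (-δ * u) * Complex.exp (Complex.I * σ * (l * (v - u) : ℝ)) := by
      rw [← Complex.exp_add, ← Complex.exp_add]; congr 1; push_cast; ring
    linear_combination ((1 - |σ| : ℝ) : ℂ) * ((HH u - 1 : ℝ) : ℂ) * this
  · have hb : Integrable (fun p : ℝ × ℝ => (1:ℝ) * (9 * Real.exp (-δ * p.2)))
        ((volume.restrict (Ioc (-1:ℝ) 1)).prod (volume.restrict (Ioi (0:ℝ)))) := by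
      apply Integrable.mul_prod (f := fun _ : ℝ => (1:ℝ)) (g := fun u : ℝ => 9 * Real.exp (-δ * u))
      · exact integrable_const _
      · exact (exp_neg_integrableOn_Ioi 0 hδ).const_mul 9
    refine hb.mono' ?_ ?_
    · have hm := HH_meas
      apply Measurable.aestronglyMeasurable
      unfold Function.uncurry
      fun_prop
    · have : ∀ᵐ p : ℝ × ℝ ∂((volume.restrict (Ioc (-1:ℝ) 1)).prod (volume.restrict (Ioi (0:ℝ)))),
          p ∈ Ioc (-1:ℝ) 1 ×ˢ Ioi (0:ℝ) := by
        rw [Measure.prod_restrict]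
        exact ae_restrict_mem (measurableSet_Ioc.prod measurableSet_Ioi)
      filter_upwards [this] with p hp
      simp only [Function.uncurry, norm_mul]
      have e1 : ‖Complex.exp (Complex.I * p.1 * (l * v : ℝ))‖ = 1 := by
        rw [Complex.norm_exp]; simp
      have e2 : ‖Complex.exp (-(δ + Complex.I * (l * p.1 : ℝ)) * p.2)‖ = Real.exp (-δ * p.2) := by
        rw [Complex.norm_exp]; simp
      rw [e1, e2]
      have e3 : ‖((1 - |p.1| : ℝ) : ℂ)‖ ≤ 1 := by
        have h1 := hp.1
        have : |p.1| ≤ 1 := abs_le.2 ⟨h1.1.le, h1.2⟩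
        rw [Complex.norm_real, Real.norm_eq_abs, abs_le]
        constructor <;> linarith [abs_nonneg p.1]
      have := HH_bound p.2
      rw [mul_one]
      gcongr

lemma kerK_comp_integrable {l : ℝ} (hl : 0 < l) (v : ℝ) : Integrable fun u => kerK (l * (v - u)) := by
  have := (kerK_integrable.comp_mul_left' hl.ne').comp_sub_left v
  exact this

lemma wiener {l : ℝ} (hl : 0 < l) (v : ℝ) :
    ∫ σ in (-1:ℝ)..1, ((1 - |σ| : ℝ) : ℂ) * Complex.exp (Complex.I * σ * (l * v : ℝ)) * GG 0 (l * σ) =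
    ∫ u in Ioi (0:ℝ), ((HH u - 1 : ℝ) : ℂ) * kerK (l * (v - u)) := by
  have h1 : Tendsto (fun δ : ℝ => ∫ σ in (-1:ℝ)..1, ((1 - |σ| : ℝ) : ℂ) *
      Complex.exp (Complex.I * σ * (l * v : ℝ)) * GG δ (l * σ)) (𝓝[>] 0)
      (𝓝 (∫ σ in (-1:ℝ)..1, ((1 - |σ| : ℝ) : ℂ) *
      Complex.exp (Complex.I * σ * (l * v : ℝ)) * GG 0 (l * σ))) := by
    have : Continuous (fun δ : ℝ => ∫ σ in (-1:ℝ)..1, ((1 - |σ| : ℝ) : ℂ) *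
      Complex.exp (Complex.I * σ * (l * v : ℝ)) * GG δ (l * σ)) := by
      apply intervalIntegral.continuous_parametric_intervalIntegral_of_continuous'
      have := GG_cont.comp (show Continuous fun p : ℝ × ℝ => (p.1, l * p.2) by fun_prop)
      unfold Function.uncurry
      refine Continuous.mul (by fun_prop) this
    exact (this.tendsto 0).mono_left nhdsWithin_le_nhds
  have h2 : Tendsto (fun δ : ℝ => ∫ u in Ioi (0:ℝ), ((HH u - 1 : ℝ) : ℂ) * Complex.exp (-δ * u) * kerK (l * (v - u)))
      (𝓝[>] 0) (𝓝 (∫ u in Ioi (0:ℝ), ((HH u - 1 : ℝ) : ℂ) * kerK (l * (v - u)))) := by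
    apply tendsto_integral_filter_of_dominated_convergence (fun u => 9 * kerK (l * (v - u)))
    · filter_upwards with δ
      have hm := HH_meas
      have hk := kerK_cont.measurable
      apply Measurable.aestronglyMeasurable
      fun_prop
    · filter_upwards [self_mem_nhdsWithin] with δ hδ
      filter_upwards [ae_restrict_mem measurableSet_Ioi] with u hu
      rw [norm_mul, norm_mul, Complex.norm_real (kerK _), Real.norm_of_nonneg (kerK_nonneg _)]
      have e2 : ‖Complex.exp (-δ * u)‖ ≤ 1 := by
        rw [Complex.norm_exp]; simp
        exact mul_nonneg (le_of_lt hδ) (le_of_lt hu)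
      have := HH_bound u
      have := kerK_nonneg (l * (v - u))
      calc _ ≤ 9 * 1 * kerK (l * (v - u)) := by gcongr
        _ = _ := by ring
    · exact ((kerK_comp_integrable hl v).const_mul 9).restrict
    · filter_upwards with u
      have : Continuous fun δ : ℝ => ((HH u - 1 : ℝ) : ℂ) * Complex.exp (-δ * u) * kerK (l * (v - u)) := by fun_prop
      have := (this.tendsto 0).mono_left (nhdsWithin_le_nhds (s := Ioi 0))
      simpa using this
  refine tendsto_nhds_unique h1 (h2.congr' ?_)
  filter_upwards [self_mem_nhdsWithin] with δ hδ
  exact (fub hδ l v).symm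

lemma wiener_tendsto {l : ℝ} (hl : 0 < l) :
    Tendsto (fun v => ∫ u in Ioi (0:ℝ), ((HH u - 1 : ℝ) : ℂ) * kerK (l * (v - u))) atTop (𝓝 0) := by
  simp_rw [← wiener hl]
  have h := Real.tendsto_integral_exp_smul_cocompact
    ((Ioc (-1:ℝ) 1).indicator fun σ => ((1 - |σ| : ℝ) : ℂ) * GG 0 (l * σ))
  have h2 : Tendsto (fun v : ℝ => -(l * v / (2 * Real.pi))) atTop (cocompact ℝ) := by
    refine Tendsto.mono_right ?_ atBot_le_cocompact
    apply tendsto_neg_atTop_atBot.comp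
    apply Tendsto.atTop_div_const (by positivity)
    exact tendsto_id.const_mul_atTop hl
  refine (h.comp h2).congr ?_
  intro v
  rw [intervalIntegral.integral_of_le (by norm_num), ← integral_indicator measurableSet_Ioc]
  simp only [Function.comp]
  congr 1
  ext σ
  by_cases hσ : σ ∈ Ioc (-1:ℝ) 1
  · rw [indicator_of_mem hσ, indicator_of_mem hσ, Circle.smul_def, Real.fourierChar_apply, smul_eq_mul]
    have : (2 * Real.pi * -(σ * -(l * v / (2 * Real.pi)))) = σ * (l * v) := by
      field_simp
    rw [this, show ((σ * (l * v) : ℝ) : ℂ) * Complex.I = Complex.I * σ * (l * v : ℝ) by push_cast; ring]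
    ring
  · rw [indicator_of_notMem hσ, indicator_of_notMem hσ, smul_zero]

end

section
open Filter Topology MeasureTheory Set

lemma HHk_integrable {l : ℝ} (hl : 0 < l) (v : ℝ) : Integrable fun u => HH u * kerK (l * (v - u)) := by
  refine Integrable.bdd_mul (c := 8) (kerK_comp_integrable hl v) HH_meas.aestronglyMeasurable ?_
  filter_upwards with u
  rw [Real.norm_of_nonneg (HH_nonneg u)]
  exact HH_le u

lemma kerK_shift_integral {l : ℝ} (hl : 0 < l) (v : ℝ) : ∫ u, kerK (l * (v - u)) = l⁻¹ * ∫ w, kerK w := by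
  rw [integral_sub_left_eq_self (fun u => kerK (l * u)) volume v, Measure.integral_comp_mul_left,
    abs_of_pos (by positivity), smul_eq_mul]

lemma kerK_half_tendsto {l : ℝ} (hl : 0 < l) :
    Tendsto (fun v => ∫ u in Ioi (0:ℝ), kerK (l * (v - u))) atTop (𝓝 (l⁻¹ * ∫ w, kerK w)) := by
  have h0 : Tendsto (fun v : ℝ => ∫ w, (Iio v).indicator (fun w => kerK (l * w)) w) atTop (𝓝 (∫ w, kerK (l * w))) := by
    have hi := kerK_integrable.comp_mul_left' hl.ne'
    apply tendsto_integral_filter_of_dominated_convergence (fun w => kerK (l * w))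
    · filter_upwards with v
      exact (hi.indicator measurableSet_Iio).aestronglyMeasurable
    · filter_upwards with v
      filter_upwards with w
      rw [norm_indicator_eq_indicator_norm]
      refine (indicator_le_self' (fun _ _ => norm_nonneg _) w).trans ?_
      rw [Real.norm_of_nonneg (kerK_nonneg _)]
    · exact hi
    · filter_upwards with w
      apply tendsto_const_nhds.congr'
      filter_upwards [eventually_gt_atTop w] with v hv
      rw [indicator_of_mem (by exact hv)]
  rw [Measure.integral_comp_mul_left, abs_of_pos (by positivity), smul_eq_mul] at h0
  refine h0.congr ?_
  intro v
  rw [← integral_sub_left_eq_self _ volume v, ← integral_indicator measurableSet_Ioi]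
  congr 1
  ext u
  by_cases hu : 0 < u
  · rw [indicator_of_mem (by simp [hu]), indicator_of_mem (by simp [hu])]
  · rw [indicator_of_notMem (by simpa using hu), indicator_of_notMem (by simpa using hu)]

lemma HHk_tendsto {l : ℝ} (hl : 0 < l) :
    Tendsto (fun v => ∫ u, HH u * kerK (l * (v - u))) atTop (𝓝 (l⁻¹ * ∫ w, kerK w)) := by
  have h1 := (Complex.continuous_re.tendsto _).comp (wiener_tendsto hl)
  simp only [Complex.zero_re] at h1
  have h2 := h1.add (kerK_half_tendsto hl)
  rw [zero_add] at h2
  refine h2.congr ?_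
  intro v
  have e1 : ∫ u in Ioi (0:ℝ), ((HH u - 1 : ℝ) : ℂ) * kerK (l * (v - u)) =
      ((∫ u in Ioi (0:ℝ), (HH u - 1) * kerK (l * (v - u)) : ℝ) : ℂ) := by
    rw [← integral_complex_ofReal]; push_cast; rfl
  simp only [Function.comp]
  rw [e1, Complex.ofReal_re, ← integral_add]
  · rw [← integral_indicator measurableSet_Ioi]
    congr 1
    ext u
    by_cases hu : 0 < u
    · rw [indicator_of_mem (by simpa using hu)]; ring
    · rw [indicator_of_notMem (by simpa using hu), HH_neg (by linarith)]; ring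
  · have := ((HHk_integrable hl v).sub (kerK_comp_integrable hl v)).restrict (s := Ioi (0:ℝ))
    refine this.congr ?_
    filter_upwards with u
    simp; ring
  · exact (kerK_comp_integrable hl v).restrict

lemma kerK_mid {l a : ℝ} (hl : 0 < l) (v : ℝ) :
    ∫ u in Icc (v - a) (v + a), kerK (l * (v - u)) = l⁻¹ * ∫ w in Icc (-(l * a)) (l * a), kerK w := by
  rw [← integral_indicator measurableSet_Icc, ← integral_indicator measurableSet_Icc]
  have h1 : ∀ u, (Icc (v - a) (v + a)).indicator (fun u => kerK (l * (v - u))) u =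
      (Icc (-(l*a)) (l*a)).indicator kerK (l * (v - u)) := by
    intro u
    by_cases hu : u ∈ Icc (v - a) (v + a)
    · rw [indicator_of_mem hu, indicator_of_mem]
      constructor <;> nlinarith [hu.1, hu.2]
    · rw [indicator_of_notMem hu, indicator_of_notMem]
      intro h
      apply hu
      constructor
      · by_contra hc; push Not at hc; nlinarith [h.1, h.2]
      · by_contra hc; push Not at hc; nlinarith [h.1, h.2]
  simp_rw [h1]
  rw [integral_sub_left_eq_self (fun u => (Icc (-(l*a)) (l*a)).indicator kerK (l * u)) volume v,
    Measure.integral_comp_mul_left, abs_of_pos (by positivity), smul_eq_mul]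

lemma kerK_mid_tendsto : Tendsto (fun r : ℝ => ∫ w in Icc (-r) r, kerK w) atTop (𝓝 (∫ w, kerK w)) := by
  have h := intervalIntegral_tendsto_integral kerK_integrable tendsto_neg_atTop_atBot tendsto_id
  refine h.congr' ?_
  filter_upwards [eventually_ge_atTop 0] with r hr
  simp only [id]
  rw [intervalIntegral.integral_of_le (by linarith), integral_Icc_eq_integral_Ioc]

lemma HH_upper {a : ℝ} (ha : 0 < a) {η : ℝ} (hη : 0 < η) (hη1 : η < 1) :
    ∀ᶠ v in atTop, HH v ≤ Real.exp (2 * a) * ((1 + η) / (1 - η)) := by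
  set c := ∫ w, kerK w with hc
  have hcpos : 0 < c := kerK_pos
  obtain ⟨r, hr0, hr⟩ : ∃ r : ℝ, 0 < r ∧ (1 - η) * c < ∫ w in Icc (-r) r, kerK w := by
    have h := kerK_mid_tendsto.eventually (lt_mem_nhds (show (1 - η) * c < c by nlinarith))
    obtain ⟨r, h1, h2⟩ := (h.and (eventually_gt_atTop 0)).exists
    exact ⟨r, h2, h1⟩
  set l := r / a with hl
  have hlpos : 0 < l := by positivity
  have hla : l * a = r := by rw [hl]; field_simp
  have ht := (HHk_tendsto hlpos).eventually (gt_mem_nhds (show l⁻¹ * c < l⁻¹ * ((1 + η) * c) by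
    have : 0 < l⁻¹ := by positivity
    have : 0 < η * c := by positivity
    nlinarith))
  have ht2 := (tendsto_atTop_add_const_right atTop a tendsto_id).eventually ht
  filter_upwards [ht2] with v hv
  simp only [id] at hv
  have hge : HH v * Real.exp (-(2 * a)) * (l⁻¹ * ∫ w in Icc (-r) r, kerK w) ≤
      ∫ u, HH u * kerK (l * (v + a - u)) := by
    rw [← hla, ← kerK_mid hlpos (v + a), ← integral_const_mul]
    refine le_trans ?_ (setIntegral_le_integral (s := Icc (v + a - a) (v + a + a)) (HHk_integrable hlpos _) ?_)
    · apply setIntegral_mono_on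
      · exact ((kerK_comp_integrable hlpos _).const_mul _).integrableOn
      · exact (HHk_integrable hlpos _).integrableOn
      · exact measurableSet_Icc
      · intro u hu
        apply mul_le_mul_of_nonneg_right _ (kerK_nonneg _)
        refine le_trans ?_ (HH_mono (show v ≤ u by linarith [hu.1]))
        apply mul_le_mul_of_nonneg_left _ (HH_nonneg v)
        apply Real.exp_le_exp.2
        linarith [hu.2]
    · filter_upwards with u
      exact mul_nonneg (HH_nonneg _) (kerK_nonneg _)
  have h3 := hge.trans hv.le
  have hx : 0 ≤ HH v * Real.exp (-(2 * a)) := mul_nonneg (HH_nonneg _) (Real.exp_pos _).le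
  have h4 : HH v * Real.exp (-(2 * a)) * ((1 - η) * c) ≤ (1 + η) * c := by
    have h5 : l⁻¹ * (HH v * Real.exp (-(2 * a)) * ∫ w in Icc (-r) r, kerK w) ≤ l⁻¹ * ((1 + η) * c) := by
      linarith
    have h6 := le_of_mul_le_mul_left h5 (by positivity)
    exact (mul_le_mul_of_nonneg_left hr.le hx).trans h6
  have h7 : HH v * Real.exp (-(2 * a)) * (1 - η) ≤ (1 + η) := by
    apply le_of_mul_le_mul_right _ hcpos
    linarith
  rw [Real.exp_neg] at h7
  rw [← mul_div_assoc, le_div_iff₀ (by linarith)]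
  have he := Real.exp_pos (2 * a)
  calc HH v * (1 - η) = Real.exp (2*a) * (HH v * (Real.exp (2*a))⁻¹ * (1 - η)) := by field_simp
    _ ≤ _ := mul_le_mul_of_nonneg_left h7 he.le

lemma HH_lower {a : ℝ} (ha : 0 < a) {η : ℝ} (hη : 0 < η) :
    ∀ᶠ v in atTop, Real.exp (-(2 * a)) * (1 - 9 * η) ≤ HH v := by
  set c := ∫ w, kerK w with hc
  have hcpos : 0 < c := kerK_pos
  obtain ⟨r, hr0, hr⟩ : ∃ r : ℝ, 0 < r ∧ (1 - η) * c < ∫ w in Icc (-r) r, kerK w := by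
    have h := kerK_mid_tendsto.eventually (lt_mem_nhds (show (1 - η) * c < c by nlinarith))
    obtain ⟨r, h1, h2⟩ := (h.and (eventually_gt_atTop 0)).exists
    exact ⟨r, h2, h1⟩
  set l := r / a with hl
  have hlpos : 0 < l := by positivity
  have hla : l * a = r := by rw [hl]; field_simp
  have ht := (HHk_tendsto hlpos).eventually (lt_mem_nhds (show l⁻¹ * ((1 - η) * c) < l⁻¹ * c by
    have : 0 < l⁻¹ := by positivity
    have : 0 < η * c := by positivity
    nlinarith))
  have ht2 := (tendsto_atTop_add_const_right atTop (-a) tendsto_id).eventually ht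
  filter_upwards [ht2] with v hv
  simp only [id] at hv
  have hle : ∫ u, HH u * kerK (l * (v + -a - u)) ≤ HH v * Real.exp (2 * a) * (l⁻¹ * c) +
      8 * (l⁻¹ * c - l⁻¹ * ∫ w in Icc (-r) r, kerK w) := by
    have hk := kerK_comp_integrable hlpos (v + -a)
    rw [← hla, ← kerK_mid hlpos (v + -a), ← kerK_shift_integral hlpos (v + -a),
      ← integral_indicator measurableSet_Icc, ← integral_sub hk (hk.indicator measurableSet_Icc),
      ← integral_const_mul, ← integral_const_mul]
    have hk2 : Integrable fun u => 8 * (kerK (l * (v + -a - u)) -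
        (Icc (v + -a - a) (v + -a + a)).indicator (fun u => kerK (l * (v + -a - u))) u) :=
      (hk.sub (hk.indicator measurableSet_Icc)).const_mul 8
    rw [← integral_add (hk.const_mul _) hk2]
    apply integral_mono (HHk_integrable hlpos _)
    · exact (hk.const_mul _).add hk2
    · intro u
      simp only
      have hk0 := kerK_nonneg (l * (v + -a - u))
      by_cases hu : u ∈ Icc (v + -a - a) (v + -a + a)
      · rw [indicator_of_mem hu, sub_self, mul_zero, add_zero]
        apply mul_le_mul_of_nonneg_right _ hk0
        have h1 := HH_mono (show u ≤ v by linarith [hu.2])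
        have h2 : HH u = HH u * Real.exp (u - v) * Real.exp (v - u) := by
          rw [mul_assoc, ← Real.exp_add]; simp
        rw [h2]
        apply mul_le_mul h1 _ (Real.exp_pos _).le (HH_nonneg v)
        apply Real.exp_le_exp.2
        linarith [hu.1]
      · rw [indicator_of_notMem hu, sub_zero]
        have h1 := mul_le_mul_of_nonneg_right (HH_le u) hk0
        have h2 : 0 ≤ HH v * Real.exp (2 * a) * kerK (l * (v + -a - u)) :=
          mul_nonneg (mul_nonneg (HH_nonneg _) (Real.exp_pos _).le) hk0
        linarith
  have h3 := hv.le.trans hle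
  have h4 : (1 - η) * c ≤ HH v * Real.exp (2 * a) * c + 8 * (c - (1 - η) * c) := by
    have h5 : l⁻¹ * ((1 - η) * c) ≤ l⁻¹ * (HH v * Real.exp (2 * a) * c + 8 * (c - ∫ w in Icc (-r) r, kerK w)) := by
      linarith
    have h6 := le_of_mul_le_mul_left h5 (by positivity)
    linarith
  have h7 : (1 - 9 * η) ≤ HH v * Real.exp (2 * a) := by
    apply le_of_mul_le_mul_right _ hcpos
    linarith
  rw [Real.exp_neg]
  have he := Real.exp_pos (2 * a)
  rw [inv_mul_le_iff₀ he]; linarith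

lemma HH_tendsto : Tendsto HH atTop (𝓝 1) := by
  apply tendsto_order.2
  constructor
  · intro b hb
    have hc : Tendsto (fun a : ℝ => Real.exp (-(2 * a)) * (1 - 9 * a)) (𝓝[>] 0) (𝓝 1) := by
      have : Continuous (fun a : ℝ => Real.exp (-(2 * a)) * (1 - 9 * a)) := by fun_prop
      simpa using (this.tendsto 0).mono_left (nhdsWithin_le_nhds (s := Ioi 0))
    obtain ⟨a, h1, h2⟩ := ((hc.eventually (lt_mem_nhds hb)).and self_mem_nhdsWithin).exists
    filter_upwards [HH_lower (a := a) h2 (η := a) h2] with v hv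
    linarith
  · intro b hb
    have hc : Tendsto (fun a : ℝ => Real.exp (2 * a) * ((1 + a) / (1 - a))) (𝓝[>] 0) (𝓝 1) := by
      have : ContinuousAt (fun a : ℝ => Real.exp (2 * a) * ((1 + a) / (1 - a))) 0 := by
        apply ContinuousAt.mul (by fun_prop)
        apply ContinuousAt.div (by fun_prop) (by fun_prop) (by norm_num)
      have h := this.tendsto.mono_left (nhdsWithin_le_nhds (s := Ioi 0))
      simpa using h
    obtain ⟨a, ⟨h1, h3⟩, h2⟩ := (((hc.eventually (gt_mem_nhds hb)).and
      (nhdsWithin_le_nhds (gt_mem_nhds (show (0:ℝ) < 1 by norm_num)))).and (self_mem_nhdsWithin (s := Ioi (0:ℝ)))).exists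
    filter_upwards [HH_upper (a := a) h2 (η := a) h2 h3] with v hv
    linarith

theorem pnt_psi : Tendsto (fun x => Chebyshev.psi x / x) atTop (𝓝 1) := by
  refine (HH_tendsto.comp Real.tendsto_log_atTop).congr' ?_
  filter_upwards [eventually_gt_atTop 0] with x hx
  simp [HH, Real.exp_log hx, Real.exp_neg, div_eq_mul_inv]

theorem pnt_theta : Tendsto (fun x => Chebyshev.theta x / x) atTop (𝓝 1) := by
  have h1 : Tendsto (fun x : ℝ => (Chebyshev.psi x - Chebyshev.theta x) / x) atTop (𝓝 0) := by
    obtain ⟨C, hC⟩ := Chebyshev.psi_sub_theta_le_mul_sqrt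
    have h2 : Tendsto (fun x : ℝ => C * (Real.sqrt x)⁻¹) atTop (𝓝 (C * 0)) :=
      (tendsto_inv_atTop_zero.comp Real.tendsto_sqrt_atTop).const_mul C
    rw [mul_zero] at h2
    refine squeeze_zero' ?_ ?_ h2
    · filter_upwards [eventually_gt_atTop 0] with x hx
      exact div_nonneg (sub_nonneg.2 (Chebyshev.theta_le_psi x)) hx.le
    · filter_upwards [eventually_gt_atTop 0] with x hx
      rw [div_le_iff₀ hx, mul_assoc]
      refine (hC x).trans_eq ?_
      congr 1
      have := Real.mul_self_sqrt hx.le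
      have hs := Real.sqrt_pos.2 hx
      field_simp
      nlinarith
  have := pnt_psi.sub h1
  rw [sub_zero] at this
  refine this.congr ?_
  intro x; ring

end

section
open Polynomial

noncomputable section

def ww : ℂ := -1/2 + (Real.sqrt 3 / 2 : ℝ) * Complex.I
def xx : ℂ := 1 - ww

lemma ww_sq : ww ^ 2 = -1 - ww := by
  have h : ((Real.sqrt 3 : ℝ) : ℂ) ^ 2 = 3 := by
    rw [← Complex.ofReal_pow, Real.sq_sqrt (by norm_num)]; norm_num
  unfold ww
  push_cast
  linear_combination (1/4) * Complex.I ^ 2 * h + (3/4) * Complex.I_sq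

lemma ww_ne : ww ≠ 0 := by
  intro h
  have := ww_sq
  rw [h] at this
  norm_num at this

def EisInt (z : ℂ) : Prop := ∃ a b : ℤ, z = a + b * ww

lemma EisInt.add {z w : ℂ} (hz : EisInt z) (hw : EisInt w) : EisInt (z + w) := by
  obtain ⟨a, b, rfl⟩ := hz
  obtain ⟨c, d, rfl⟩ := hw
  exact ⟨a + c, b + d, by push_cast; ring⟩

lemma EisInt.neg {z : ℂ} (hz : EisInt z) : EisInt (-z) := by
  obtain ⟨a, b, rfl⟩ := hz
  exact ⟨-a, -b, by push_cast; ring⟩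

lemma EisInt.mul {z w : ℂ} (hz : EisInt z) (hw : EisInt w) : EisInt (z * w) := by
  obtain ⟨a, b, rfl⟩ := hz
  obtain ⟨c, d, rfl⟩ := hw
  refine ⟨a * c - b * d, a * d + b * c - b * d, ?_⟩
  push_cast
  linear_combination (b * d : ℂ) * ww_sq

lemma EisInt.int (a : ℤ) : EisInt a := ⟨a, 0, by simp⟩
lemma EisInt.one : EisInt 1 := ⟨1, 0, by simp⟩
lemma EisInt.x : EisInt xx := ⟨1, -1, by simp [xx]; ring⟩
lemma EisInt.winv : EisInt ww⁻¹ := ⟨-1, -1, by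
  field_simp [ww_ne]
  push_cast
  linear_combination ww_sq⟩
lemma EisInt.pow {z : ℂ} (hz : EisInt z) (n : ℕ) : EisInt (z ^ n) := by
  induction n with
  | zero => simpa using EisInt.one
  | succ k ih => rw [pow_succ]; exact ih.mul hz
lemma EisInt.sum {ι : Type*} (s : Finset ι) (f : ι → ℂ) (h : ∀ i ∈ s, EisInt (f i)) :
    EisInt (∑ i ∈ s, f i) := by
  classical
  induction s using Finset.induction_on with
  | empty => simpa using EisInt.int 0
  | insert a s ha ih =>
    rw [Finset.sum_insert ha]
    exact (h a (by simp)).add (ih fun i hi => h i (by simp [hi]))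

lemma EisInt.one_le {z : ℂ} (hz : EisInt z) (h0 : z ≠ 0) : 1 ≤ ‖z‖ := by
  obtain ⟨a, b, rfl⟩ := hz
  have h3 : Real.sqrt 3 ^ 2 = 3 := Real.sq_sqrt (by norm_num)
  have hn : Complex.normSq (a + b * ww) = ((a ^ 2 - a * b + b ^ 2 : ℤ) : ℝ) := by
    unfold ww
    simp [Complex.normSq_apply]
    nlinarith
  have hpos : 0 < Complex.normSq (a + b * ww) := Complex.normSq_pos.2 h0
  rw [hn] at hpos
  have : (1 : ℤ) ≤ a ^ 2 - a * b + b ^ 2 := by exact_mod_cast hpos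
  have h1 : (1 : ℝ) ≤ ‖(a + b * ww : ℂ)‖ ^ 2 := by
    rw [← Complex.normSq_eq_norm_sq, hn]; exact_mod_cast this
  nlinarith [norm_nonneg (a + b * ww : ℂ)]

def del : ℂ[X] →ₗ[ℂ] ℂ[X] := taylor (1:ℂ) - LinearMap.id

lemma del_eval (P : ℂ[X]) (t : ℂ) : (del P).eval t = P.eval (t + 1) - P.eval t := by
  simp [del, taylor_eval]

lemma del_derivative (P : ℂ[X]) : derivative (del P) = del (derivative P) := by
  simp [del, taylor_apply, derivative_comp]

lemma del_natDegree_le (P : ℂ[X]) : (del P).natDegree ≤ P.natDegree := by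
  simp only [del, LinearMap.sub_apply, LinearMap.id_apply]
  refine (natDegree_sub_le _ _).trans ?_
  simp [natDegree_taylor]

lemma del_pow_natDegree_le (P : ℂ[X]) (m : ℕ) : ((del ^ m) P).natDegree ≤ P.natDegree := by
  induction m with
  | zero => simp
  | succ k ih =>
    rw [pow_succ', Module.End.mul_apply]
    exact (del_natDegree_le _).trans ih

lemma del_pow_eq_zero (N : ℕ) : ∀ P : ℂ[X], P.natDegree < N → (del ^ N) P = 0 := by
  induction N with
  | zero => intro P h; omega
  | succ k ih =>
    intro P h
    rw [pow_succ, Module.End.mul_apply]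
    by_cases hd : P.natDegree = 0
    · obtain ⟨a, rfl⟩ := natDegree_eq_zero.1 hd
      simp [del]
    · apply ih
      have hP : P ≠ 0 := by rintro rfl; simp at hd
      have h1 : (taylor (1:ℂ) P - P).degree < (taylor (1:ℂ) P).degree := by
        apply degree_sub_lt_left
        · rw [degree_taylor]
        · intro h0; exact hP ((taylor_eq_zero _ _).1 h0)
        · rw [leadingCoeff_taylor]
      have h2 : (del P).natDegree < P.natDegree := by
        rw [degree_taylor] at h1
        by_cases h0 : del P = 0
        · rw [h0, natDegree_zero]; omega
        · exact natDegree_lt_natDegree h0 h1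
      omega

def Sop (N : ℕ) (P : ℂ[X]) : ℂ[X] :=
  -∑ m ∈ Finset.range N, (xx ^ m * (ww⁻¹) ^ (m + 1)) • (del ^ m) P

lemma Sop_add (N : ℕ) (P Q : ℂ[X]) : Sop N (P + Q) = Sop N P + Sop N Q := by
  simp [Sop, Finset.sum_add_distrib]; ring

lemma Sop_smul (N : ℕ) (c : ℂ) (P : ℂ[X]) : Sop N (c • P) = c • Sop N P := by
  simp only [Sop, map_smul, smul_neg, Finset.smul_sum]
  congr 1
  apply Finset.sum_congr rfl
  intro i _
  rw [smul_comm]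

lemma Sop_derivative (N : ℕ) (P : ℂ[X]) : derivative (Sop N P) = Sop N (derivative P) := by
  have : ∀ m : ℕ, derivative ((del ^ m) P) = (del ^ m) (derivative P) := by
    intro m
    induction m with
    | zero => simp
    | succ k ih => rw [pow_succ', Module.End.mul_apply, Module.End.mul_apply, del_derivative, ih]
  simp [Sop, this, derivative_smul]

lemma Sop_eq {N : ℕ} {P : ℂ[X]} (h : (del ^ N) P = 0) :
    xx • taylor (1:ℂ) (Sop N P) - Sop N P = P := by
  have hdel : taylor (1:ℂ) (Sop N P) = del (Sop N P) + Sop N P := by simp [del]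
  rw [hdel]
  have hx : xx = 1 - ww := rfl
  have h1 : del (Sop N P) = -∑ m ∈ Finset.range N, (xx ^ m * (ww⁻¹) ^ (m + 1)) • (del ^ (m+1)) P := by
    simp [Sop, pow_succ' del]
  have key : ∀ n : ℕ, xx • (-∑ m ∈ Finset.range n, (xx ^ m * (ww⁻¹) ^ (m + 1)) • (del ^ (m+1)) P)
      - ww • (-∑ m ∈ Finset.range n, (xx ^ m * (ww⁻¹) ^ (m + 1)) • (del ^ m) P)
      = P - (xx ^ n * (ww⁻¹) ^ n) • (del ^ n) P := by
    intro n
    induction n with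
    | zero => simp
    | succ k ih =>
      rw [Finset.sum_range_succ, Finset.sum_range_succ, neg_add, neg_add, smul_add, smul_add,
        add_sub_add_comm, ih]
      have e : ww * (xx ^ k * (ww⁻¹) ^ (k + 1)) = xx ^ k * (ww⁻¹) ^ k := by
        have := mul_inv_cancel₀ ww_ne
        rw [pow_succ]; linear_combination (xx ^ k * (ww⁻¹) ^ k) * this
      simp only [smul_neg, smul_smul, e]
      rw [pow_succ xx]
      rw [show xx * (xx ^ k * ww⁻¹ ^ (k + 1)) = xx ^ k * xx * ww⁻¹ ^ (k + 1) by ring]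
      module
  have hk := key N
  rw [h, smul_zero, sub_zero, ← h1] at hk
  have e2 : Sop N P = -∑ m ∈ Finset.range N, (xx ^ m * (ww⁻¹) ^ (m + 1)) • (del ^ m) P := rfl
  rw [← e2] at hk
  rw [smul_add, show xx • Sop N P = Sop N P - ww • Sop N P by rw [hx, sub_smul, one_smul]]
  rw [← add_sub_assoc, sub_right_comm, add_sub_cancel_right, hk]

lemma del_pow_int {P : ℂ[X]} {c : ℂ} (h : ∀ k : ℤ, ∃ a : ℤ, c * P.eval (k : ℂ) = a) (m : ℕ) :
    ∀ k : ℤ, ∃ a : ℤ, c * ((del ^ m) P).eval (k : ℂ) = a := by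
  induction m with
  | zero => simpa using h
  | succ j ih =>
    intro k
    rw [pow_succ', Module.End.mul_apply, del_eval]
    obtain ⟨a, ha⟩ := ih (k + 1)
    obtain ⟨b, hb⟩ := ih k
    refine ⟨a - b, ?_⟩
    push_cast at ha ⊢
    rw [mul_sub, ha, hb]

lemma Sop_int {P : ℂ[X]} {c : ℂ} (h : ∀ k : ℤ, ∃ a : ℤ, c * P.eval (k : ℂ) = a) (N : ℕ) :
    EisInt (c * (Sop N P).eval 0) := by
  rw [Sop, eval_neg, eval_finsetSum, mul_neg, Finset.mul_sum]
  apply EisInt.neg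
  apply EisInt.sum
  intro m _
  obtain ⟨a, ha⟩ := del_pow_int h m 0
  rw [eval_smul, smul_eq_mul, show c * (xx ^ m * ww⁻¹ ^ (m + 1) * eval 0 ((del ^ m) P)) =
    (xx ^ m * ww⁻¹ ^ (m + 1)) * (c * eval 0 ((del ^ m) P)) by ring]
  rw [Int.cast_zero] at ha
  rw [ha]
  exact ((EisInt.x.pow _).mul (EisInt.winv.pow _)).mul (EisInt.int a)

lemma Sop_natDegree (N : ℕ) (P : ℂ[X]) : (Sop N P).natDegree ≤ P.natDegree := by
  rw [Sop, natDegree_neg]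
  apply natDegree_sum_le_of_forall_le
  intro m _
  exact (natDegree_smul_le _ _).trans (del_pow_natDegree_le P m)

lemma Sop_eval {N : ℕ} {P : ℂ[X]} (h : P.natDegree < N) (t : ℂ) :
    xx * (Sop N P).eval (t + 1) - (Sop N P).eval t = P.eval t := by
  have := congrArg (eval t) (Sop_eq (del_pow_eq_zero N P h))
  simpa [taylor_eval] using this

def bP (N : ℕ) (a : ℤ) : ℂ[X] :=
  C (1 / (N.factorial : ℂ)) * ∏ i ∈ Finset.range N, (X + C ((a : ℂ) - i))

def RR (n : ℕ) : ℂ[X] := bP (5 * n) (6 * n) * bP (5 * n) (5 * n) * bP (5 * n) (4 * n)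

lemma bP_natDegree (N : ℕ) (a : ℤ) : (bP N a).natDegree ≤ N := by
  unfold bP
  refine (natDegree_C_mul_le _ _).trans ?_
  refine (natDegree_prod_le _ _).trans ?_
  refine (Finset.sum_le_sum (fun i _ => natDegree_X_add_C _ |>.le)).trans ?_
  simp

lemma bP_ne (N : ℕ) (a : ℤ) : bP N a ≠ 0 := by
  unfold bP
  apply mul_ne_zero
  · rw [Ne, C_eq_zero]; simp [Nat.factorial_ne_zero]
  · exact Finset.prod_ne_zero_iff.2 fun i _ => X_add_C_ne_zero _

lemma bP_dvd (N : ℕ) (a k : ℤ) (h1 : -a ≤ k) (h2 : k < N - a) : X - C (k : ℂ) ∣ bP N a := by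
  unfold bP
  apply Dvd.dvd.mul_left
  have hm : (k + a).toNat ∈ Finset.range N := by rw [Finset.mem_range]; omega
  refine dvd_trans ?_ (Finset.dvd_prod_of_mem _ hm)
  have : ((k + a).toNat : ℂ) = (k : ℂ) + a := by
    have h3 : (((k + a).toNat : ℤ) : ℂ) = ((k + a : ℤ) : ℂ) := by rw [Int.toNat_of_nonneg (by omega)]
    rw [← Int.cast_natCast, h3, Int.cast_add]
  rw [this, show (a : ℂ) - (k + a) = -(k : ℂ) by ring, C_neg, ← sub_eq_add_neg]

lemma RR_natDegree (n : ℕ) : (RR n).natDegree ≤ 15 * n := by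
  unfold RR
  refine natDegree_mul_le.trans ?_
  have := natDegree_mul_le (p := bP (5 * n) (6 * n)) (q := bP (5 * n) (5 * n))
  have h1 := bP_natDegree (5 * n) (6 * n)
  have h2 := bP_natDegree (5 * n) (5 * n)
  have h3 := bP_natDegree (5 * n) (4 * n)
  omega

lemma RR_ne (n : ℕ) : RR n ≠ 0 := mul_ne_zero (mul_ne_zero (bP_ne _ _) (bP_ne _ _)) (bP_ne _ _)

lemma RR_dvd1 (n : ℕ) (k : ℤ) (h1 : -6 * n ≤ k) (h2 : k < n) : (X - C (k : ℂ)) ∣ RR n := by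
  unfold RR
  by_cases h : k < -n
  · exact Dvd.dvd.mul_right (Dvd.dvd.mul_right (bP_dvd _ _ _ (by push_cast; omega) (by push_cast; omega)) _) _
  · exact Dvd.dvd.mul_left (bP_dvd _ _ _ (by push_cast; omega) (by push_cast; omega)) _

lemma RR_dvd2 (n : ℕ) (k : ℤ) (h1 : -5 * n ≤ k) (h2 : k < 0) : (X - C (k : ℂ)) ^ 2 ∣ RR n := by
  unfold RR
  rw [pow_two]
  by_cases h : k < -n
  · exact Dvd.dvd.mul_right (mul_dvd_mul (bP_dvd _ _ _ (by push_cast; omega) (by push_cast; omega))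
      (bP_dvd _ _ _ (by push_cast; omega) (by push_cast; omega))) _
  · rw [mul_assoc]
    exact Dvd.dvd.mul_left (mul_dvd_mul (bP_dvd _ _ _ (by push_cast; omega) (by push_cast; omega))
      (bP_dvd _ _ _ (by push_cast; omega) (by push_cast; omega))) _

lemma RR_dvd3 (n : ℕ) (k : ℤ) (h1 : -4 * n ≤ k) (h2 : k < -n) : (X - C (k : ℂ)) ^ 3 ∣ RR n := by
  unfold RR
  rw [pow_succ, pow_two]
  exact mul_dvd_mul (mul_dvd_mul (bP_dvd _ _ _ (by push_cast; omega) (by push_cast; omega))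
      (bP_dvd _ _ _ (by push_cast; omega) (by push_cast; omega)))
      (bP_dvd _ _ _ (by push_cast; omega) (by push_cast; omega))

lemma iter_deriv_zero {P : ℂ[X]} {a : ℂ} {m : ℕ} (h : (X - C a) ^ m ∣ P) (j : ℕ) (hj : j < m) :
    (derivative^[j] P).eval a = 0 := by
  by_cases hP : P = 0
  · subst hP; simp
  have : m ≤ P.rootMultiplicity a := (le_rootMultiplicity_iff hP).2 h
  exact isRoot_iterate_derivative_of_lt_rootMultiplicity (by omega)

lemma xx_ne : xx ≠ 0 := by
  intro h
  have h1 : ww = 1 := by unfold xx at h; linear_combination -h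
  have := ww_sq
  rw [h1] at this
  norm_num at this

lemma chain_zero {f : ℤ → ℂ} {a b k0 : ℤ} (h : ∀ k, a ≤ k → k < b → xx * f (k + 1) = f k)
    (ha : a ≤ k0) (hb : k0 ≤ b) (h0 : f k0 = 0) : ∀ k, a ≤ k → k ≤ b → f k = 0 := by
  have up : ∀ m : ℕ, k0 + m ≤ b → f (k0 + m) = 0 := by
    intro m
    induction m with
    | zero => intro _; simpa using h0
    | succ j ih =>
      intro hj
      have h1 := ih (by push_cast at hj; omega)
      have h2 := h (k0 + j) (by omega) (by push_cast at hj; omega)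
      rw [h1] at h2
      push_cast
      rw [← add_assoc]
      exact (mul_eq_zero.1 h2).resolve_left xx_ne
  have dn : ∀ m : ℕ, a ≤ k0 - m → f (k0 - m) = 0 := by
    intro m
    induction m with
    | zero => intro _; simpa using h0
    | succ j ih =>
      intro hj
      have h1 := ih (by push_cast at hj; omega)
      have h2 := h (k0 - (j + 1)) (by push_cast at hj; omega) (by omega)
      rw [show k0 - ((j : ℤ) + 1) + 1 = k0 - j by ring, h1, mul_zero] at h2
      push_cast
      exact h2.symm
  intro k hk1 hk2
  rcases le_total k0 k with hh | hh
  · have := up (k - k0).toNat (by omega)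
    rwa [show k0 + ((k - k0).toNat : ℤ) = k by omega] at this
  · have := dn (k0 - k).toNat (by omega)
    rwa [show k0 - ((k0 - k).toNat : ℤ) = k by omega] at this

lemma Sop_iter (N : ℕ) (P : ℂ[X]) (j : ℕ) : derivative^[j] (Sop N P) = Sop N (derivative^[j] P) := by
  induction j generalizing P with
  | zero => rfl
  | succ k ih => rw [Function.iterate_succ_apply, Function.iterate_succ_apply, Sop_derivative, ih]

lemma S_chain {N : ℕ} {P : ℂ[X]} (hP : P.natDegree < N) (j : ℕ) (k : ℤ) (m : ℕ) (hj : j < m)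
    (h : (X - C (k : ℂ)) ^ m ∣ P) :
    xx * (derivative^[j] (Sop N P)).eval ((k + 1 : ℤ) : ℂ) = (derivative^[j] (Sop N P)).eval (k : ℂ) := by
  have h1 : (derivative^[j] P).natDegree < N :=
    lt_of_le_of_lt ((natDegree_iterate_derivative P j).trans (Nat.sub_le _ _)) hP
  have := Sop_eval h1 (k : ℂ)
  rw [iter_deriv_zero h j hj, ← Sop_iter] at this
  push_cast
  linear_combination this

lemma S_zero {n : ℕ} {Q : ℂ[X]} (hQ : Q.natDegree ≤ 2)
    (h0 : ∀ j < 3, (derivative^[j] (Sop (15 * n + 3) (RR n * Q))).eval (-(n : ℂ)) = 0) : Q = 0 := by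
  have hdeg : (RR n * Q).natDegree ≤ 15 * n + 2 :=
    natDegree_mul_le.trans (by have := RR_natDegree n; omega)
  set S := Sop (15 * n + 3) (RR n * Q) with hS
  by_contra hQ0
  have hS0 : S ≠ 0 := by
    intro h
    have := Sop_eq (del_pow_eq_zero (15 * n + 3) (RR n * Q) (by omega))
    rw [← hS, h] at this
    simp only [map_zero, smul_zero, sub_zero] at this
    exact (mul_ne_zero (RR_ne n) hQ0) this.symm
  have hn : -(n : ℂ) = ((-(n : ℤ) : ℤ) : ℂ) := by push_cast; rfl
  rw [hn] at h0
  have z0 : ∀ k : ℤ, -6 * n ≤ k → k ≤ n → (derivative^[0] S).eval (k : ℂ) = 0 :=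
    chain_zero (f := fun k : ℤ => (derivative^[0] S).eval (k : ℂ))
      (fun k h1 h2 => S_chain (by omega) 0 k 1 (by omega)
        (by rw [pow_one]; exact Dvd.dvd.mul_right (RR_dvd1 n k h1 h2) _)) (by omega) (by omega) (h0 0 (by omega))
  have z1 : ∀ k : ℤ, -5 * n ≤ k → k ≤ 0 → (derivative^[1] S).eval (k : ℂ) = 0 :=
    chain_zero (f := fun k : ℤ => (derivative^[1] S).eval (k : ℂ))
      (fun k h1 h2 => S_chain (by omega) 1 k 2 (by omega)
        (Dvd.dvd.mul_right (RR_dvd2 n k h1 h2) _)) (by omega) (by omega) (h0 1 (by omega))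
  have z2 : ∀ k : ℤ, -4 * n ≤ k → k ≤ -n → (derivative^[2] S).eval (k : ℂ) = 0 :=
    chain_zero (f := fun k : ℤ => (derivative^[2] S).eval (k : ℂ))
      (fun k h1 h2 => S_chain (by omega) 2 k 3 (by omega)
        (Dvd.dvd.mul_right (RR_dvd3 n k h1 h2) _)) (by omega) (by omega) (h0 2 (by omega))
  have mult : ∀ (k : ℤ) (m : ℕ), (∀ j < m + 1, (derivative^[j] S).eval (k : ℂ) = 0) →
      m + 1 ≤ S.rootMultiplicity (k : ℂ) := by
    intro k m h
    apply (lt_rootMultiplicity_iff_isRoot_iterate_derivative hS0).2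
    intro j hj
    exact h j (by omega)
  let e : ℤ ↪ ℂ := ⟨fun k => (k : ℂ), Int.cast_injective⟩
  let A1 := (Finset.Icc (-6 * n : ℤ) n).map e
  let A2 := (Finset.Icc (-5 * n : ℤ) 0).map e
  let A3 := (Finset.Icc (-4 * n : ℤ) (-n)).map e
  have hle : A1.val + A2.val + A3.val ≤ S.roots := by
    classical
    rw [Multiset.le_iff_count]
    intro z
    rw [Multiset.count_add, Multiset.count_add, count_roots,
      Multiset.count_eq_of_nodup A1.nodup, Multiset.count_eq_of_nodup A2.nodup,
      Multiset.count_eq_of_nodup A3.nodup]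
    simp only [Finset.mem_val]
    by_cases hz : ∃ k : ℤ, (k : ℂ) = z
    · obtain ⟨k, rfl⟩ := hz
      have m1 : (k : ℂ) ∈ A1 ↔ k ∈ Finset.Icc (-6 * n : ℤ) n := Finset.mem_map' e
      have m2 : (k : ℂ) ∈ A2 ↔ k ∈ Finset.Icc (-5 * n : ℤ) 0 := Finset.mem_map' e
      have m3 : (k : ℂ) ∈ A3 ↔ k ∈ Finset.Icc (-4 * n : ℤ) (-n) := Finset.mem_map' e
      rw [Finset.mem_Icc] at m1 m2 m3
      simp only [m1, m2, m3]
      by_cases c3 : -4 * (n : ℤ) ≤ k ∧ k ≤ -n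
      · have := mult k 2 (by
          intro j hj
          interval_cases j
          · exact z0 k (by omega) (by omega)
          · exact z1 k (by omega) (by omega)
          · exact z2 k (by omega) (by omega))
        split_ifs <;> omega
      by_cases c2 : -5 * (n : ℤ) ≤ k ∧ k ≤ 0
      · have := mult k 1 (by
          intro j hj
          interval_cases j
          · exact z0 k (by omega) (by omega)
          · exact z1 k (by omega) (by omega))
        split_ifs <;> omega
      by_cases c1 : -6 * (n : ℤ) ≤ k ∧ k ≤ n
      · have := mult k 0 (by
          intro j hj
          interval_cases j
          · exact z0 k (by omega) (by omega))
        split_ifs <;> omega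
      rw [if_neg c1, if_neg c2, if_neg c3]; omega
    · have : ∀ s : Finset ℤ, z ∉ s.map e := by
        intro s hs
        obtain ⟨k, _, hk⟩ := Finset.mem_map.1 hs
        exact hz ⟨k, hk⟩
      rw [if_neg (this _), if_neg (this _), if_neg (this _)]
      omega
  have hc := Multiset.card_le_card hle
  have hr := card_roots' S
  have hd := Sop_natDegree (15 * n + 3) (RR n * Q)
  rw [← hS] at hd
  simp only [Multiset.card_add, Finset.card_val, A1, A2, A3, Finset.card_map, Int.card_Icc] at hc
  omega

def Sj (n j : ℕ) : ℂ[X] := Sop (15 * n + 3) (RR n * X ^ j)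

lemma nonvan (n : ℕ) (a b : ℂ) (ha : a ≠ 0) :
    ∃ j < 3, a * (derivative (Sj n j)).eval 0 + b * (Sj n j).eval 0 ≠ 0 := by
  let Qc : (Fin 3 → ℂ) →ₗ[ℂ] ℂ[X] :=
    { toFun := fun c => ∑ j : Fin 3, c j • X ^ (j : ℕ)
      map_add' := by intro x y; simp [add_smul, Finset.sum_add_distrib]
      map_smul' := by intro x y; simp [Finset.smul_sum, smul_smul] }
  let SL : (Fin 3 → ℂ) →ₗ[ℂ] ℂ[X] :=
    { toFun := fun c => Sop (15 * n + 3) (RR n * Qc c)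
      map_add' := by intro x y; rw [map_add, mul_add, Sop_add]
      map_smul' := by intro x y; rw [map_smul, mul_smul_comm, Sop_smul]; rfl }
  let Φ : (Fin 3 → ℂ) →ₗ[ℂ] (Fin 3 → ℂ) :=
    { toFun := fun c i => (derivative^[(i : ℕ)] (SL c)).eval (-(n : ℂ))
      map_add' := by intro x y; ext i; simp [map_add, iterate_map_add]
      map_smul' := by intro x y; ext i; simp [map_smul, iterate_derivative_smul] }
  have Qdeg : ∀ c, (Qc c).natDegree ≤ 2 := by
    intro c
    refine natDegree_sum_le_of_forall_le Finset.univ (fun j : Fin 3 => c j • (X : ℂ[X]) ^ (j : ℕ)) ?_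
    intro i _
    refine (natDegree_smul_le _ _).trans ?_
    rw [natDegree_X_pow]; omega
  have inj : Function.Injective Φ := by
    rw [injective_iff_map_eq_zero]
    intro c hc
    have hQ : Qc c = 0 := by
      apply S_zero (n := n) (Qdeg c)
      intro j hj
      exact congrFun hc ⟨j, hj⟩
    have hQ2 : c 0 • (1 : ℂ[X]) + c 1 • X + c 2 • X ^ 2 = 0 := by
      have h5 : Qc c = ∑ j : Fin 3, c j • X ^ (j : ℕ) := rfl
      rw [← hQ, h5, Fin.sum_univ_three]
      simp
    have c0 := congrArg (fun p => coeff p 0) hQ2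
    have c1 := congrArg (fun p => coeff p 1) hQ2
    have c2 := congrArg (fun p => coeff p 2) hQ2
    simp [coeff_one, coeff_X] at c0 c1 c2
    ext i
    fin_cases i <;> assumption
  obtain ⟨c, hc⟩ := LinearMap.injective_iff_surjective.1 inj ![0, 1, 0]
  have hdeg : (RR n * Qc c).natDegree ≤ 15 * n + 2 :=
    natDegree_mul_le.trans (by have := RR_natDegree n; have := Qdeg c; omega)
  set S := Sop (15 * n + 3) (RR n * Qc c) with hS
  have e0 : S.eval (-(n : ℂ)) = 0 := congrFun hc 0
  have e1 : (derivative S).eval (-(n : ℂ)) = 1 := congrFun hc 1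
  have hn : -(n : ℂ) = ((-(n : ℤ) : ℤ) : ℂ) := by push_cast; rfl
  have z0 : S.eval 0 = 0 := by
    have := chain_zero (f := fun k : ℤ => (derivative^[0] S).eval (k : ℂ)) (a := -n) (b := 0) (k0 := -n)
      (fun k h1 h2 => S_chain (by omega) 0 k 1 (by omega)
        (by rw [pow_one]; exact Dvd.dvd.mul_right (RR_dvd1 n k (by omega) (by omega)) _)) (by omega) (by omega)
      (by rw [hn] at e0; exact e0) 0 (by omega) (by omega)
    simpa using this
  have z1 : (derivative S).eval 0 ≠ 0 := by
    intro h
    have := chain_zero (f := fun k : ℤ => (derivative^[1] S).eval (k : ℂ)) (a := -n) (b := 0) (k0 := 0)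
      (fun k h1 h2 => S_chain (by omega) 1 k 2 (by omega)
        (Dvd.dvd.mul_right (RR_dvd2 n k (by omega) (by omega)) _)) (by omega) (by omega)
      (by simpa using h) (-n) (by omega) (by omega)
    rw [hn] at e1
    have h2 : (derivative S).eval ((-(n : ℤ) : ℤ) : ℂ) = 0 := this
    rw [h2] at e1
    exact zero_ne_one e1
  by_contra! hall
  have hlin : S = ∑ j : Fin 3, c j • Sj n j := by
    have h1 := hall
    simp only [hS, Sj, Qc, LinearMap.coe_mk, AddHom.coe_mk, Fin.sum_univ_three, mul_add, Sop_add,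
      mul_smul_comm, Sop_smul]
  have : a * (derivative S).eval 0 + b * S.eval 0 = 0 := by
    have h0 := hall 0 (by omega)
    have h1 := hall 1 (by omega)
    have h2 := hall 2 (by omega)
    rw [hlin]
    simp [Fin.sum_univ_three, derivative_smul]
    linear_combination c 0 * h0 + c 1 * h1 + c 2 * h2
  rw [z0, mul_zero, add_zero] at this
  exact mul_ne_zero ha z1 this
end

end

section
open Finset

def ffz (N : ℕ) (z : ℤ) : ℤ := ∏ i ∈ range N, (z - i)
def ggz (N : ℕ) (z : ℤ) : ℤ := ∑ i ∈ range N, ∏ l ∈ (range N).erase i, (z - l)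
def cnt (p N : ℕ) (z : ℤ) : ℕ := #((range N).filter fun i : ℕ => (p : ℤ) ∣ z - (i : ℤ))

lemma fact_dvd_ffz (N : ℕ) (z : ℤ) : (N.factorial : ℤ) ∣ ffz N z := by
  have h := Nat.factorial_coe_dvd_prod N (z - N + 1)
  rw [← Finset.prod_range_reflect] at h
  refine h.trans (dvd_of_eq ?_)
  apply Finset.prod_congr rfl
  intro i hi
  rw [mem_range] at hi
  rw [Nat.sub_sub, Nat.cast_sub (by omega)]
  push_cast; ring

lemma erase_prod (N i : ℕ) (hi : i < N) (z : ℤ) :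
    ∏ l ∈ (range N).erase i, (z - l) = ffz i z * ffz (N - (i + 1)) (z - (i + 1)) := by
  have h1 : (range N).erase i = range i ∪ Ico (i + 1) N := by
    ext a; simp only [mem_erase, mem_range, mem_union, mem_Ico]; omega
  have h2 : Disjoint (range i) (Ico (i + 1) N) := by
    rw [Finset.disjoint_left]; intro a; simp only [mem_range, mem_Ico]; omega
  rw [h1, prod_union h2, prod_Ico_eq_prod_range]
  unfold ffz
  congr 1
  apply Finset.prod_congr rfl
  intro l _
  push_cast; ring

lemma leib (M : ℕ) (i : ℕ) : ∀ m : ℕ, i + m + 1 ≤ M →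
    ((i + m + 1).factorial : ℤ) ∣ (Nat.lcmUpto M : ℤ) * i.factorial * m.factorial := by
  induction i with
  | zero =>
    intro m hm
    have : (m + 1) ∣ Nat.lcmUpto M := by
      apply Finset.dvd_lcm (f := id) (b := m + 1)
      rw [mem_Icc]; omega
    rw [zero_add, Nat.factorial_succ, Nat.factorial_zero]
    have h2 : ((m + 1 : ℕ) : ℤ) ∣ (Nat.lcmUpto M : ℤ) := Int.natCast_dvd_natCast.2 this
    push_cast
    rw [mul_one]
    push_cast at h2
    exact mul_dvd_mul h2 dvd_rfl
  | succ k ih =>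
    intro m hm
    have h1 := ih m (by omega)
    have h2 := ih (m + 1) (by omega)
    rw [show k + (m + 1) + 1 = k + m + 2 by ring] at h2
    rw [show k + 1 + m + 1 = k + m + 2 by ring]
    have h3 : ((k + m + 2).factorial : ℤ) ∣
        ((k + m + 2 : ℕ) : ℤ) * ((Nat.lcmUpto M : ℤ) * k.factorial * m.factorial) := by
      rw [show k + m + 2 = (k + m + 1) + 1 by ring, Nat.factorial_succ, Nat.cast_mul]
      exact mul_dvd_mul dvd_rfl h1
    have := dvd_sub h3 h2
    refine this.trans (dvd_of_eq ?_)
    rw [Nat.factorial_succ, Nat.factorial_succ]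
    push_cast; ring

lemma fact_dvd_ggz (N : ℕ) (z : ℤ) :
    (N.factorial : ℤ) ∣ (Nat.lcmUpto N : ℤ) * ggz N z := by
  unfold ggz
  rw [Finset.mul_sum]
  apply Finset.dvd_sum
  intro i hi
  rw [mem_range] at hi
  rw [erase_prod N i hi]
  have h1 := leib N i (N - (i + 1)) (by omega)
  rw [show i + (N - (i + 1)) + 1 = N by omega] at h1
  refine h1.trans ?_
  rw [mul_assoc]
  exact mul_dvd_mul dvd_rfl (mul_dvd_mul (fact_dvd_ffz _ _) (fact_dvd_ffz _ _))

lemma pow_card_dvd (p : ℤ) (s : Finset ℕ) (f : ℕ → ℤ) :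
    p ^ #{i ∈ s | p ∣ f i} ∣ ∏ i ∈ s, f i := by
  classical
  calc p ^ #{i ∈ s | p ∣ f i} = ∏ i ∈ s with p ∣ f i, p := by rw [prod_const]
    _ ∣ ∏ i ∈ s with p ∣ f i, f i := prod_dvd_prod_of_dvd _ _ (fun i hi => (mem_filter.1 hi).2)
    _ ∣ _ := prod_dvd_prod_of_subset _ _ _ (filter_subset _ _)

lemma pow_cnt_ffz (p N : ℕ) (z : ℤ) : (p : ℤ) ^ cnt p N z ∣ ffz N z :=
  pow_card_dvd p (range N) (fun i => z - i)

lemma pow_cnt_ggz (p N : ℕ) (z : ℤ) : (p : ℤ) ^ (cnt p N z - 1) ∣ ggz N z := by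
  apply Finset.dvd_sum
  intro i _
  refine (pow_dvd_pow _ ?_).trans (pow_card_dvd p ((range N).erase i) (fun i => z - i))
  rw [filter_erase]
  exact Finset.pred_card_le_card_erase (s := (range N).filter fun i : ℕ => (p : ℤ) ∣ z - (i : ℤ))

lemma ediv_step (p m : ℤ) (hp : 0 < p) : m / p - (m - 1) / p = if p ∣ m then 1 else 0 := by
  split_ifs with h
  · obtain ⟨c, rfl⟩ := h
    rw [Int.mul_ediv_cancel_left _ hp.ne']
    have : (p * c - 1) / p = c - 1 := by
      rw [Int.ediv_eq_iff_of_pos hp]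
      constructor <;> nlinarith
    omega
  · have h1 : m % p ≠ 0 := fun h' => h (Int.dvd_of_emod_eq_zero h')
    have h2 := Int.emod_nonneg m hp.ne'
    have h3 := Int.emod_lt_of_pos m hp
    have h4 := Int.mul_ediv_add_emod m p
    have : (m - 1) / p = m / p := by
      rw [Int.ediv_eq_iff_of_pos hp]
      constructor <;> nlinarith [lt_of_le_of_ne h2 (Ne.symm h1)]
    omega

lemma cnt_eq (p N : ℕ) (hp : 0 < p) (z : ℤ) : (cnt p N z : ℤ) = z / p - (z - N) / p := by
  unfold cnt
  induction N with
  | zero => simp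
  | succ k ih =>
    rw [range_add_one, filter_insert]
    have := ediv_step p (z - k) (by exact_mod_cast hp)
    push_cast
    rw [show z - ((k : ℤ) + 1) = z - k - 1 by ring]
    split_ifs with h
    · rw [card_insert_of_notMem (by simp)]
      rw [if_pos h] at this
      push_cast
      omega
    · rw [if_neg h] at this
      omega

lemma div_shift (k n r p q j : ℤ) (hp : 0 < p) (hn : n = p * q + r) :
    (k + j * n) / p = (k % p + j * r) / p + (k / p + j * q) := by
  have h4 := Int.mul_ediv_add_emod k p
  rw [show k + j * n = (k % p + j * r) + p * (k / p + j * q) by rw [hn]; linear_combination (-1)*h4]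
  rw [Int.add_mul_ediv_left _ _ hp.ne']

/-- sum of floor differences -/
def Fl (p n k : ℤ) : ℤ :=
  ((k + 6 * n) / p - (k + 1 * n) / p) + ((k + 5 * n) / p - (k + 0 * n) / p) +
    ((k + 4 * n) / p - (k + (-1) * n) / p)

lemma Fl_red (p n k q r : ℤ) (hp : 0 < p) (hn : n = p * q + r) :
    Fl p n k = Fl p r (k % p) + 15 * q := by
  unfold Fl
  rw [div_shift k n r p q 6 hp hn, div_shift k n r p q 5 hp hn, div_shift k n r p q 4 hp hn,
    div_shift k n r p q 1 hp hn, div_shift k n r p q 0 hp hn, div_shift k n r p q (-1) hp hn]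
  ring

lemma Fl_aux (p r k f θ : ℤ) (hp : 0 < p) (hk0 : 0 ≤ k) (hk : k < p)
    (hf1 : f * p ≤ 5 * r) (hf2 : 5 * r < (f + 1) * p)
    (h : (θ = 1 ∧ ((p ≤ 7 * r ∧ 5 * r < p) ∨ (2 * p ≤ 7 * r ∧ 5 * r < 2 * p) ∨
        (p ≤ 2 * r ∧ 5 * r < 3 * p) ∨ (2 * p ≤ 3 * r ∧ 5 * r < 4 * p))) ∨
      (θ = 2 ∧ ((p ≤ 6 * r ∧ 5 * r < p) ∨ (p ≤ 3 * r ∧ 5 * r < 2 * p) ∨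
        (4 * p ≤ 7 * r ∧ 5 * r < 3 * p) ∨ (3 * p ≤ 4 * r ∧ 5 * r < 4 * p)))) :
    3 * f + θ ≤ Fl p r k := by
  have hq0 : (k + 0 * r) / p = 0 := by
    rw [zero_mul, add_zero]; exact Int.ediv_eq_zero_of_lt hk0 hk
  have key : ∀ c j : ℤ, (c * p ≤ k + j * r ∧ c ≤ (k + j * r) / p) ∨
      (k + j * r < c * p ∧ (k + j * r) / p ≤ c - 1) := by
    intro c j
    rcases le_or_gt (c * p) (k + j * r) with h | h
    · exact Or.inl ⟨h, (Int.le_ediv_iff_mul_le hp).2 h⟩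
    · exact Or.inr ⟨h, by have := Int.ediv_lt_of_lt_mul hp h; omega⟩
  unfold Fl
  rw [hq0]
  have a1 := key 1 1
  have a0 := key 2 1
  have am := key 0 (-1)
  have am0 := key 1 (-1)
  have hr : 0 ≤ r := by omega
  rcases h with ⟨hθ, h | h | h | h⟩ | ⟨hθ, h | h | h | h⟩
  all_goals
    subst hθ
  · obtain rfl : f = 0 := by nlinarith
    have b4 := key 0 4
    have b41 := key 1 4
    have b5 := key 0 5
    have b51 := key 1 5
    have b6 := key 0 6
    have b61 := key 1 6
    generalize (k + 6 * r) / p = q6 at *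
    generalize (k + 5 * r) / p = q5 at *
    generalize (k + 4 * r) / p = q4 at *
    generalize (k + 1 * r) / p = q1 at *
    generalize (k + -1 * r) / p = qm at *
    omega
  · obtain rfl : f = 1 := by nlinarith
    have b4 := key 1 4
    have b41 := key 2 4
    have b5 := key 1 5
    have b51 := key 2 5
    have b6 := key 1 6
    have b61 := key 2 6
    generalize (k + 6 * r) / p = q6 at *
    generalize (k + 5 * r) / p = q5 at *
    generalize (k + 4 * r) / p = q4 at *
    generalize (k + 1 * r) / p = q1 at *
    generalize (k + -1 * r) / p = qm at *
    omega
  · obtain rfl : f = 2 := by nlinarith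
    have b4 := key 2 4
    have b41 := key 3 4
    have b5 := key 2 5
    have b51 := key 3 5
    have b6 := key 3 6
    have b61 := key 4 6
    generalize (k + 6 * r) / p = q6 at *
    generalize (k + 5 * r) / p = q5 at *
    generalize (k + 4 * r) / p = q4 at *
    generalize (k + 1 * r) / p = q1 at *
    generalize (k + -1 * r) / p = qm at *
    omega
  · obtain rfl : f = 3 := by nlinarith
    have b40 := key 2 4
    have b4 := key 3 4
    have b41 := key 4 4
    have b5 := key 3 5
    have b51 := key 4 5
    have b6 := key 4 6
    have b61 := key 5 6
    generalize (k + 6 * r) / p = q6 at *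
    generalize (k + 5 * r) / p = q5 at *
    generalize (k + 4 * r) / p = q4 at *
    generalize (k + 1 * r) / p = q1 at *
    generalize (k + -1 * r) / p = qm at *
    omega
  · obtain rfl : f = 0 := by nlinarith
    have b4 := key 0 4
    have b41 := key 1 4
    have b5 := key 0 5
    have b51 := key 1 5
    have b6 := key 1 6
    have b61 := key 2 6
    generalize (k + 6 * r) / p = q6 at *
    generalize (k + 5 * r) / p = q5 at *
    generalize (k + 4 * r) / p = q4 at *
    generalize (k + 1 * r) / p = q1 at *
    generalize (k + -1 * r) / p = qm at *
    omega
  · obtain rfl : f = 1 := by nlinarith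
    have b4 := key 1 4
    have b41 := key 2 4
    have b5 := key 1 5
    have b51 := key 2 5
    have b6 := key 2 6
    have b61 := key 3 6
    generalize (k + 6 * r) / p = q6 at *
    generalize (k + 5 * r) / p = q5 at *
    generalize (k + 4 * r) / p = q4 at *
    generalize (k + 1 * r) / p = q1 at *
    generalize (k + -1 * r) / p = qm at *
    omega
  · obtain rfl : f = 2 := by nlinarith
    have b4 := key 2 4
    have b41 := key 3 4
    have b5 := key 2 5
    have b51 := key 3 5
    have b6 := key 3 6
    have b61 := key 4 6
    generalize (k + 6 * r) / p = q6 at *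
    generalize (k + 5 * r) / p = q5 at *
    generalize (k + 4 * r) / p = q4 at *
    generalize (k + 1 * r) / p = q1 at *
    generalize (k + -1 * r) / p = qm at *
    omega
  · obtain rfl : f = 3 := by nlinarith
    have b4 := key 3 4
    have b41 := key 4 4
    have b5 := key 3 5
    have b51 := key 4 5
    have b6 := key 4 6
    have b61 := key 5 6
    generalize (k + 6 * r) / p = q6 at *
    generalize (k + 5 * r) / p = q5 at *
    generalize (k + 4 * r) / p = q4 at *
    generalize (k + 1 * r) / p = q1 at *
    generalize (k + -1 * r) / p = qm at *
    omega

end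

section
open Finset

lemma fact_split (N p : ℕ) (hp : p.Prime) (h : N < p ^ 2) :
    ∃ g : ℕ, N.factorial = p ^ (N / p) * g ∧ ¬ p ∣ g := by
  have := Fact.mk hp
  have h1 : N.factorial.factorization p = N / p := by
    rw [Nat.factorization_def _ hp, padicValNat_factorial (b := 2) (Nat.log_lt_of_lt_pow' (by norm_num) h)]
    simp
  refine ⟨N.factorial / p ^ (N / p), ?_, ?_⟩
  · rw [← h1]; exact (Nat.ordProj_mul_ordCompl_eq_self _ _).symm
  · rw [← h1]; exact Nat.not_dvd_ordCompl hp (Nat.factorial_ne_zero _)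

lemma cancel_pow (p g f θ : ℕ) (v : ℤ) (hp : p.Prime) (hg : ¬ p ∣ g) (F : ℤ) (hF : F = ((p ^ f * g : ℕ) : ℤ))
    (h : (p : ℤ) ^ (3 * f + θ) ∣ F ^ 3 * v) : (p : ℤ) ^ θ ∣ v := by
  subst hF
  push_cast at h
  rw [mul_pow, ← pow_mul, mul_comm f 3, pow_add, mul_assoc] at h
  have hp0 : (p : ℤ) ^ (3 * f) ≠ 0 := pow_ne_zero _ (by exact_mod_cast hp.ne_zero)
  have h2 := (mul_dvd_mul_iff_left hp0).1 h
  refine IsCoprime.dvd_of_dvd_mul_left ?_ h2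
  apply IsCoprime.pow
  rw [Nat.isCoprime_iff_coprime]
  exact (hp.coprime_iff_not_dvd).2 hg

lemma main_cnt (n p θ : ℕ) (hp : 0 < p) (k : ℤ)
    (h : (θ = 1 ∧ ((p ≤ 7 * (n % p) ∧ 5 * (n % p) < p) ∨ (2 * p ≤ 7 * (n % p) ∧ 5 * (n % p) < 2 * p) ∨
        (p ≤ 2 * (n % p) ∧ 5 * (n % p) < 3 * p) ∨ (2 * p ≤ 3 * (n % p) ∧ 5 * (n % p) < 4 * p))) ∨
      (θ = 2 ∧ ((p ≤ 6 * (n % p) ∧ 5 * (n % p) < p) ∨ (p ≤ 3 * (n % p) ∧ 5 * (n % p) < 2 * p) ∨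
        (4 * p ≤ 7 * (n % p) ∧ 5 * (n % p) < 3 * p) ∨ (3 * p ≤ 4 * (n % p) ∧ 5 * (n % p) < 4 * p)))) :
    3 * (5 * n / p) + θ ≤ cnt p (5 * n) (k + 6 * n) + cnt p (5 * n) (k + 5 * n) + cnt p (5 * n) (k + 4 * n) := by
  have hpz : (0 : ℤ) < p := by exact_mod_cast hp
  zify
  rw [cnt_eq p _ hp, cnt_eq p _ hp, cnt_eq p _ hp]
  have hn : (n : ℤ) = p * ((n / p : ℕ) : ℤ) + ((n % p : ℕ) : ℤ) := by
    exact_mod_cast (Nat.div_add_mod n p).symm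
  have h1 := Fl_red p n k _ _ hpz hn
  have hf : 5 * (n : ℤ) / p = 5 * ((n % p : ℕ) : ℤ) / p + 5 * ((n / p : ℕ) : ℤ) := by
    have : 5 * (n : ℤ) = 5 * ((n % p : ℕ) : ℤ) + p * (5 * ((n / p : ℕ) : ℤ)) := by
      linear_combination 5 * hn
    rw [this, Int.add_mul_ediv_left _ _ hpz.ne']
  have h2 := Fl_aux p ((n % p : ℕ) : ℤ) (k % p) (5 * ((n % p : ℕ) : ℤ) / p) θ hpz
    (Int.emod_nonneg _ hpz.ne') (Int.emod_lt_of_pos _ hpz)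
    (Int.ediv_mul_le _ hpz.ne') (Int.lt_ediv_add_one_mul_self _ hpz) (by exact_mod_cast h)
  have h3 : k + 6 * (n : ℤ) - ((5 * n : ℕ) : ℤ) = k + 1 * n := by push_cast; ring
  have h4 : k + 5 * (n : ℤ) - ((5 * n : ℕ) : ℤ) = k + 0 * n := by push_cast; ring
  have h5 : k + 4 * (n : ℤ) - ((5 * n : ℕ) : ℤ) = k + (-1) * n := by push_cast; ring
  rw [h3, h4, h5, hf]
  have h6 : Fl p n k = ((k + 6 * n) / p - (k + 1 * n) / p) + ((k + 5 * n) / p - (k + 0 * n) / p) +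
    ((k + 4 * n) / p - (k + (-1) * n) / p) := rfl
  linarith

lemma main_div (n p : ℕ) (hp : p.Prime) (h5 : 5 * n < p ^ 2) (k u1 u2 u3 w1 w2 w3 : ℤ)
    (hu1 : ((5 * n).factorial : ℤ) * u1 = ffz (5 * n) (k + 6 * n))
    (hu2 : ((5 * n).factorial : ℤ) * u2 = ffz (5 * n) (k + 5 * n))
    (hu3 : ((5 * n).factorial : ℤ) * u3 = ffz (5 * n) (k + 4 * n))
    (hw1 : ((5 * n).factorial : ℤ) * w1 = Nat.lcmUpto (5 * n) * ggz (5 * n) (k + 6 * n))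
    (hw2 : ((5 * n).factorial : ℤ) * w2 = Nat.lcmUpto (5 * n) * ggz (5 * n) (k + 5 * n))
    (hw3 : ((5 * n).factorial : ℤ) * w3 = Nat.lcmUpto (5 * n) * ggz (5 * n) (k + 4 * n)) (T : ℕ)
    (hT : 3 * (5 * n / p) + T ≤ cnt p (5 * n) (k + 6 * n) + cnt p (5 * n) (k + 5 * n) + cnt p (5 * n) (k + 4 * n)) (hT1 : 1 ≤ T) :
    (p : ℤ) ^ T ∣ u1 * u2 * u3 ∧
    (p : ℤ) ^ (T - 1) ∣ w1 * u2 * u3 + u1 * w2 * u3 + u1 * u2 * w3 ∧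
    (p ≤ 5 * n → (p : ℤ) ^ T ∣ w1 * u2 * u3 + u1 * w2 * u3 + u1 * u2 * w3) := by
  obtain ⟨g, hg, hpg⟩ := fact_split (5 * n) p hp h5
  have hF : ((5 * n).factorial : ℤ) = ((p ^ (5 * n / p) * g : ℕ) : ℤ) := by rw [hg]
  have f1 := pow_cnt_ffz p (5 * n) (k + 6 * n)
  have f2 := pow_cnt_ffz p (5 * n) (k + 5 * n)
  have f3 := pow_cnt_ffz p (5 * n) (k + 4 * n)
  have g1 := pow_cnt_ggz p (5 * n) (k + 6 * n)
  have g2 := pow_cnt_ggz p (5 * n) (k + 5 * n)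
  have g3 := pow_cnt_ggz p (5 * n) (k + 4 * n)
  rw [← hu1] at f1
  rw [← hu2] at f2
  rw [← hu3] at f3
  generalize cnt p (5 * n) (k + 6 * n) = c1 at *
  generalize cnt p (5 * n) (k + 5 * n) = c2 at *
  generalize cnt p (5 * n) (k + 4 * n) = c3 at *
  set F : ℤ := ((5 * n).factorial : ℤ) with hFdef
  have general : ∀ e : ℕ, (∀ G : ℤ, ∀ c : ℕ, (p : ℤ) ^ (c - 1) ∣ G →
      (p : ℤ) ^ (c - (1 - e)) ∣ Nat.lcmUpto (5 * n) * G) →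
      (p : ℤ) ^ (T - (1 - e)) ∣ w1 * u2 * u3 + u1 * w2 * u3 + u1 * u2 * w3 := by
    intro e he
    have q1 := he _ _ g1
    have q2 := he _ _ g2
    have q3 := he _ _ g3
    rw [← hw1] at q1
    rw [← hw2] at q2
    rw [← hw3] at q3
    apply cancel_pow p g (5 * n / p) _ _ hp hpg F hF
    rw [show F ^ 3 * (w1 * u2 * u3 + u1 * w2 * u3 + u1 * u2 * w3) =
      (F * w1) * (F * u2) * (F * u3) + (F * u1) * (F * w2) * (F * u3) + (F * u1) * (F * u2) * (F * w3) by ring]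
    refine dvd_add (dvd_add ?_ ?_) ?_
    · refine dvd_trans ?_ (mul_dvd_mul (mul_dvd_mul q1 f2) f3)
      rw [← pow_add, ← pow_add]; exact pow_dvd_pow _ (by omega)
    · refine dvd_trans ?_ (mul_dvd_mul (mul_dvd_mul f1 q2) f3)
      rw [← pow_add, ← pow_add]; exact pow_dvd_pow _ (by omega)
    · refine dvd_trans ?_ (mul_dvd_mul (mul_dvd_mul f1 f2) q3)
      rw [← pow_add, ← pow_add]; exact pow_dvd_pow _ (by omega)
  refine ⟨?_, ?_, ?_⟩
  · apply cancel_pow p g (5 * n / p) T _ hp hpg F hF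
    rw [show F ^ 3 * (u1 * u2 * u3) = (F * u1) * (F * u2) * (F * u3) by ring]
    refine dvd_trans ?_ (mul_dvd_mul (mul_dvd_mul f1 f2) f3)
    rw [← pow_add, ← pow_add]; exact pow_dvd_pow _ hT
  · exact general 0 (fun G c h => h.mul_left _)
  · intro hle
    have hd : (p : ℤ) ∣ (Nat.lcmUpto (5 * n) : ℤ) := by
      rw [Int.natCast_dvd_natCast]
      apply Finset.dvd_lcm (f := id) (b := p)
      rw [mem_Icc]; exact ⟨hp.one_le, hle⟩
    refine general 1 (fun G c h => ?_)
    refine dvd_trans ?_ (mul_dvd_mul hd h)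
    rw [← pow_succ']; exact pow_dvd_pow _ (by omega)

/-- interval data: numerators and denominators of endpoints -/
def iA : Fin 8 → ℕ := ![1, 2, 1, 2, 1, 1, 4, 3]
def iAd : Fin 8 → ℕ := ![7, 7, 2, 3, 6, 3, 7, 4]
def iB : Fin 8 → ℕ := ![1, 2, 3, 4, 1, 2, 3, 4]

def icond (n p K : ℕ) (i : Fin 8) : Prop :=
  (iA i * p ≤ iAd i * (n % p) ∧ 5 * (n % p) < iB i * p) ∧ n / p < K ∧ (i = 0 → n / p ≠ 0)

instance (n p K : ℕ) (i : Fin 8) : Decidable (icond n p K i) := by unfold icond; infer_instance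

def thN (n p K : ℕ) : ℕ := ∑ i : Fin 8, if icond n p K i then 1 else 0

lemma thN_cases (n p K : ℕ) (hp : 0 < p) : thN n p K = 0 ∨ (n / p < K ∧ ((p ≤ 5 * n ∧
    ((thN n p K = 1 ∧ ((p ≤ 7 * (n % p) ∧ 5 * (n % p) < p) ∨ (2 * p ≤ 7 * (n % p) ∧ 5 * (n % p) < 2 * p) ∨
        (p ≤ 2 * (n % p) ∧ 5 * (n % p) < 3 * p) ∨ (2 * p ≤ 3 * (n % p) ∧ 5 * (n % p) < 4 * p))) ∨
      (thN n p K = 2 ∧ ((p ≤ 6 * (n % p) ∧ 5 * (n % p) < p) ∨ (p ≤ 3 * (n % p) ∧ 5 * (n % p) < 2 * p) ∨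
        (4 * p ≤ 7 * (n % p) ∧ 5 * (n % p) < 3 * p) ∨ (3 * p ≤ 4 * (n % p) ∧ 5 * (n % p) < 4 * p))))) ∨
    (thN n p K = 1 ∧ (p ≤ 6 * (n % p) ∧ 5 * (n % p) < p)))) := by
  have hq : (n / p = 0 ∧ n % p = n) ∨ (1 ≤ n / p ∧ p ≤ n) := by
    rcases lt_or_ge n p with h | h
    · left; exact ⟨Nat.div_eq_of_lt h, Nat.mod_eq_of_lt h⟩
    · right; exact ⟨Nat.div_pos h hp, h⟩
  have hdef : thN n p K = ∑ i : Fin 8, if icond n p K i then 1 else 0 := rfl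
  rw [Fin.sum_univ_eight] at hdef
  have ex : ∀ i : Fin 8, ((if icond n p K i then 1 else 0) = 1 ∧ icond n p K i) ∨
      ((if icond n p K i then 1 else 0) = 0 ∧ ¬ icond n p K i) := by
    intro i
    by_cases h : icond n p K i
    · left; exact ⟨if_pos h, h⟩
    · right; exact ⟨if_neg h, h⟩
  have e0 := ex 0
  have e1 := ex 1
  have e2 := ex 2
  have e3 := ex 3
  have e4 := ex 4
  have e5 := ex 5
  have e6 := ex 6
  have e7 := ex 7
  generalize thN n p K = T at *
  generalize (if icond n p K 0 then 1 else 0) = E0 at *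
  generalize (if icond n p K 1 then 1 else 0) = E1 at *
  generalize (if icond n p K 2 then 1 else 0) = E2 at *
  generalize (if icond n p K 3 then 1 else 0) = E3 at *
  generalize (if icond n p K 4 then 1 else 0) = E4 at *
  generalize (if icond n p K 5 then 1 else 0) = E5 at *
  generalize (if icond n p K 6 then 1 else 0) = E6 at *
  generalize (if icond n p K 7 then 1 else 0) = E7 at *
  clear ex
  simp [icond, iA, iAd, iB] at e0 e1 e2 e3 e4 e5 e6 e7
  generalize n % p = r at *
  generalize n / p = q at *
  rcases e4 with e4 | e4
  · replace e1 : E1 = 0 := by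
      rcases e1 with e1 | e1
      · omega
      · exact e1.1
    replace e2 : E2 = 0 := by
      rcases e2 with e2 | e2
      · omega
      · exact e2.1
    replace e3 : E3 = 0 := by
      rcases e3 with e3 | e3
      · omega
      · exact e3.1
    replace e5 : E5 = 0 := by
      rcases e5 with e5 | e5
      · omega
      · exact e5.1
    replace e6 : E6 = 0 := by
      rcases e6 with e6 | e6
      · omega
      · exact e6.1
    replace e7 : E7 = 0 := by
      rcases e7 with e7 | e7
      · omega
      · exact e7.1
    rcases e0 with e0 | e0
    · refine Or.inr ⟨by omega, Or.inl ⟨by omega, Or.inr ⟨by omega, Or.inl (by omega)⟩⟩⟩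
    · refine Or.inr ⟨by omega, Or.inr ⟨by omega, by omega⟩⟩
  replace e4 := e4.1
  rcases e5 with e5 | e5
  · replace e0 : E0 = 0 := by
      rcases e0 with e0 | e0
      · omega
      · exact e0.1
    replace e2 : E2 = 0 := by
      rcases e2 with e2 | e2
      · omega
      · exact e2.1
    replace e3 : E3 = 0 := by
      rcases e3 with e3 | e3
      · omega
      · exact e3.1
    replace e6 : E6 = 0 := by
      rcases e6 with e6 | e6
      · omega
      · exact e6.1
    replace e7 : E7 = 0 := by
      rcases e7 with e7 | e7
      · omega
      · exact e7.1
    rcases e1 with e1 | e1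
    · refine Or.inr ⟨by omega, Or.inl ⟨by omega, Or.inr ⟨by omega, Or.inr (Or.inl (by omega))⟩⟩⟩
    · omega
  replace e5 := e5.1
  rcases e6 with e6 | e6
  · replace e0 : E0 = 0 := by
      rcases e0 with e0 | e0
      · omega
      · exact e0.1
    replace e1 : E1 = 0 := by
      rcases e1 with e1 | e1
      · omega
      · exact e1.1
    replace e3 : E3 = 0 := by
      rcases e3 with e3 | e3
      · omega
      · exact e3.1
    replace e7 : E7 = 0 := by
      rcases e7 with e7 | e7
      · omega
      · exact e7.1
    rcases e2 with e2 | e2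
    · refine Or.inr ⟨by omega, Or.inl ⟨by omega, Or.inr ⟨by omega, Or.inr (Or.inr (Or.inl (by omega)))⟩⟩⟩
    · omega
  replace e6 := e6.1
  rcases e7 with e7 | e7
  · replace e0 : E0 = 0 := by
      rcases e0 with e0 | e0
      · omega
      · exact e0.1
    replace e1 : E1 = 0 := by
      rcases e1 with e1 | e1
      · omega
      · exact e1.1
    replace e2 : E2 = 0 := by
      rcases e2 with e2 | e2
      · omega
      · exact e2.1
    rcases e3 with e3 | e3
    · refine Or.inr ⟨by omega, Or.inl ⟨by omega, Or.inr ⟨by omega, Or.inr (Or.inr (Or.inr (by omega)))⟩⟩⟩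
    · omega
  replace e7 := e7.1
  rcases e0 with e0 | e0
  · replace e1 : E1 = 0 := by
      rcases e1 with e1 | e1
      · omega
      · exact e1.1
    replace e2 : E2 = 0 := by
      rcases e2 with e2 | e2
      · omega
      · exact e2.1
    replace e3 : E3 = 0 := by
      rcases e3 with e3 | e3
      · omega
      · exact e3.1
    refine Or.inr ⟨by omega, Or.inl ⟨by omega, Or.inl ⟨by omega, Or.inl (by omega)⟩⟩⟩
  replace e0 := e0.1
  rcases e1 with e1 | e1
  · replace e2 : E2 = 0 := by
      rcases e2 with e2 | e2
      · omega
      · exact e2.1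
    replace e3 : E3 = 0 := by
      rcases e3 with e3 | e3
      · omega
      · exact e3.1
    refine Or.inr ⟨by omega, Or.inl ⟨by omega, Or.inl ⟨by omega, Or.inr (Or.inl (by omega))⟩⟩⟩
  replace e1 := e1.1
  rcases e2 with e2 | e2
  · replace e3 : E3 = 0 := by
      rcases e3 with e3 | e3
      · omega
      · exact e3.1
    refine Or.inr ⟨by omega, Or.inl ⟨by omega, Or.inl ⟨by omega, Or.inr (Or.inr (Or.inl (by omega)))⟩⟩⟩
  replace e2 := e2.1
  rcases e3 with e3 | e3
  · refine Or.inr ⟨by omega, Or.inl ⟨by omega, Or.inl ⟨by omega, Or.inr (Or.inr (Or.inr (by omega)))⟩⟩⟩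
  replace e3 := e3.1
  left; omega

end

section
open Finset

lemma bP_eval (N : ℕ) (a k : ℤ) : (N.factorial : ℂ) * (bP N a).eval (k : ℂ) = (ffz N (k + a) : ℤ) := by
  unfold bP ffz
  have : (N.factorial : ℂ) ≠ 0 := by exact_mod_cast N.factorial_ne_zero
  rw [Polynomial.eval_mul, Polynomial.eval_C, ← mul_assoc, mul_one_div_cancel this, one_mul, Polynomial.eval_prod]
  push_cast
  apply Finset.prod_congr rfl
  intro i _
  simp; ring

lemma bP_deriv (N : ℕ) (a k : ℤ) :
    (N.factorial : ℂ) * (Polynomial.derivative (bP N a)).eval (k : ℂ) = (ggz N (k + a) : ℤ) := by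
  unfold bP ggz
  have : (N.factorial : ℂ) ≠ 0 := by exact_mod_cast N.factorial_ne_zero
  rw [Polynomial.derivative_C_mul, Polynomial.eval_mul, Polynomial.eval_C, ← mul_assoc,
    mul_one_div_cancel this, one_mul, Polynomial.derivative_prod_finset, Polynomial.eval_finsetSum]
  push_cast
  apply Finset.sum_congr rfl
  intro i _
  simp only [Polynomial.derivative_add, Polynomial.derivative_X, Polynomial.derivative_C, add_zero,
    mul_one, Polynomial.eval_prod]
  apply Finset.prod_congr rfl
  intro l _
  simp; ring

noncomputable def MM (n K : ℕ) : ℕ := ∏ p ∈ (range (6 * n + 1)).filter Nat.Prime, p ^ thN n p K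

lemma MM_pos (n K : ℕ) : 0 < MM n K :=
  Finset.prod_pos fun p hp => pow_pos (mem_filter.1 hp).2.pos _

lemma MM_dvd (n K : ℕ) (v : ℤ) (h : ∀ p, p.Prime → thN n p K ≠ 0 → (p : ℤ) ^ thN n p K ∣ v) :
    (MM n K : ℤ) ∣ v := by
  unfold MM
  push_cast
  apply Finset.prod_dvd_of_coprime
  · intro p hp q hq hpq
    simp only [coe_filter, mem_range] at hp hq
    apply IsCoprime.pow
    rw [Nat.isCoprime_iff_coprime]
    exact (Nat.coprime_primes hp.2 hq.2).2 hpq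
  · intro p hp
    by_cases h0 : thN n p K = 0
    · rw [h0, pow_zero]; exact one_dvd _
    · exact h p (mem_filter.1 hp).2 h0

lemma RR_int (n K : ℕ) (hK : 1 ≤ K) (hn : 5 * K ^ 2 ≤ n) (k : ℤ) :
    ∃ U V : ℤ, (RR n).eval (k : ℂ) = ((MM n K : ℤ) * U : ℤ) ∧
      (Nat.lcmUpto (5 * n) : ℂ) * (Polynomial.derivative (RR n)).eval (k : ℂ) = ((MM n K : ℤ) * V : ℤ) := by
  have ex : ∀ z : ℤ, ∃ u w : ℤ, ((5 * n).factorial : ℤ) * u = ffz (5 * n) z ∧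
      ((5 * n).factorial : ℤ) * w = Nat.lcmUpto (5 * n) * ggz (5 * n) z := by
    intro z
    obtain ⟨u, hu⟩ := fact_dvd_ffz (5 * n) z
    obtain ⟨w, hw⟩ := fact_dvd_ggz (5 * n) z
    exact ⟨u, w, hu.symm, hw.symm⟩
  obtain ⟨u1, w1, hu1, hw1⟩ := ex (k + 6 * n)
  obtain ⟨u2, w2, hu2, hw2⟩ := ex (k + 5 * n)
  obtain ⟨u3, w3, hu3, hw3⟩ := ex (k + 4 * n)
  have hN : ((5 * n).factorial : ℂ) ≠ 0 := by exact_mod_cast (5 * n).factorial_ne_zero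
  have v : ∀ (a : ℤ) (u : ℤ), ((5 * n).factorial : ℤ) * u = ffz (5 * n) (k + a) →
      (bP (5 * n) a).eval (k : ℂ) = u := by
    intro a u h
    apply mul_left_cancel₀ hN
    rw [bP_eval, ← h]; push_cast; rfl
  have v' : ∀ (a : ℤ) (w : ℤ), ((5 * n).factorial : ℤ) * w = Nat.lcmUpto (5 * n) * ggz (5 * n) (k + a) →
      (Nat.lcmUpto (5 * n) : ℂ) * (Polynomial.derivative (bP (5 * n) a)).eval (k : ℂ) = w := by
    intro a w h
    apply mul_left_cancel₀ hN
    rw [mul_left_comm, bP_deriv]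
    have := congrArg (fun z : ℤ => (z : ℂ)) h
    push_cast at this
    push_cast
    exact this.symm
  have hdiv : ∀ p, p.Prime → thN n p K ≠ 0 → (p : ℤ) ^ thN n p K ∣ u1 * u2 * u3 ∧
      (p : ℤ) ^ thN n p K ∣ w1 * u2 * u3 + u1 * w2 * u3 + u1 * u2 * w3 := by
    intro p hp h0
    rcases thN_cases n p K hp.pos with h | ⟨hq, h⟩
    · exact absurd h h0
    have h5 : 5 * n < p ^ 2 := by
      have h1 : n < K * p := (Nat.div_lt_iff_lt_mul hp.pos).1 hq
      nlinarith
    rcases h with ⟨h1, h2⟩ | ⟨h1, h2⟩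
    · have hc := main_cnt n p _ hp.pos k h2
      have := main_div n p hp h5 k u1 u2 u3 w1 w2 w3 hu1 hu2 hu3 hw1 hw2 hw3 _ hc (by omega)
      exact ⟨this.1, this.2.2 h1⟩
    · have hc := main_cnt n p 2 hp.pos k (Or.inr ⟨rfl, Or.inl h2⟩)
      have := main_div n p hp h5 k u1 u2 u3 w1 w2 w3 hu1 hu2 hu3 hw1 hw2 hw3 _ hc (by omega)
      rw [h1]
      exact ⟨(pow_dvd_pow _ (by norm_num)).trans this.1, this.2.1⟩
  obtain ⟨U, hU⟩ := MM_dvd n K _ (fun p hp h0 => (hdiv p hp h0).1)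
  obtain ⟨V, hV⟩ := MM_dvd n K _ (fun p hp h0 => (hdiv p hp h0).2)
  refine ⟨U, V, ?_, ?_⟩
  · rw [← hU]
    unfold RR
    rw [Polynomial.eval_mul, Polynomial.eval_mul, v _ u1 hu1, v _ u2 hu2, v _ u3 hu3]
    push_cast; rfl
  · rw [← hV]
    unfold RR
    rw [Polynomial.derivative_mul, Polynomial.derivative_mul]
    simp only [Polynomial.eval_mul, Polynomial.eval_add]
    rw [v _ u1 hu1, v _ u2 hu2, v _ u3 hu3]
    have := v' _ w1 hw1
    have := v' _ w2 hw2
    have := v' _ w3 hw3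
    push_cast
    linear_combination (u2 * u3 : ℂ) * v' _ w1 hw1 + (u1 * u3 : ℂ) * v' _ w2 hw2 + (u1 * u2 : ℂ) * v' _ w3 hw3

noncomputable def cc (n K : ℕ) : ℝ := (Nat.lcmUpto (5 * n) : ℝ) / MM n K

lemma cc_pos (n K : ℕ) : 0 < cc n K :=
  div_pos (by exact_mod_cast Nat.lcmUpto_pos _) (by exact_mod_cast MM_pos n K)

lemma cc_int (n K : ℕ) (hK : 1 ≤ K) (hn : 5 * K ^ 2 ≤ n) (j : ℕ) (k : ℤ) :
    (∃ a : ℤ, (cc n K : ℂ) * (RR n * Polynomial.X ^ j).eval (k : ℂ) = a) ∧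
    (∃ a : ℤ, (cc n K : ℂ) * (Polynomial.derivative (RR n * Polynomial.X ^ j)).eval (k : ℂ) = a) := by
  obtain ⟨U, V, hU, hV⟩ := RR_int n K hK hn k
  have hM : (MM n K : ℂ) ≠ 0 := by exact_mod_cast (MM_pos n K).ne'
  have h1 : (cc n K : ℂ) * (RR n).eval (k : ℂ) = ((Nat.lcmUpto (5 * n) : ℤ) * U : ℤ) := by
    rw [hU, cc]; push_cast; field_simp
  have h2 : (cc n K : ℂ) * (Polynomial.derivative (RR n)).eval (k : ℂ) = V := by
    rw [cc]; push_cast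
    rw [div_mul_eq_mul_div, hV]; push_cast; field_simp
  constructor
  · refine ⟨(Nat.lcmUpto (5 * n) : ℤ) * U * k ^ j, ?_⟩
    rw [Polynomial.eval_mul, ← mul_assoc, h1]
    simp
  · refine ⟨V * k ^ j + (Nat.lcmUpto (5 * n) : ℤ) * U * (j * k ^ (j - 1)), ?_⟩
    rw [Polynomial.derivative_mul, Polynomial.eval_add, Polynomial.eval_mul, Polynomial.eval_mul,
      mul_add, ← mul_assoc, ← mul_assoc, h1, h2, Polynomial.derivative_X_pow]
    simp

noncomputable def xA (i : Fin 8) (m : ℕ) : ℝ := iAd i / (m * iAd i + iA i)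
noncomputable def xB (i : Fin 8) (m : ℕ) : ℝ := 5 / (m * 5 + iB i)

lemma iAd_pos (i : Fin 8) : 0 < iAd i := by fin_cases i <;> decide
lemma iA_pos (i : Fin 8) : 0 < iA i := by fin_cases i <;> decide
lemma iB_le (i : Fin 8) : 0 < iB i ∧ iB i < 5 := by fin_cases i <;> decide
lemma iAB (i : Fin 8) : 5 * iA i ≤ iB i * iAd i := by fin_cases i <;> decide
lemma iA6 (i : Fin 8) : i = 0 ∨ iAd i ≤ 6 * iA i := by fin_cases i <;> decide

lemma xA_pos (i : Fin 8) (m : ℕ) : 0 < xA i m := by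
  have := iAd_pos i
  have := iA_pos i
  unfold xA; positivity
lemma xB_pos (i : Fin 8) (m : ℕ) : 0 < xB i m := by
  have := (iB_le i).1
  unfold xB; positivity
lemma xB_le_xA (i : Fin 8) (m : ℕ) : xB i m ≤ xA i m := by
  have h1 := iAd_pos i
  have h2 := iA_pos i
  have h3 := (iB_le i).1
  have h4 := iAB i
  unfold xA xB
  rw [div_le_div_iff₀ (by positivity) (by positivity)]
  have : (5 * iA i : ℝ) ≤ iB i * iAd i := by exact_mod_cast h4
  nlinarith

def Rm (K : ℕ) (i : Fin 8) : Finset ℕ := (range K).filter fun m => i = 0 → m ≠ 0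

lemma theta_diff (x y : ℝ) (h : y ≤ x) (N : ℕ) (hN : x ≤ N) :
    Chebyshev.theta x - Chebyshev.theta y =
      ∑ p ∈ (range (N + 1)).filter Nat.Prime, if y < p ∧ (p : ℝ) ≤ x then Real.log p else 0 := by
  have key : ∀ z : ℝ, z ≤ N → Chebyshev.theta z =
      ∑ p ∈ (range (N + 1)).filter Nat.Prime, if (p : ℝ) ≤ z then Real.log p else 0 := by
    intro z hz
    rw [Chebyshev.theta, ← Finset.sum_filter, Finset.filter_filter]
    apply Finset.sum_congr _ (fun _ _ => rfl)
    ext p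
    simp only [mem_filter, mem_Ioc, mem_range]
    constructor
    · rintro ⟨⟨h1, h2⟩, h3⟩
      have := (Nat.le_floor_iff' h1.ne').1 h2
      refine ⟨?_, h3, this⟩
      have : (p : ℝ) ≤ N := this.trans hz
      have : p ≤ N := by exact_mod_cast this
      omega
    · rintro ⟨h1, h2, h3⟩
      exact ⟨⟨h2.pos, (Nat.le_floor_iff' h2.ne_zero).2 h3⟩, h2⟩
  rw [key x hN, key y (h.trans hN), ← Finset.sum_sub_distrib]
  apply Finset.sum_congr rfl
  intro p _
  by_cases h1 : (p : ℝ) ≤ y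
  · rw [if_pos h1, if_pos (h1.trans h), if_neg (by intro h2; linarith [h2.1]), sub_self]
  · rw [if_neg h1, sub_zero]
    push Not at h1
    simp [h1]

lemma logMM (n K : ℕ) (hn : 1 ≤ n) :
    ∑ i : Fin 8, ∑ m ∈ Rm K i, (Chebyshev.theta (xA i m * n) - Chebyshev.theta (xB i m * n)) ≤
      Real.log (MM n K) := by
  have hn0 : (0 : ℝ) < n := by exact_mod_cast hn
  have e1 : Real.log (MM n K) = ∑ i : Fin 8, ∑ p ∈ (range (6 * n + 1)).filter Nat.Prime,
      if icond n p K i then Real.log p else 0 := by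
    unfold MM
    push_cast
    rw [Real.log_prod (by intro p hp; have := (mem_filter.1 hp).2.pos; positivity), Finset.sum_comm]
    apply Finset.sum_congr rfl
    intro p _
    rw [Real.log_pow, thN]
    push_cast
    rw [Finset.sum_mul]
    apply Finset.sum_congr rfl
    intro i _
    split_ifs <;> simp
  rw [e1]
  apply Finset.sum_le_sum
  intro i _
  have e2 : ∀ m ∈ Rm K i, Chebyshev.theta (xA i m * n) - Chebyshev.theta (xB i m * n) =
      ∑ p ∈ (range (6 * n + 1)).filter Nat.Prime,
        if xB i m * n < p ∧ (p : ℝ) ≤ xA i m * n then Real.log p else 0 := by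
    intro m hm
    apply theta_diff _ _ (mul_le_mul_of_nonneg_right (xB_le_xA i m) hn0.le)
    push_cast
    apply mul_le_mul_of_nonneg_right _ hn0.le
    have h1 := iAd_pos i
    have h2 := iA_pos i
    unfold xA
    rw [div_le_iff₀ (by positivity)]
    rcases iA6 i with h | h
    · have := (mem_filter.1 hm).2 h
      have h3 : (1 : ℝ) ≤ m := by exact_mod_cast Nat.one_le_iff_ne_zero.2 this
      have h4 : (0 : ℝ) < iAd i := by exact_mod_cast h1
      have h5 : (0 : ℝ) < iA i := by exact_mod_cast h2
      nlinarith
    · have : (iAd i : ℝ) ≤ 6 * iA i := by exact_mod_cast h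
      have : (0 : ℝ) ≤ m * iAd i := by positivity
      linarith
  rw [Finset.sum_congr rfl e2, Finset.sum_comm]
  apply Finset.sum_le_sum
  intro p hp
  have hpp := (mem_filter.1 hp).2
  have hlog : 0 ≤ Real.log p := Real.log_natCast_nonneg p
  calc ∑ m ∈ Rm K i, (if xB i m * n < p ∧ (p : ℝ) ≤ xA i m * n then Real.log p else 0)
      ≤ ∑ m ∈ Rm K i, (if n / p = m then (if icond n p K i then Real.log p else 0) else 0) := by
        apply Finset.sum_le_sum
        intro m hm
        by_cases h : xB i m * n < p ∧ (p : ℝ) ≤ xA i m * n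
        · rw [if_pos h]
          obtain ⟨h1, h2⟩ := h
          have a1 := iAd_pos i
          have a2 := iA_pos i
          have a3 := iB_le i
          unfold xB at h1
          unfold xA at h2
          have a3' : 0 < iB i := a3.1
          rw [div_mul_eq_mul_div, div_lt_iff₀ (by positivity)] at h1
          rw [div_mul_eq_mul_div, le_div_iff₀ (by positivity)] at h2
          have h1' : 5 * n < p * (m * 5 + iB i) := by exact_mod_cast h1
          have h2' : p * (m * iAd i + iA i) ≤ iAd i * n := by exact_mod_cast h2
          have hq : n / p = m := by
            apply Nat.div_eq_of_lt_le
            · have : iAd i * (m * p) ≤ iAd i * n := by nlinarith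
              exact le_of_mul_le_mul_left this a1
            · nlinarith [hpp.pos]
          have hr : n % p + p * m = n := by rw [← hq]; exact Nat.mod_add_div n p
          have hm' := mem_filter.1 hm
          have hic : icond n p K i := by
            refine ⟨⟨?_, ?_⟩, ?_, ?_⟩
            · generalize n % p = r at *
              have : p * (m * iAd i + iA i) ≤ iAd i * (r + p * m) := by rw [hr]; exact h2'
              nlinarith
            · generalize n % p = r at *
              have : 5 * (r + p * m) < p * (m * 5 + iB i) := by rw [hr]; exact h1'
              nlinarith
            · rw [hq]; exact mem_range.1 hm'.1
            · rw [hq]; exact hm'.2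
          rw [if_pos hq, if_pos hic]
        · rw [if_neg h]
          split_ifs <;> first | exact hlog | exact le_rfl
    _ ≤ _ := by
        rw [Finset.sum_ite_eq]
        split_ifs <;> first | exact hlog | exact le_rfl

noncomputable def Dsum (K : ℕ) : ℝ := ∑ i : Fin 8, ∑ m ∈ Rm K i, (xA i m - xB i m)

open Filter Topology in
lemma log_cc (K : ℕ) (D : ℝ) (hD : 5 - Dsum K < D) :
    ∀ᶠ n : ℕ in atTop, Real.log (cc n K) ≤ D * n := by
  have hth : ∀ α : ℝ, 0 < α → Tendsto (fun n : ℕ => Chebyshev.theta (α * n) / n) atTop (𝓝 α) := by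
    intro α hα
    have h1 : Tendsto (fun n : ℕ => α * (n : ℝ)) atTop atTop :=
      Tendsto.const_mul_atTop hα tendsto_natCast_atTop_atTop
    have h2 := (pnt_theta.comp h1).const_mul α
    rw [mul_one] at h2
    refine h2.congr' ?_
    filter_upwards [eventually_ge_atTop 1] with n hn
    have : (0 : ℝ) < n := by exact_mod_cast hn
    simp only [Function.comp]
    field_simp
  have hps : Tendsto (fun n : ℕ => Chebyshev.psi (5 * n) / n) atTop (𝓝 5) := by
    have h1 : Tendsto (fun n : ℕ => 5 * (n : ℝ)) atTop atTop :=
      Tendsto.const_mul_atTop (by norm_num) tendsto_natCast_atTop_atTop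
    have h2 := (pnt_psi.comp h1).const_mul 5
    rw [mul_one] at h2
    refine h2.congr' ?_
    filter_upwards [eventually_ge_atTop 1] with n hn
    have : (0 : ℝ) < n := by exact_mod_cast hn
    simp only [Function.comp]
    field_simp
  have hsum : Tendsto (fun n : ℕ => ∑ i : Fin 8, ∑ m ∈ Rm K i,
      (Chebyshev.theta (xA i m * n) / n - Chebyshev.theta (xB i m * n) / n)) atTop (𝓝 (Dsum K)) := by
    unfold Dsum
    apply tendsto_finsetSum
    intro i _
    apply tendsto_finsetSum
    intro m _
    exact (hth _ (xA_pos i m)).sub (hth _ (xB_pos i m))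
  have := (hps.sub hsum).eventually_lt_const hD
  filter_upwards [this, eventually_ge_atTop 1] with n h hn
  have hn0 : (0 : ℝ) < n := by exact_mod_cast hn
  have h2 := logMM n K hn
  have h3 : Real.log (cc n K) = Chebyshev.psi (5 * n) - Real.log (MM n K) := by
    unfold cc
    rw [Real.log_div (by exact_mod_cast (Nat.lcmUpto_ne_zero _)) (by exact_mod_cast (MM_pos n K).ne'),
      ← Chebyshev.psi_eq_log_lcmUpto]
    push_cast; rfl
  have h4 : (∑ i : Fin 8, ∑ m ∈ Rm K i,
      (Chebyshev.theta (xA i m * n) / n - Chebyshev.theta (xB i m * n) / n)) =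
      (∑ i : Fin 8, ∑ m ∈ Rm K i, (Chebyshev.theta (xA i m * n) - Chebyshev.theta (xB i m * n))) / n := by
    simp only [← sub_div, Finset.sum_div]
  rw [h4, ← sub_div, div_lt_iff₀ hn0] at h
  rw [h3]
  linarith

end

section
open Finset Filter Topology

noncomputable def TT (u : ℝ) : ℝ := 1 / u - 1 / (12 * u ^ 3)

lemma TT_step (x : ℝ) (hx : 1 ≤ x) : TT (x - 1 / 2) - TT (x + 1 / 2) ≤ 1 / x ^ 2 := by
  unfold TT
  have h1 : 0 < x - 1 / 2 := by linarith
  have h2 : 0 < x + 1 / 2 := by linarith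
  rw [← sub_nonneg]
  have : 1 / x ^ 2 - (1 / (x - 1 / 2) - 1 / (12 * (x - 1 / 2) ^ 3) -
      (1 / (x + 1 / 2) - 1 / (12 * (x + 1 / 2) ^ 3))) =
      (7 / 4 * x ^ 2 - 3 / 16) / (12 * x ^ 2 * (x - 1 / 2) ^ 3 * (x + 1 / 2) ^ 3) := by
    have h3 : x ≠ 0 := by linarith
    obtain ⟨u, hu⟩ : ∃ u, x = u / 2 := ⟨2 * x, by ring⟩
    subst hu
    have h4 : u - 1 ≠ 0 := by intro h; linarith
    have h5 : u + 1 ≠ 0 := by intro h; linarith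
    have h6 : u ≠ 0 := by intro h; apply h3; rw [h]; simp
    rw [show u / 2 - 1 / 2 = (u - 1) / 2 by ring, show u / 2 + 1 / 2 = (u + 1) / 2 by ring]
    field_simp
    ring
  rw [this]
  apply div_nonneg
  · nlinarith
  · positivity

lemma TT_tail (a b : ℝ) (ha : 0 < a) (hab : a ≤ b) (M : ℕ) (hM : 1 ≤ M) (J : ℕ) :
    (b - a) * (TT (M + (a + b) / 2 - 1 / 2) - TT (M + J + (a + b) / 2 - 1 / 2)) ≤
      ∑ m ∈ Ico M (M + J), (1 / (m + a) - 1 / (m + b)) := by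
  induction J with
  | zero => simp
  | succ j ih =>
    rw [← add_assoc, sum_Ico_succ_top (by omega)]
    have hM' : (1 : ℝ) ≤ M := by exact_mod_cast hM
    have hj : (0 : ℝ) ≤ j := by positivity
    have h1 := TT_step (M + j + (a + b) / 2) (by linarith)
    have h2 : (b - a) * (1 / (M + j + (a + b) / 2) ^ 2) ≤ 1 / (((M + j : ℕ) : ℝ) + a) - 1 / (((M + j : ℕ) : ℝ) + b) := by
      push_cast
      have hb : 0 < b := by linarith
      rw [div_sub_div _ _ (by positivity) (by positivity), mul_one_div, div_le_div_iff₀ (by positivity) (by positivity)]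
      have : ((M : ℝ) + j + a) * (M + j + b) ≤ (M + j + (a + b) / 2) ^ 2 := by nlinarith [sq_nonneg (a - b)]
      have := mul_le_mul_of_nonneg_left this (sub_nonneg.2 hab)
      linarith
    have h3 := mul_le_mul_of_nonneg_left h1 (sub_nonneg.2 hab)
    push_cast
    rw [show (M : ℝ) + j + (a + b) / 2 + 1 / 2 = M + (j + 1) + (a + b) / 2 - 1 / 2 by ring] at h3
    push_cast at h2
    rw [mul_sub] at h3 ih ⊢
    linarith

lemma TT_lim (M : ℕ) (c : ℝ) : Tendsto (fun J : ℕ => TT (M + J + c)) atTop (𝓝 0) := by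
  have h1 : Tendsto (fun J : ℕ => (M + J + c : ℝ)) atTop atTop := by
    have := tendsto_atTop_add_const_left atTop ((M : ℝ) + c) (tendsto_natCast_atTop_atTop (R := ℝ))
    refine this.congr fun J => by ring
  have h2 : Tendsto TT atTop (𝓝 0) := by
    unfold TT
    have a1 : Tendsto (fun u : ℝ => 1 / u) atTop (𝓝 0) := by
      simpa using tendsto_inv_atTop_zero (𝕜 := ℝ)
    have a2 : Tendsto (fun u : ℝ => 1 / (12 * u ^ 3)) atTop (𝓝 0) := by
      have := (a1.pow 3).const_mul (1 / 12)
      simp only [ne_eq, OfNat.ofNat_ne_zero, not_false_eq_true, zero_pow, mul_zero] at this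
      refine this.congr fun u => by rw [div_pow]; ring
    simpa using a1.sub a2
  exact h2.comp h1

noncomputable def fA (i : Fin 8) : ℝ := iA i / iAd i
noncomputable def fB (i : Fin 8) : ℝ := iB i / 5

lemma x_eq (i : Fin 8) (m : ℕ) : xA i m - xB i m = 1 / (m + fA i) - 1 / (m + fB i) := by
  have := iAd_pos i
  have h : (iAd i : ℝ) ≠ 0 := by exact_mod_cast this.ne'
  unfold xA xB fA fB
  congr 1
  · field_simp
  · field_simp

lemma Dsum_lower (M : ℕ) (hM : 1 ≤ M) (L : ℝ)
    (hL : L < ∑ i : Fin 8, ((∑ m ∈ Rm M i, (xA i m - xB i m)) +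
      (fB i - fA i) * TT (M + (fA i + fB i) / 2 - 1 / 2))) : ∃ K, 1 ≤ K ∧ L < Dsum K := by
  have hlim : Tendsto (fun J : ℕ => ∑ i : Fin 8, ((∑ m ∈ Rm M i, (xA i m - xB i m)) +
      (fB i - fA i) * (TT (M + (fA i + fB i) / 2 - 1 / 2) - TT (M + J + (fA i + fB i) / 2 - 1 / 2)))) atTop
      (𝓝 (∑ i : Fin 8, ((∑ m ∈ Rm M i, (xA i m - xB i m)) +
      (fB i - fA i) * TT (M + (fA i + fB i) / 2 - 1 / 2)))) := by
    apply tendsto_finsetSum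
    intro i _
    apply Tendsto.const_add
    apply Tendsto.const_mul
    have := (TT_lim M ((fA i + fB i) / 2 - 1 / 2)).const_sub (TT (M + (fA i + fB i) / 2 - 1 / 2))
    rw [sub_zero] at this
    refine this.congr fun J => ?_
    rw [add_sub_assoc (M + J : ℝ)]
    
  obtain ⟨J, hJ⟩ := (hlim.eventually_const_lt hL).exists
  refine ⟨M + J, by omega, lt_of_lt_of_le hJ ?_⟩
  unfold Dsum
  apply Finset.sum_le_sum
  intro i _
  have hR : Rm (M + J) i = Rm M i ∪ Ico M (M + J) := by
    ext m; simp only [Rm, mem_filter, mem_range, mem_union, mem_Ico]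
    constructor
    · intro h
      rcases lt_or_ge m M with h1 | h1
      · exact Or.inl ⟨h1, h.2⟩
      · exact Or.inr ⟨h1, h.1⟩
    · rintro (h | h)
      · exact ⟨by omega, h.2⟩
      · exact ⟨h.2, fun _ => by omega⟩
  have hdis : Disjoint (Rm M i) (Ico M (M + J)) := by
    rw [Finset.disjoint_left]; intro m; simp only [Rm, mem_filter, mem_range, mem_Ico]; omega
  rw [hR, sum_union hdis]
  have hA : 0 < fA i := by
    have := iAd_pos i
    have := iA_pos i
    unfold fA; positivity
  have hAB : fA i ≤ fB i := by
    have h1 := iAd_pos i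
    unfold fA fB
    rw [div_le_div_iff₀ (by positivity) (by norm_num)]
    have := iAB i
    have : (5 * iA i : ℝ) ≤ iB i * iAd i := by exact_mod_cast this
    linarith
  have := TT_tail (fA i) (fB i) hA hAB M hM J
  simp only [x_eq] at *
  linarith

lemma Rm_sum (M : ℕ) (hM : 1 ≤ M) (i : Fin 8) (f : ℕ → ℝ) :
    ∑ m ∈ Rm M i, f m = (∑ m ∈ range M, f m) - if i = 0 then f 0 else 0 := by
  unfold Rm
  split_ifs with h
  · rw [eq_sub_iff_add_eq, add_comm]
    have : (range M).filter (fun m => i = 0 → m ≠ 0) = (range M).erase 0 := by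
      ext m; simp [h]; tauto
    rw [this]
    exact Finset.add_sum_erase _ _ (by simp; omega)
  · rw [sub_zero]
    congr 1
    ext m; simp [h]

lemma i_vals : iA 0 = 1 ∧ iA 1 = 2 ∧ iA 2 = 1 ∧ iA 3 = 2 ∧ iA 4 = 1 ∧ iA 5 = 1 ∧ iA 6 = 4 ∧ iA 7 = 3 ∧ iAd 0 = 7 ∧ iAd 1 = 7 ∧ iAd 2 = 2 ∧ iAd 3 = 3 ∧ iAd 4 = 6 ∧ iAd 5 = 3 ∧ iAd 6 = 7 ∧ iAd 7 = 4 ∧ iB 0 = 1 ∧ iB 1 = 2 ∧ iB 2 = 3 ∧ iB 3 = 4 ∧ iB 4 = 1 ∧ iB 5 = 2 ∧ iB 6 = 3 ∧ iB 7 = 4 := by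
  refine ⟨rfl, rfl, rfl, rfl, rfl, rfl, rfl, rfl, rfl, rfl, rfl, rfl, rfl, rfl, rfl, rfl, rfl, rfl, rfl, rfl, rfl, rfl, rfl, rfl⟩
lemma Fin_vals : (((1 : Fin 8) = 0) = False) ∧ (((2 : Fin 8) = 0) = False) ∧ (((3 : Fin 8) = 0) = False) ∧ (((4 : Fin 8) = 0) = False) ∧ (((5 : Fin 8) = 0) = False) ∧ (((6 : Fin 8) = 0) = False) ∧ (((7 : Fin 8) = 0) = False) := by
  refine ⟨eq_false (by decide), eq_false (by decide), eq_false (by decide), eq_false (by decide), eq_false (by decide), eq_false (by decide), eq_false (by decide)⟩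

lemma Dsum_num : ∃ K, 1 ≤ K ∧ 3.8179308 < Dsum K := by
  apply Dsum_lower 16 (by norm_num)
  obtain ⟨a0, a1, a2, a3, a4, a5, a6, a7, a8, a9, a10, a11, a12, a13, a14, a15, a16, a17, a18, a19, a20, a21, a22, a23⟩ := i_vals
  obtain ⟨b0, b1, b2, b3, b4, b5, b6⟩ := Fin_vals
  simp only [Rm_sum 16 (by norm_num), Fin.sum_univ_eight, xA, xB, fA, fB, TT, Finset.sum_range_succ,
    Finset.sum_range_zero, a0, a1, a2, a3, a4, a5, a6, a7, a8, a9, a10, a11, a12, a13, a14, a15, a16, a17, a18, a19, a20, a21, a22, a23, b0, b1, b2, b3, b4, b5, b6, if_true, if_false]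
  norm_num

end

section
open Filter Topology Set Complex

lemma norm_sin_ge (z : ℂ) : (Real.exp |z.im| - Real.exp (-|z.im|)) / 2 ≤ ‖Complex.sin z‖ := by
  have h1 : ‖Complex.exp (-z * I)‖ = Real.exp z.im := by
    rw [Complex.norm_exp]; simp
  have h2 : ‖Complex.exp (z * I)‖ = Real.exp (-z.im) := by
    rw [Complex.norm_exp]; simp
  have h3 : ‖Complex.sin z‖ = ‖Complex.exp (-z * I) - Complex.exp (z * I)‖ / 2 := by
    rw [Complex.sin]; simp
  rw [h3]
  have a1 := norm_sub_norm_le (Complex.exp (-z * I)) (Complex.exp (z * I))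
  have a2 := norm_sub_norm_le (Complex.exp (z * I)) (Complex.exp (-z * I))
  rw [norm_sub_rev] at a2
  rw [h1, h2] at a1 a2
  rcases abs_cases z.im with ⟨h, _⟩ | ⟨h, _⟩
  · rw [h]; linarith
  · rw [h, neg_neg]; linarith

lemma tanh_int (R : ℝ) : ∫ y in (-R)..R, (Real.pi ^ 2 / Real.cosh (Real.pi * y) ^ 2) =
    2 * Real.pi * (Real.sinh (Real.pi * R) / Real.cosh (Real.pi * R)) := by
  have hd : ∀ y ∈ uIcc (-R) R, HasDerivAt (fun y => Real.pi * (Real.sinh (Real.pi * y) / Real.cosh (Real.pi * y)))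
      (Real.pi ^ 2 / Real.cosh (Real.pi * y) ^ 2) y := by
    intro y _
    have hm : HasDerivAt (fun y : ℝ => Real.pi * y) Real.pi y := by
      simpa using (hasDerivAt_id y).const_mul Real.pi
    have hc := (Real.cosh_pos (Real.pi * y)).ne'
    have := ((hm.sinh.div hm.cosh hc).const_mul Real.pi)
    refine this.congr_deriv ?_
    have := Real.cosh_sq (Real.pi * y)
    field_simp
    linear_combination this
  rw [intervalIntegral.integral_eq_sub_of_hasDerivAt hd]
  · rw [mul_neg, Real.sinh_neg, Real.cosh_neg]; ring
  · apply Continuous.intervalIntegrable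
    refine Continuous.div (by fun_prop) (by fun_prop) (fun y => ?_)
    exact pow_ne_zero _ (Real.cosh_pos _).ne'

lemma tanh_lim : Tendsto (fun R : ℝ => Real.sinh (Real.pi * R) / Real.cosh (Real.pi * R)) atTop (𝓝 1) := by
  have h : ∀ R : ℝ, Real.sinh (Real.pi * R) / Real.cosh (Real.pi * R) =
      (1 - Real.exp (-(2 * Real.pi * R))) / (1 + Real.exp (-(2 * Real.pi * R))) := by
    intro R
    rw [Real.sinh_eq, Real.cosh_eq, div_eq_div_iff (by positivity) (by positivity)]
    have : Real.exp (-(2 * Real.pi * R)) = Real.exp (-(Real.pi * R)) * Real.exp (-(Real.pi * R)) := by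
      rw [← Real.exp_add]; ring_nf
    rw [this]
    have : Real.exp (Real.pi * R) * Real.exp (-(Real.pi * R)) = 1 := by rw [← Real.exp_add]; simp
    linear_combination Real.exp (-(Real.pi * R)) * this
  simp_rw [h]
  have : Tendsto (fun R : ℝ => Real.exp (-(2 * Real.pi * R))) atTop (𝓝 0) := by
    apply Real.tendsto_exp_neg_atTop_nhds_zero.comp
    exact tendsto_id.const_mul_atTop (by positivity)
  have := Tendsto.div (this.const_sub 1) (this.const_add 1) (by norm_num)
  simp only [sub_zero, add_zero, div_one] at this
  exact this

lemma strip_id (F : ℂ → ℂ) (hF : Differentiable ℂ F) (C a : ℝ) (ha : a < 2 * Real.pi)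
    (hb : ∀ x y : ℝ, |x| ≤ 1 / 2 → ‖F (x + y * I)‖ ≤ C * Real.exp (a * |y|)) :
    Tendsto (fun R : ℝ => ∫ y in (-R)..R, (F ((1 / 2 : ℝ) + y * I) - F ((-1 / 2 : ℝ) + y * I)) *
      ((Real.pi ^ 2 / Real.cosh (Real.pi * y) ^ 2 : ℝ) : ℂ)) atTop (𝓝 (2 * Real.pi * deriv F 0)) := by
  set F1 := dslope F 0 with hF1
  set F2 := dslope F1 0 with hF2
  set sg := dslope (fun t : ℂ => Complex.sin (Real.pi * t)) 0 with hsg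
  have dF1 : Differentiable ℂ F1 := by
    have := (Complex.differentiableOn_dslope (s := univ) (c := 0) univ_mem).2 hF.differentiableOn
    exact differentiableOn_univ.1 this
  have dF2 : Differentiable ℂ F2 := by
    have := (Complex.differentiableOn_dslope (s := univ) (c := 0) univ_mem).2 dF1.differentiableOn
    exact differentiableOn_univ.1 this
  have dsin : Differentiable ℂ (fun t : ℂ => Complex.sin (Real.pi * t)) := by fun_prop
  have dsg : Differentiable ℂ sg := by
    have := (Complex.differentiableOn_dslope (s := univ) (c := 0) univ_mem).2 dsin.differentiableOn
    exact differentiableOn_univ.1 this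
  have e1 : ∀ t, F t = F 0 + t * deriv F 0 + t ^ 2 * F2 t := by
    intro t
    have a1 := sub_smul_dslope F 0 t
    have a2 := sub_smul_dslope F1 0 t
    rw [← hF1] at a1; rw [← hF2] at a2
    have a3 : F1 0 = deriv F 0 := dslope_same _ _
    simp only [sub_zero, smul_eq_mul] at a1 a2
    rw [a3] at a2
    linear_combination (-1) * a1 - t * a2
  have e2 : ∀ t, Complex.sin (Real.pi * t) = t * sg t := by
    intro t
    have a1 := sub_smul_dslope (fun t : ℂ => Complex.sin (Real.pi * t)) 0 t
    simp only [sub_zero, smul_eq_mul, mul_zero, Complex.sin_zero] at a1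
    exact a1.symm
  have sg0 : sg 0 = Real.pi := by
    have : HasDerivAt (fun t : ℂ => Complex.sin (Real.pi * t)) (Complex.cos (Real.pi * 0) * Real.pi) 0 := by
      have hm : HasDerivAt (fun t : ℂ => (Real.pi : ℂ) * t) Real.pi 0 := by
        simpa using (hasDerivAt_id (0:ℂ)).const_mul (Real.pi : ℂ)
      exact hm.csin
    rw [hsg, dslope_same, this.deriv]; simp
  have pine : (Real.pi : ℂ) ≠ 0 := by exact_mod_cast Real.pi_ne_zero
  have sgne : ∀ t : ℂ, |t.re| ≤ 1 / 2 → sg t ≠ 0 := by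
    intro t ht h
    by_cases h0 : t = 0
    · rw [h0, sg0] at h; exact pine h
    · have := e2 t
      rw [h, mul_zero, Complex.sin_eq_zero_iff] at this
      obtain ⟨k, hk⟩ := this
      have : t = k := by
        apply mul_left_cancel₀ pine; rw [hk]; ring
      rw [this] at ht h0
      simp only [intCast_re] at ht
      have : |k| < 1 := by
        have : |(k:ℝ)| < 1 := by linarith
        exact_mod_cast this
      apply h0
      rw [Int.abs_lt_one_iff.1 this]; simp
  set g : ℂ → ℂ := fun t => Real.pi ^ 2 * (F2 t / sg t ^ 2) with hg
  have key : ∀ R : ℝ, 0 ≤ R → (∫ y in (-R)..R, (F ((1 / 2 : ℝ) + y * I) - F ((-1 / 2 : ℝ) + y * I)) *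
      ((Real.pi ^ 2 / Real.cosh (Real.pi * y) ^ 2 : ℝ) : ℂ)) =
      deriv F 0 * ((2 * Real.pi * (Real.sinh (Real.pi * R) / Real.cosh (Real.pi * R)) : ℝ) : ℂ) +
      I * ((∫ x in (-1 / 2 : ℝ)..(1 / 2 : ℝ), g (x + (-R : ℝ) * I)) - ∫ x in (-1 / 2 : ℝ)..(1 / 2 : ℝ), g (x + R * I)) := by
    intro R hR
    have hrect := Complex.integral_boundary_rect_eq_zero_of_differentiableOn g
      ⟨-1 / 2, -R⟩ ⟨1 / 2, R⟩ (by
        intro t ht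
        have ht1 := ht.1
        simp only [mem_preimage] at ht1
        rw [uIcc_of_le (by norm_num)] at ht1
        have : sg t ≠ 0 := sgne t (by rw [abs_le]; constructor <;> linarith [ht1.1, ht1.2])
        apply DifferentiableAt.differentiableWithinAt
        exact ((dF2 t).div ((dsg t).pow 2) (pow_ne_zero 2 this)).const_mul _)
    have hv : ∀ x : ℝ, |x| = 1 / 2 → ∀ y : ℝ, g (x + y * I) = (F (x + y * I) - F 0 - (x + y * I) * deriv F 0) *
        ((Real.pi ^ 2 / Real.cosh (Real.pi * y) ^ 2 : ℝ) : ℂ) := by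
      intro x hx y
      have ht := sgne (x + y * I) (by simp [hx])
      have hc : Complex.sin (Real.pi * (x + y * I)) ^ 2 = (Real.cosh (Real.pi * y) : ℂ) ^ 2 := by
        rw [mul_add, ← mul_assoc, Complex.sin_add_mul_I]
        have hcos : Complex.cos (Real.pi * x) = 0 := by
          rcases eq_or_eq_neg_of_abs_eq hx with h | h
          · rw [h]; push_cast; rw [show (Real.pi : ℂ) * (1 / 2) = Real.pi / 2 by ring]; exact Complex.cos_pi_div_two
          · rw [h]; push_cast; rw [show (Real.pi : ℂ) * (-(1 / 2)) = -(Real.pi / 2) by ring, Complex.cos_neg]; exact Complex.cos_pi_div_two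
        have hs : Complex.sin (Real.pi * x) ^ 2 = 1 := by
          have := Complex.sin_sq_add_cos_sq (Real.pi * x)
          rw [hcos] at this; simpa using this
        rw [hcos, zero_mul, zero_mul, add_zero, mul_pow, hs, one_mul]
        push_cast; rfl
      have hcne : (Real.cosh (Real.pi * y) : ℂ) ≠ 0 := by exact_mod_cast (Real.cosh_pos _).ne'
      have hf := e1 (x + y * I)
      rw [e2, mul_pow] at hc
      simp only [hg]
      rw [hf]
      rw [ofReal_div, ofReal_pow, ofReal_pow, ← hc]
      have h0 : (x + y * I : ℂ) ≠ 0 := by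
        intro h
        have := congrArg Complex.re h
        simp at this
        rw [this] at hx; norm_num at hx
      field_simp
      ring
    have c1 : ∀ x : ℝ, Continuous fun y : ℝ => (F (x + y * I) - F 0 - (x + y * I) * deriv F 0) *
        ((Real.pi ^ 2 / Real.cosh (Real.pi * y) ^ 2 : ℝ) : ℂ) := by
      intro x
      have := hF.continuous
      refine Continuous.mul (by fun_prop) (continuous_ofReal.comp (Continuous.div (by fun_prop) (by fun_prop) fun y => ?_))
      exact pow_ne_zero _ (Real.cosh_pos _).ne'
    have c2 : Continuous fun y : ℝ => deriv F 0 * ((Real.pi ^ 2 / Real.cosh (Real.pi * y) ^ 2 : ℝ) : ℂ) := by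
      refine Continuous.mul (by fun_prop) (continuous_ofReal.comp (Continuous.div (by fun_prop) (by fun_prop) fun y => ?_))
      exact pow_ne_zero _ (Real.cosh_pos _).ne'
    simp only [smul_eq_mul] at hrect
    have r1 : (∫ y in (-R)..R, g ((1 / 2 : ℝ) + y * I)) = ∫ y in (-R)..R, (F ((1 / 2 : ℝ) + y * I) - F 0 - ((1 / 2 : ℝ) + y * I) * deriv F 0) *
        ((Real.pi ^ 2 / Real.cosh (Real.pi * y) ^ 2 : ℝ) : ℂ) :=
      intervalIntegral.integral_congr fun y _ => hv (1 / 2) (by norm_num) y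
    have r2 : (∫ y in (-R)..R, g ((-1 / 2 : ℝ) + y * I)) = ∫ y in (-R)..R, (F ((-1 / 2 : ℝ) + y * I) - F 0 - ((-1 / 2 : ℝ) + y * I) * deriv F 0) *
        ((Real.pi ^ 2 / Real.cosh (Real.pi * y) ^ 2 : ℝ) : ℂ) :=
      intervalIntegral.integral_congr fun y _ => hv (-1 / 2) (by norm_num [abs_of_neg]) y
    rw [r1, r2] at hrect
    have r3 : (∫ y in (-R)..R, (F ((1 / 2 : ℝ) + y * I) - F ((-1 / 2 : ℝ) + y * I)) *
      ((Real.pi ^ 2 / Real.cosh (Real.pi * y) ^ 2 : ℝ) : ℂ)) =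
      (∫ y in (-R)..R, (F ((1 / 2 : ℝ) + y * I) - F 0 - ((1 / 2 : ℝ) + y * I) * deriv F 0) *
        ((Real.pi ^ 2 / Real.cosh (Real.pi * y) ^ 2 : ℝ) : ℂ)) - (∫ y in (-R)..R, (F ((-1 / 2 : ℝ) + y * I) - F 0 - ((-1 / 2 : ℝ) + y * I) * deriv F 0) *
        ((Real.pi ^ 2 / Real.cosh (Real.pi * y) ^ 2 : ℝ) : ℂ)) + ∫ y in (-R)..R, deriv F 0 * ((Real.pi ^ 2 / Real.cosh (Real.pi * y) ^ 2 : ℝ) : ℂ) := by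
      rw [← intervalIntegral.integral_sub ((c1 _).intervalIntegrable _ _) ((c1 _).intervalIntegrable _ _),
        ← intervalIntegral.integral_add (((c1 _).intervalIntegrable _ _).sub ((c1 _).intervalIntegrable _ _)) (c2.intervalIntegrable _ _)]
      apply intervalIntegral.integral_congr
      intro y _
      push_cast
      ring
    rw [r3, intervalIntegral.integral_const_mul, intervalIntegral.integral_ofReal, tanh_int]
    linear_combination (-I) * hrect - ((∫ y in (-R)..R, (F ((1 / 2 : ℝ) + y * I) - F 0 - ((1 / 2 : ℝ) + y * I) * deriv F 0) *
        ((Real.pi ^ 2 / Real.cosh (Real.pi * y) ^ 2 : ℝ) : ℂ)) - (∫ y in (-R)..R, (F ((-1 / 2 : ℝ) + y * I) - F 0 - ((-1 / 2 : ℝ) + y * I) * deriv F 0) *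
        ((Real.pi ^ 2 / Real.cosh (Real.pi * y) ^ 2 : ℝ) : ℂ))) * (-I_sq)
  -- horizontal bound
  set M : ℝ → ℝ := fun R => Real.pi ^ 2 * ((C * Real.exp (a * R) + ‖F 0‖ + (1 + R) * ‖deriv F 0‖) * (16 * Real.exp (-(2 * Real.pi * R)))) with hM
  have hC : 0 ≤ C := by
    have := (norm_nonneg _).trans (hb 0 0 (by norm_num))
    simpa using this
  have hor : ∀ R : ℝ, 1 ≤ |R| → ‖∫ x in (-1 / 2 : ℝ)..(1 / 2 : ℝ), g (x + R * I)‖ ≤ M |R| := by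
    intro R hR
    have : ‖∫ x in (-1 / 2 : ℝ)..(1 / 2 : ℝ), g (x + R * I)‖ ≤ M |R| * |1 / 2 - -1 / 2| := by
      apply intervalIntegral.norm_integral_le_of_norm_le_const
      intro x hx
      rw [uIoc_of_le (by norm_num)] at hx
      have hx' : |x| ≤ 1 / 2 := by rw [abs_le]; constructor <;> linarith [hx.1, hx.2]
      have hs := sgne (x + R * I) (by simpa using hx')
      have h0 : (x + R * I : ℂ) ≠ 0 := by
        intro h
        have := congrArg Complex.im h
        simp at this
        rw [this] at hR; norm_num at hR
      have hgf : g (x + R * I) = Real.pi ^ 2 * ((F (x + R * I) - F 0 - (x + R * I) * deriv F 0) /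
          Complex.sin (Real.pi * (x + R * I)) ^ 2) := by
        simp only [hg]
        rw [e2, e1 (x + R * I)]
        field_simp
        ring
      rw [hgf, norm_mul, norm_div, norm_pow, norm_pow]
      simp only [norm_real, Real.norm_eq_abs, abs_of_pos Real.pi_pos]
      simp only [hM]
      apply mul_le_mul_of_nonneg_left _ (by positivity)
      rw [div_eq_mul_inv]
      apply mul_le_mul
      · have n1 := norm_sub_le (F (x + R * I) - F 0) ((x + R * I) * deriv F 0)
        have n2 := norm_sub_le (F (x + R * I)) (F 0)
        have n3 := hb x R hx'
        have n4 : ‖(x + R * I) * deriv F 0‖ ≤ (1 + |R|) * ‖deriv F 0‖ := by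
          rw [norm_mul]
          apply mul_le_mul_of_nonneg_right _ (norm_nonneg _)
          have := norm_add_le (x : ℂ) (R * I)
          simp only [norm_mul, norm_real, Real.norm_eq_abs, norm_I, mul_one] at this
          linarith
        linarith
      · have hs2 := norm_sin_ge (Real.pi * (x + R * I))
        have him : ((Real.pi : ℂ) * (x + R * I)).im = Real.pi * R := by simp
        rw [him, abs_mul, abs_of_pos Real.pi_pos] at hs2
        have he : Real.exp (Real.pi * |R|) / 4 ≤ ‖Complex.sin (Real.pi * (x + R * I))‖ := by
          refine le_trans ?_ hs2
          have a1 : 2 ≤ Real.exp (Real.pi * |R|) := by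
            have := Real.add_one_le_exp (Real.pi * |R|)
            nlinarith [Real.pi_gt_three]
          have a2 : Real.exp (-(Real.pi * |R|)) ≤ 1 := by
            apply Real.exp_le_one_iff.2; nlinarith [Real.pi_gt_three]
          linarith
        have : (16 * Real.exp (-(2 * Real.pi * |R|))) = ((Real.exp (Real.pi * |R|) / 4) ^ 2)⁻¹ := by
          rw [Real.exp_neg, div_pow, ← Real.exp_nat_mul]
          push_cast
          rw [inv_div, div_eq_mul_inv]
          norm_num
          ring_nf
        rw [this]
        apply inv_anti₀ (by positivity)
        exact pow_le_pow_left₀ (by positivity) he 2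
      · positivity
      · positivity
    rw [show |(1 : ℝ) / 2 - -1 / 2| = 1 by norm_num, mul_one] at this
    exact this
  have hMlim : Tendsto M atTop (𝓝 0) := by
    have b1 : Tendsto (fun R : ℝ => Real.exp (-((2 * Real.pi - a) * R))) atTop (𝓝 0) := by
      apply Real.tendsto_exp_neg_atTop_nhds_zero.comp
      exact tendsto_id.const_mul_atTop (by linarith)
    have b2 : Tendsto (fun R : ℝ => Real.exp (-(2 * Real.pi * R))) atTop (𝓝 0) := by
      apply Real.tendsto_exp_neg_atTop_nhds_zero.comp
      exact tendsto_id.const_mul_atTop (by positivity)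
    have b3 : Tendsto (fun R : ℝ => R * Real.exp (-(2 * Real.pi * R))) atTop (𝓝 0) := by
      have := Real.tendsto_pow_mul_exp_neg_atTop_nhds_zero 1
      have := (this.comp (tendsto_id.const_mul_atTop (show 0 < 2 * Real.pi by positivity))).const_mul (1 / (2 * Real.pi))
      rw [mul_zero] at this
      refine this.congr fun R => ?_
      simp
      field_simp
    have := ((b1.const_mul C).add ((b2.const_mul (‖F 0‖ + ‖deriv F 0‖)).add (b3.const_mul ‖deriv F 0‖))).const_mul (16 * Real.pi ^ 2)
    simp only [mul_zero, add_zero] at this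
    refine this.congr fun R => ?_
    simp only [hM]
    rw [show -((2 * Real.pi - a) * R) = a * R + -(2 * Real.pi * R) by ring, Real.exp_add]
    ring
  have hz1 : Tendsto (fun R : ℝ => ∫ x in (-1 / 2 : ℝ)..(1 / 2 : ℝ), g (x + R * I)) atTop (𝓝 0) := by
    apply squeeze_zero_norm' _ hMlim
    filter_upwards [eventually_ge_atTop 1] with R hR
    have := hor R (by rw [abs_of_pos] <;> linarith)
    rwa [abs_of_pos (by linarith)] at this
  have hz2 : Tendsto (fun R : ℝ => ∫ x in (-1 / 2 : ℝ)..(1 / 2 : ℝ), g (x + (-R : ℝ) * I)) atTop (𝓝 0) := by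
    apply squeeze_zero_norm' _ hMlim
    filter_upwards [eventually_ge_atTop 1] with R hR
    have := hor (-R) (by rw [abs_neg, abs_of_pos] <;> linarith)
    rwa [abs_neg, abs_of_pos (by linarith)] at this
  have t1 : Tendsto (fun R : ℝ => deriv F 0 * ((2 * Real.pi * (Real.sinh (Real.pi * R) / Real.cosh (Real.pi * R)) : ℝ) : ℂ)) atTop
      (𝓝 (deriv F 0 * ((2 * Real.pi * 1 : ℝ) : ℂ))) := by
    apply Tendsto.const_mul
    exact (continuous_ofReal.tendsto _).comp (tanh_lim.const_mul _)
  have := t1.add ((hz2.sub hz1).const_mul I)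
  rw [sub_zero, mul_zero, add_zero] at this
  have h2 : deriv F 0 * ((2 * Real.pi * 1 : ℝ) : ℂ) = 2 * Real.pi * deriv F 0 := by push_cast; ring
  rw [h2] at this
  refine this.congr' ?_
  filter_upwards [eventually_ge_atTop 0] with R hR
  exact (key R hR).symm

end

section
open Filter Topology Set Complex

noncomputable def lam : ℂ := (Real.log 3 / 2 : ℝ) - (Real.pi / 6 : ℝ) * I

lemma exp_lam : Complex.exp lam = xx := by
  unfold lam
  rw [Complex.exp_sub, ← Complex.ofReal_exp]
  have h : Complex.exp ((Real.pi / 6 : ℝ) * I) = (Real.sqrt 3 / 2 : ℝ) + (1 / 2 : ℝ) * I := by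
    rw [Complex.exp_mul_I, ← Complex.ofReal_cos, ← Complex.ofReal_sin, Real.cos_pi_div_six, Real.sin_pi_div_six]
  have h2 : Real.exp (Real.log 3 / 2) = Real.sqrt 3 := by
    rw [Real.sqrt_eq_rpow, Real.rpow_def_of_pos (by norm_num)]; ring_nf
  have h0 := Complex.exp_ne_zero ((Real.pi / 6 : ℝ) * I)
  rw [h2, div_eq_iff h0, h, xx, ww]
  have h3 : (Real.sqrt 3 : ℂ) ^ 2 = 3 := by
    rw [← Complex.ofReal_pow, Real.sq_sqrt (by norm_num)]; norm_num
  push_cast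
  linear_combination (Real.sqrt 3 : ℂ) / 4 * I_sq + (-I / 4) * h3 + I / 2 * h3

lemma poly_bound (P : Polynomial ℂ) (δ : ℝ) (hδ : 0 < δ) :
    ∃ C : ℝ, 0 ≤ C ∧ ∀ t : ℂ, ‖P.eval t‖ ≤ C * Real.exp (δ * ‖t‖) := by
  induction P using Polynomial.induction_on' with
  | add p q hp hq =>
    obtain ⟨C, hC, h⟩ := hp
    obtain ⟨C', hC', h'⟩ := hq
    refine ⟨C + C', by positivity, fun t => ?_⟩
    rw [Polynomial.eval_add, add_mul]
    exact (norm_add_le _ _).trans (add_le_add (h t) (h' t))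
  | monomial m a =>
    refine ⟨‖a‖ * (m.factorial / δ ^ m), by positivity, fun t => ?_⟩
    rw [Polynomial.eval_monomial, norm_mul, norm_pow, mul_assoc]
    apply mul_le_mul_of_nonneg_left _ (norm_nonneg _)
    have := Real.pow_div_factorial_le_exp (δ * ‖t‖) (by positivity) m
    rw [div_le_iff₀ (by positivity), mul_pow] at this
    rw [div_mul_eq_mul_div, le_div_iff₀ (by positivity)]
    linarith

lemma id_L (S P : Polynomial ℂ) (h : ∀ t, xx * S.eval (t + 1) - S.eval t = P.eval t) (L : ℂ)
    (hL : Complex.exp L = xx) (hIm : |L.im| < 2 * Real.pi) (k : ℤ) :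
    Tendsto (fun R : ℝ => ∫ y in (-R)..R, P.eval (k - 1 / 2 + y * I : ℂ) * Complex.exp (L * (k - 1 / 2 + y * I)) *
      ((Real.pi ^ 2 / Real.cosh (Real.pi * y) ^ 2 : ℝ) : ℂ)) atTop
      (𝓝 (2 * Real.pi * ((S.derivative.eval (k : ℂ) + L * S.eval (k : ℂ)) * Complex.exp (L * k)))) := by
  set δ := (2 * Real.pi - |L.im|) / 2 with hδ
  have hδ0 : 0 < δ := by rw [hδ]; linarith
  obtain ⟨C, hC, hb⟩ := poly_bound S δ hδ0
  set F : ℂ → ℂ := fun t => S.eval (k + t) * Complex.exp (L * (k + t)) with hF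
  have hFd : ∀ t : ℂ, HasDerivAt F ((S.derivative.eval (k + t) + L * S.eval (k + t)) * Complex.exp (L * (k + t))) t := by
    intro t
    have h1 : HasDerivAt (fun t : ℂ => (k : ℂ) + t) 1 t := by simpa using (hasDerivAt_id t).const_add (k : ℂ)
    have h2 := (S.hasDerivAt (k + t)).comp t h1
    have h3 := (h1.const_mul L).cexp
    refine (h2.mul h3).congr_deriv ?_
    simp only [Function.comp]
    ring
  have := strip_id F (fun t => (hFd t).differentiableAt) (C * Real.exp (δ * (|(k : ℝ)| + 1)) * Real.exp (|L.re| * (|(k : ℝ)| + 1)))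
    (|L.im| + δ) (by rw [hδ]; linarith) (by
      intro x y hx
      simp only [hF]
      rw [norm_mul, Complex.norm_exp]
      have n1 : ‖(k + (x + y * I) : ℂ)‖ ≤ (|(k : ℝ)| + 1) + |y| := by
        have := norm_add_le (k : ℂ) (x + y * I)
        have h2 := norm_add_le (x : ℂ) (y * I)
        simp only [norm_mul, norm_real, Real.norm_eq_abs, norm_I, mul_one, norm_intCast] at this h2
        linarith
      have n2 := (hb (k + (x + y * I))).trans (mul_le_mul_of_nonneg_left (Real.exp_le_exp.2 (mul_le_mul_of_nonneg_left n1 hδ0.le)) hC)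
      have n3 : (L * (k + (x + y * I))).re ≤ |L.re| * (|(k : ℝ)| + 1) + |L.im| * |y| := by
        simp only [mul_re, add_re, intCast_re, ofReal_re, I_re, mul_zero, ofReal_im, I_im, sub_self, add_zero, add_im, intCast_im, mul_im, mul_one, zero_add]
        have e1 : L.re * (k + x) ≤ |L.re| * (|(k : ℝ)| + 1) := by
          refine (le_abs_self _).trans ?_
          rw [abs_mul]
          apply mul_le_mul_of_nonneg_left _ (abs_nonneg _)
          have := abs_add_le (k : ℝ) x
          linarith
        have e2 : -(L.im * y) ≤ |L.im| * |y| := by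
          rw [← abs_mul]; exact neg_le_abs _
        linarith
      calc _ ≤ C * Real.exp (δ * ((|(k : ℝ)| + 1) + |y|)) * Real.exp (|L.re| * (|(k : ℝ)| + 1) + |L.im| * |y|) :=
            mul_le_mul n2 (Real.exp_le_exp.2 n3) (by positivity) (by positivity)
        _ = _ := by
            rw [mul_add δ, Real.exp_add, Real.exp_add, add_mul, Real.exp_add]; ring)
  rw [(hFd 0).deriv, add_zero] at this
  refine this.congr fun R => ?_
  apply intervalIntegral.integral_congr
  intro y _
  simp only
  congr 1
  simp only [hF]
  have hp := h (k - 1 / 2 + y * I)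
  rw [show (k : ℂ) + (((1 / 2 : ℝ) : ℂ) + y * I) = (k - 1 / 2 + y * I) + 1 by push_cast; ring,
    show (k : ℂ) + (((-1 / 2 : ℝ) : ℂ) + y * I) = (k - 1 / 2 + y * I) by push_cast; ring, ← hp, mul_add, Complex.exp_add, mul_one, hL]
  ring

lemma exp_lam_step (k : ℤ) : Complex.exp (lam * (k + 1 : ℤ)) = Complex.exp (lam * k) * xx := by
  push_cast
  rw [mul_add, mul_one, Complex.exp_add, exp_lam]

lemma chain_const (f : ℤ → ℂ) (a : ℤ) (h : ∀ k, a ≤ k → k < 0 → xx * f (k + 1) = f k) (k : ℤ) (hk : a ≤ k) (hk0 : k ≤ 0) :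
    f k * Complex.exp (lam * k) = f 0 := by
  have : ∀ m : ℕ, a ≤ -(m : ℤ) → f (-(m : ℤ)) * Complex.exp (lam * (-(m : ℤ) : ℤ)) = f 0 := by
    intro m
    induction m with
    | zero => intro _; simp
    | succ m ih =>
      intro hm
      have h1 := ih (by push_cast at hm; omega)
      have h2 := h (-((m + 1 : ℕ) : ℤ)) hm (by push_cast; omega)
      have h3 := exp_lam_step (-((m + 1 : ℕ) : ℤ))
      have e : -((m + 1 : ℕ) : ℤ) + 1 = -(m : ℤ) := by push_cast; ring
      rw [e] at h2 h3
      rw [← h2, ← h1, h3]; ring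
  obtain ⟨m, hm⟩ := Int.eq_ofNat_of_zero_le (show 0 ≤ -k by omega)
  have := this m (by omega)
  rwa [← hm, neg_neg] at this

lemma Sj_eval (n j : ℕ) (hj : j < 3) (t : ℂ) :
    xx * (Sj n j).eval (t + 1) - (Sj n j).eval t = (RR n * Polynomial.X ^ j).eval t := by
  apply Sop_eval
  have h1 := RR_natDegree n
  have h2 := Polynomial.natDegree_mul_le (p := RR n) (q := Polynomial.X ^ j)
  rw [Polynomial.natDegree_X_pow] at h2
  omega

lemma Sj_const (n j : ℕ) (hj : j < 3) (k : ℤ) (hk : -5 * (n : ℤ) ≤ k) (hk0 : k ≤ 0) :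
    (Sj n j).eval (k : ℂ) * Complex.exp (lam * k) = (Sj n j).eval 0 ∧
    (Sj n j).derivative.eval (k : ℂ) * Complex.exp (lam * k) = (Sj n j).derivative.eval 0 := by
  have hdeg : (RR n * Polynomial.X ^ j).natDegree < 15 * n + 3 := by
    have h1 := RR_natDegree n
    have h2 := Polynomial.natDegree_mul_le (p := RR n) (q := Polynomial.X ^ j)
    rw [Polynomial.natDegree_X_pow] at h2
    omega
  constructor
  · have := chain_const (fun k => (Sj n j).eval (k : ℂ)) (-5 * n) (fun k h1 h2 => by
      have := S_chain hdeg 0 k 2 (by norm_num) ((RR_dvd2 n k h1 h2).mul_right _)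
      simpa [Sj] using this) k hk hk0
    simpa using this
  · have := chain_const (fun k => (Sj n j).derivative.eval (k : ℂ)) (-5 * n) (fun k h1 h2 => by
      have := S_chain hdeg 1 k 2 (by norm_num) ((RR_dvd2 n k h1 h2).mul_right _)
      simpa [Sj] using this) k hk hk0
    simpa using this

noncomputable def PE (n j : ℕ) (t : ℂ) : ℂ := (RR n * Polynomial.X ^ j).eval t * Complex.exp (lam * t)

lemma PE_cont (n j : ℕ) : Continuous (PE n j) := by
  unfold PE; fun_prop

lemma lam_im : lam.im = -(Real.pi / 6) := by
  simp only [lam, sub_im, mul_im, ofReal_im, ofReal_re, I_re, I_im]; ring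
lemma lam_re : lam.re = Real.log 3 / 2 := by
  simp only [lam, sub_re, mul_re, ofReal_im, ofReal_re, I_re, I_im]; ring

lemma id_I (n j : ℕ) (hj : j < 3) (k : ℤ) (hk : -5 * (n : ℤ) ≤ k) (hk0 : k ≤ 0) :
    Tendsto (fun R : ℝ => ∫ y in (-R)..R, PE n j (k - 1 / 2 + y * I : ℂ) *
      ((Real.pi ^ 2 / Real.cosh (Real.pi * y) ^ 2 : ℝ) : ℂ)) atTop
      (𝓝 (2 * Real.pi * ((Sj n j).derivative.eval 0 + lam * (Sj n j).eval 0))) := by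
  have := id_L (Sj n j) _ (Sj_eval n j hj) lam exp_lam (by rw [lam_im, abs_neg, abs_of_pos (by positivity)]; linarith [Real.pi_pos]) k
  obtain ⟨h1, h2⟩ := Sj_const n j hj k hk hk0
  rw [add_mul, h2, mul_assoc lam, h1] at this
  exact this

lemma id_B (n j : ℕ) (hj : j < 3) (k : ℤ) (hk : -5 * (n : ℤ) ≤ k) (hk0 : k ≤ 0) :
    Tendsto (fun R : ℝ => ∫ y in (-R)..R, PE n j (k - 1 / 2 + y * I : ℂ) *
      ((1 / (1 + Real.exp (2 * Real.pi * y)) : ℝ) : ℂ)) atTop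
      (𝓝 (- I * (Sj n j).eval 0)) := by
  have t1 := id_L (Sj n j) _ (Sj_eval n j hj) lam exp_lam (by rw [lam_im, abs_neg, abs_of_pos (by positivity)]; linarith [Real.pi_pos]) k
  have hL2 : Complex.exp (lam + 2 * Real.pi * I) = xx := by
    rw [Complex.exp_add, exp_lam, Complex.exp_two_pi_mul_I, mul_one]
  have t2 := id_L (Sj n j) _ (Sj_eval n j hj) (lam + 2 * Real.pi * I) hL2 (by
    have : (lam + 2 * Real.pi * I).im = 11 * Real.pi / 6 := by
      simp [lam_im]; ring
    rw [this, abs_of_pos (by positivity)]; linarith [Real.pi_pos]) k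
  have hk1 : Complex.exp ((lam + 2 * Real.pi * I) * k) = Complex.exp (lam * k) := by
    rw [add_mul, Complex.exp_add]
    have := Complex.exp_int_mul_two_pi_mul_I k
    rw [mul_comm] at this
    rw [this, mul_one]
  obtain ⟨h1, h2⟩ := Sj_const n j hj k hk hk0
  have t3 := (t1.sub t2).const_mul (1 / (4 * Real.pi ^ 2) : ℂ)
  have pine : (Real.pi : ℂ) ≠ 0 := by exact_mod_cast Real.pi_ne_zero
  have hv : (1 / (4 * Real.pi ^ 2) : ℂ) * (2 * Real.pi * (((Sj n j).derivative.eval (k : ℂ) + lam * (Sj n j).eval (k : ℂ)) * Complex.exp (lam * k)) -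
      2 * Real.pi * (((Sj n j).derivative.eval (k : ℂ) + (lam + 2 * Real.pi * I) * (Sj n j).eval (k : ℂ)) * Complex.exp ((lam + 2 * Real.pi * I) * k))) =
      - I * (Sj n j).eval 0 := by
    rw [hk1, ← h1]
    field_simp
    ring
  rw [hv] at t3
  refine t3.congr fun R => ?_
  have hcosh : Continuous fun y : ℝ => ((Real.pi ^ 2 / Real.cosh (Real.pi * y) ^ 2 : ℝ) : ℂ) := by
    refine continuous_ofReal.comp (Continuous.div (by fun_prop) (by fun_prop) fun y => ?_)
    exact pow_ne_zero _ (Real.cosh_pos _).ne'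
  rw [← intervalIntegral.integral_sub, ← intervalIntegral.integral_const_mul]
  · apply intervalIntegral.integral_congr
    intro y _
    simp only [PE]
    have he : Complex.exp ((lam + 2 * Real.pi * I) * (k - 1 / 2 + y * I)) =
        Complex.exp (lam * (k - 1 / 2 + y * I)) * (-(Real.exp (-(2 * Real.pi * y)) : ℝ)) := by
      rw [add_mul, Complex.exp_add]
      congr 1
      have : (2 * Real.pi * I) * (k - 1 / 2 + y * I) = (k : ℂ) * (2 * Real.pi * I) + (-(Real.pi * I) + (-(2 * Real.pi * y) : ℝ)) := by
        push_cast
        linear_combination (2 * Real.pi * y : ℂ) * I_sq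
      rw [this, Complex.exp_add, Complex.exp_int_mul_two_pi_mul_I, one_mul, Complex.exp_add, Complex.exp_neg, Complex.exp_pi_mul_I,
        Complex.ofReal_exp]
      norm_num
    rw [he]
    have hreal : (1 / (4 * Real.pi ^ 2)) * ((1 + Real.exp (-(2 * Real.pi * y))) * (Real.pi ^ 2 / Real.cosh (Real.pi * y) ^ 2)) =
        1 / (1 + Real.exp (2 * Real.pi * y)) := by
      rw [Real.cosh_eq]
      have e1 : Real.exp (-(2 * Real.pi * y)) = Real.exp (-(Real.pi * y)) ^ 2 := by
        rw [← Real.exp_nat_mul]; push_cast; ring_nf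
      have e2 : Real.exp (2 * Real.pi * y) = Real.exp (Real.pi * y) ^ 2 := by
        rw [← Real.exp_nat_mul]; push_cast; ring_nf
      have e3 : Real.exp (-(Real.pi * y)) = (Real.exp (Real.pi * y))⁻¹ := Real.exp_neg _
      rw [e1, e2, e3]
      have := Real.exp_pos (Real.pi * y)
      have := Real.pi_pos
      field_simp
      ring
    rw [← hreal]
    push_cast
    ring
  · apply Continuous.intervalIntegrable
    exact Continuous.mul (by fun_prop) hcosh
  · apply Continuous.intervalIntegrable
    exact Continuous.mul (by fun_prop) hcosh

end

section
open Filter Topology Set Complex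

noncomputable def Psi (T : ℂ) (x : ℝ) : ℝ := -((T - x) * Complex.log (T - x)).re + (T.re - x)

lemma slit_of_im {z : ℂ} (h : 0 < z.im) : z ∈ slitPlane := Or.inr h.ne'

lemma re_hasDerivAt {f : ℝ → ℂ} {f' : ℂ} {x : ℝ} (h : HasDerivAt f f' x) :
    HasDerivAt (fun y => (f y).re) f'.re x :=
  (Complex.reCLM.hasFDerivAt.comp_hasDerivAt x h)

lemma zlog_hasDerivAt {z : ℂ} (h : 0 < z.im) : HasDerivAt (fun z : ℂ => z * Complex.log z) (Complex.log z + 1) z := by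
  have hz : z ≠ 0 := by intro h0; rw [h0] at h; simp at h
  have := (hasDerivAt_id z).mul (Complex.hasDerivAt_log (slit_of_im h))
  refine this.congr_deriv ?_
  simp [hz]

lemma Psi_hasDerivAt {T : ℂ} (hT : 0 < T.im) (x : ℝ) : HasDerivAt (Psi T) (Real.log ‖T - x‖) x := by
  have h1 : HasDerivAt (fun y : ℝ => T - (y : ℂ)) (-1) x := by
    simpa using (hasDerivAt_id x).ofReal_comp.const_sub T
  have hi : 0 < (T - (x : ℂ)).im := by simpa using hT
  have h2 := re_hasDerivAt ((zlog_hasDerivAt hi).comp x h1)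
  have h3 := (hasDerivAt_id x).const_sub T.re
  refine (h2.neg.add h3).congr_deriv ?_
  simp [Complex.log_re]

lemma Psi_mvt {T : ℂ} (hT : 0 < T.im) {a b : ℝ} (hab : a < b) :
    ∃ c ∈ Ioo a b, Psi T b - Psi T a = Real.log ‖T - c‖ * (b - a) := by
  obtain ⟨c, hc, h⟩ := exists_hasDerivAt_eq_slope (Psi T) (fun x => Real.log ‖T - x‖) hab
    (fun x _ => (Psi_hasDerivAt hT x).continuousAt.continuousWithinAt) (fun x _ => Psi_hasDerivAt hT x)
  refine ⟨c, hc, ?_⟩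
  rw [h]; field_simp [(sub_pos.2 hab).ne']

lemma one_le_norm_T {T : ℂ} (hT : 1 ≤ T.im) (x : ℝ) : 1 ≤ ‖T - x‖ := by
  have := Complex.abs_im_le_norm (T - x)
  simp only [sub_im, ofReal_im, sub_zero] at this
  exact (hT.trans (le_abs_self _)).trans this

lemma Psi_mono {T : ℂ} (hT : 1 ≤ T.im) {a b : ℝ} (hab : a ≤ b) : Psi T a ≤ Psi T b := by
  rcases hab.eq_or_lt with h | h
  · rw [h]
  · obtain ⟨c, _, h2⟩ := Psi_mvt (by linarith) h
    have := Real.log_nonneg (one_le_norm_T hT c)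
    nlinarith

lemma norm_mono {t T : ℂ} (h1 : |t.re| ≤ |T.re|) (h2 : |t.im| ≤ |T.im|) : ‖t‖ ≤ ‖T‖ := by
  rw [Complex.norm_eq_sqrt_sq_add_sq, Complex.norm_eq_sqrt_sq_add_sq]
  exact Real.sqrt_le_sqrt (add_le_add (sq_le_sq.2 h1) (sq_le_sq.2 h2))

lemma norm_le_right {T : ℂ} (hT : 1 ≤ T.im) (r : ℝ) (h : T.re ≤ r) : ‖T - r‖ ≤ Real.exp (Psi T (r + 1) - Psi T r) := by
  obtain ⟨c, hc, h2⟩ := Psi_mvt (T := T) (by linarith) (show r < r + 1 by linarith)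
  rw [h2, add_sub_cancel_left, mul_one, Real.exp_log (by linarith [one_le_norm_T hT c])]
  apply norm_mono
  · simp only [sub_re, ofReal_re]
    rw [abs_of_nonpos (by linarith), abs_of_nonpos (by linarith [hc.1])]; linarith [hc.1]
  · simp

lemma norm_le_left {T : ℂ} (hT : 1 ≤ T.im) (r : ℝ) (h : r ≤ T.re) : ‖T - r‖ ≤ Real.exp (Psi T r - Psi T (r - 1)) := by
  obtain ⟨c, hc, h2⟩ := Psi_mvt (T := T) (by linarith) (show r - 1 < r by linarith)
  rw [h2, sub_sub_cancel, mul_one, Real.exp_log (by linarith [one_le_norm_T hT c])]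
  apply norm_mono
  · simp only [sub_re, ofReal_re]
    rw [abs_of_nonneg (by linarith), abs_of_nonneg (by linarith [hc.2])]; linarith [hc.2]
  · simp

def Dom (t T : ℂ) : Prop := ∀ r : ℤ, ((r : ℝ) < T.re → ‖t - r‖ ≤ ‖T - r‖) ∧ (T.re ≤ r → ‖t - r‖ ≤ ‖T - (r + 2)‖)

lemma prod_le {t T : ℂ} (hT : 1 ≤ T.im) (hD : Dom t T) (lo : ℤ) (N : ℕ) :
    ∏ i ∈ Finset.range N, ‖t - (lo + i : ℤ)‖ ≤ Real.exp (Psi T (lo + N + 2) - Psi T (lo - 1)) := by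
  set E : ℝ → ℝ := fun r => if r < T.re then Psi T (r - 1) else Psi T (r + 2) with hE
  have h1 : ∀ r : ℤ, ‖t - r‖ ≤ Real.exp (E (r + 1) - E r) := by
    intro r
    simp only [hE]
    rcases lt_or_ge (r : ℝ) T.re with h | h
    · rw [if_pos h]
      refine ((hD r).1 h).trans ?_
      refine (norm_le_left hT r h.le).trans ?_
      apply Real.exp_le_exp.2
      split_ifs
      · rw [add_sub_cancel_right]
      · have := Psi_mono hT (show (r : ℝ) ≤ r + 1 + 2 by linarith)
        linarith
    · rw [if_neg (not_lt.2 h), if_neg (not_lt.2 (by linarith))]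
      refine ((hD r).2 h).trans ?_
      have := norm_le_right hT (r + 2) (by linarith)
      push_cast at this
      refine this.trans ?_
      rw [show (r : ℝ) + 2 + 1 = r + 1 + 2 by ring]
  have h2 : ∏ i ∈ Finset.range N, ‖t - (lo + i : ℤ)‖ ≤ Real.exp (E (lo + N) - E lo) := by
    induction N with
    | zero => simp
    | succ m ih =>
      rw [Finset.prod_range_succ]
      have := h1 (lo + m)
      calc _ ≤ Real.exp (E (lo + m) - E lo) * Real.exp (E (((lo + m : ℤ) : ℝ) + 1) - E ((lo + m : ℤ) : ℝ)) :=
            mul_le_mul ih this (norm_nonneg _) (by positivity)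
        _ = _ := by rw [← Real.exp_add]; push_cast; ring_nf
  refine h2.trans (Real.exp_le_exp.2 ?_)
  have a1 : E (lo + N) ≤ Psi T (lo + N + 2) := by
    simp only [hE]; split_ifs
    · exact Psi_mono hT (by linarith)
    · exact le_rfl
  have a2 : Psi T (lo - 1) ≤ E lo := by
    simp only [hE]; split_ifs
    · exact le_rfl
    · exact Psi_mono hT (by linarith)
  linarith

lemma tangent (w w1 w2 : ℝ → ℝ) (h1 : ∀ s, 0 < s → HasDerivAt w (w1 s) s) (h2 : ∀ s, 0 < s → HasDerivAt w1 (w2 s) s)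
    (h3 : ∀ s, 0 < s → w2 s ≤ 0) (a b : ℝ) (ha : 0 < a) (hb : 0 < b) : w a ≤ w b + (a - b) * w1 b := by
  have mvt : ∀ (f f' : ℝ → ℝ), (∀ s, 0 < s → HasDerivAt f (f' s) s) → ∀ x y, 0 < x → x < y → ∃ c ∈ Ioo x y, f y - f x = f' c * (y - x) := by
    intro f f' hf x y hx hxy
    obtain ⟨c, hc, h⟩ := exists_hasDerivAt_eq_slope f f' hxy
      (fun z hz => (hf z (by linarith [hz.1])).continuousAt.continuousWithinAt) (fun z hz => hf z (by linarith [hz.1]))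
    refine ⟨c, hc, ?_⟩
    rw [h]; field_simp [(sub_pos.2 hxy).ne']
  rcases lt_trichotomy a b with h | h | h
  · obtain ⟨c, hc, e1⟩ := mvt w w1 h1 a b ha h
    obtain ⟨c', hc', e2⟩ := mvt w1 w2 h2 c b (by linarith [hc.1]) hc.2
    have := h3 c' (by linarith [hc.1, hc'.1])
    have : w1 b ≤ w1 c := by nlinarith [hc.2]
    nlinarith
  · rw [h]; simp
  · obtain ⟨c, hc, e1⟩ := mvt w w1 h1 b a hb h
    obtain ⟨c', hc', e2⟩ := mvt w1 w2 h2 b c hb hc.1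
    have := h3 c' (by linarith [hc'.1])
    have : w1 c ≤ w1 b := by nlinarith [hc.1]
    nlinarith

lemma tangent_log (c lo hi : ℝ) (d : ℂ) (hd : 0 < d.im) (hlo : lo ≤ c) (hhi : c ≤ hi) (hd2 : d.re ^ 2 ≤ d.im ^ 2)
    (hd3 : 0 ≤ ((c - lo) - (hi - c)) * d.re) (a b : ℝ) (ha : 0 < a) (hb : 0 < b) :
    Psi (c + a * d) hi - Psi (c + a * d) lo ≤ (c - lo) * Real.log ‖(c + b * d - lo : ℂ)‖ + (hi - c) * Real.log ‖(c + b * d - hi : ℂ)‖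
      + a * (d * (Complex.log (c + b * d - lo) - Complex.log (c + b * d - hi))).re - (hi - lo) := by
  have him : ∀ (x s : ℝ), 0 < s → 0 < (c + s * d - x : ℂ).im := by
    intro x s hs; simp; positivity
  have hz : ∀ (x s : ℝ), HasDerivAt (fun s : ℝ => (c + s * d - x : ℂ)) d s := by
    intro x s
    have := (((hasDerivAt_id s).ofReal_comp.mul_const d).const_add (c : ℂ)).sub_const (x : ℂ)
    simpa using this
  set w : ℝ → ℝ := fun s => ((c + s * d - lo : ℂ) * Complex.log (c + s * d - lo) - (c + s * d - hi : ℂ) * Complex.log (c + s * d - hi)).re with hw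
  set w1 : ℝ → ℝ := fun s => (d * (Complex.log (c + s * d - lo) - Complex.log (c + s * d - hi))).re with hw1
  set w2 : ℝ → ℝ := fun s => (d * ((c + s * d - lo : ℂ)⁻¹ * d - (c + s * d - hi : ℂ)⁻¹ * d)).re with hw2
  have t := tangent w w1 w2 (by
      intro s hs
      have e1 := (zlog_hasDerivAt (him lo s hs)).comp s (hz lo s)
      have e2 := (zlog_hasDerivAt (him hi s hs)).comp s (hz hi s)
      refine (re_hasDerivAt (e1.sub e2)).congr_deriv ?_
      simp only [hw1]; congr 1; ring)
    (by
      intro s hs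
      have e1 := (Complex.hasDerivAt_log (slit_of_im (him lo s hs))).comp s (hz lo s)
      have e2 := (Complex.hasDerivAt_log (slit_of_im (him hi s hs))).comp s (hz hi s)
      exact re_hasDerivAt ((e1.sub e2).const_mul d))
    (by
      intro s hs
      simp only [hw2]
      set z1 := (c + s * d - lo : ℂ) with hz1
      set z2 := (c + s * d - hi : ℂ) with hz2
      have n1 : z1 ≠ 0 := fun h => by have := him lo s hs; rw [← hz1, h] at this; simp at this
      have n2 : z2 ≠ 0 := fun h => by have := him hi s hs; rw [← hz2, h] at this; simp at this
      have e : d * (z1⁻¹ * d - z2⁻¹ * d) = ((-(hi - lo) / (normSq z1 * normSq z2) : ℝ) : ℂ) * (d ^ 2 * (starRingEnd ℂ) (z1 * z2)) := by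
        rw [Complex.inv_def, Complex.inv_def, map_mul]
        have m1 : (normSq z1 : ℂ) ≠ 0 := by exact_mod_cast (normSq_pos.2 n1).ne'
        have m2 : (normSq z2 : ℂ) ≠ 0 := by exact_mod_cast (normSq_pos.2 n2).ne'
        have k1 := Complex.normSq_eq_conj_mul_self (z := z1)
        have k2 := Complex.normSq_eq_conj_mul_self (z := z2)
        have k3 : (starRingEnd ℂ) z2 - (starRingEnd ℂ) z1 = -(hi - lo) := by
          rw [hz1, hz2]; simp
        have k4 : z2 - z1 = -(hi - lo) := by rw [hz1, hz2]; ring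
        push_cast
        field_simp
        rw [k1, k2]
        linear_combination ((starRingEnd ℂ) z1 * (starRingEnd ℂ) z2) * k4
      rw [e, Complex.re_ofReal_mul]
      have hpos : 0 ≤ (d ^ 2 * (starRingEnd ℂ) (z1 * z2)).re := by
        have : (d ^ 2 * (starRingEnd ℂ) (z1 * z2)).re = (c - lo) * (hi - c) * (d.im ^ 2 - d.re ^ 2) +
            s * (d.re ^ 2 + d.im ^ 2) * (((c - lo) - (hi - c)) * d.re) + s ^ 2 * (d.re ^ 2 + d.im ^ 2) ^ 2 := by
          rw [hz1, hz2]
          simp [pow_two]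
          ring
        rw [this]
        have := mul_nonneg (sub_nonneg.2 hlo) (sub_nonneg.2 hhi)
        have := mul_nonneg this (sub_nonneg.2 hd2)
        positivity
      have : -(hi - lo) / (normSq z1 * normSq z2) ≤ 0 := by
        apply div_nonpos_of_nonpos_of_nonneg (by linarith)
        exact mul_nonneg (normSq_nonneg _) (normSq_nonneg _)
      exact mul_nonpos_of_nonpos_of_nonneg this hpos) a b ha hb
  have hb1 : w b = (c - lo) * Real.log ‖(c + b * d - lo : ℂ)‖ + (hi - c) * Real.log ‖(c + b * d - hi : ℂ)‖ + b * w1 b := by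
    simp only [hw, hw1]
    rw [← Complex.log_re, ← Complex.log_re]
    rw [← Complex.re_ofReal_mul, ← Complex.re_ofReal_mul, ← Complex.re_ofReal_mul, ← Complex.add_re, ← Complex.add_re]
    congr 1
    push_cast
    ring
  have hP : Psi (c + a * d) hi - Psi (c + a * d) lo = w a - (hi - lo) := by
    simp only [Psi, hw, sub_re]; ring
  rw [hP]
  nlinarith [t, hb1]

end

section
open Filter Topology Set Complex

noncomputable def hb (c0 : ℝ) (d : ℂ) (a : ℕ) : ℝ :=
  (c0 + a) * Real.log ‖(c0 + d + a : ℂ)‖ + (5 - a - c0) * Real.log ‖(c0 + d + a - 5 : ℂ)‖ - 5 * Real.log 5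
noncomputable def tb (c0 : ℝ) (d : ℂ) (a : ℕ) : ℂ :=
  Complex.log (c0 + d + a) - Complex.log (c0 + d + a - 5)

lemma fact_lower (N : ℕ) : Real.exp (-(N * Real.log N) + N) * N.factorial ≥ 1 := by
  rcases Nat.eq_zero_or_pos N with h | h
  · simp [h]
  have := Real.pow_div_factorial_le_exp (N : ℝ) (by positivity) N
  rw [div_le_iff₀ (by positivity)] at this
  have hN : (0 : ℝ) < N := by exact_mod_cast h
  rw [Real.exp_add, Real.exp_neg, show (N : ℝ) * Real.log N = Real.log ((N : ℝ) ^ N) by rw [Real.log_pow], Real.exp_log (by positivity)]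
  rw [ge_iff_le, mul_assoc, ← div_eq_inv_mul, le_div_iff₀ (by positivity)]
  linarith

lemma Psi_up {T : ℂ} (hT : 1 ≤ T.im) (x h : ℝ) (hh : 0 < h) : Psi T (x + h) - Psi T x ≤ h * Real.log (‖T - x‖ + h) := by
  obtain ⟨c, hc, e⟩ := Psi_mvt (T := T) (by linarith) (show x < x + h by linarith)
  rw [e, add_sub_cancel_left, mul_comm]
  apply mul_le_mul_of_nonneg_left _ hh.le
  apply Real.log_le_log (by linarith [one_le_norm_T hT c])
  have : T - c = (T - x) + ((x - c : ℝ) : ℂ) := by push_cast; ring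
  rw [this]
  refine (norm_add_le _ _).trans ?_
  rw [norm_real, Real.norm_eq_abs]
  have : |x - c| ≤ h := by rw [abs_le]; constructor <;> linarith [hc.1, hc.2]
  linarith

lemma Psi_down {T : ℂ} (hT : 1 ≤ T.im) (x : ℝ) : Psi T x - Psi T (x - 1) ≤ Real.log (‖T - x‖ + 1) := by
  obtain ⟨c, hc, e⟩ := Psi_mvt (T := T) (by linarith) (show x - 1 < x by linarith)
  rw [e, sub_sub_cancel, mul_one]
  apply Real.log_le_log (by linarith [one_le_norm_T hT c])
  have : T - c = (T - x) + ((x - c : ℝ) : ℂ) := by push_cast; ring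
  rw [this]
  refine (norm_add_le _ _).trans ?_
  rw [norm_real, Real.norm_eq_abs]
  have : |x - c| ≤ 1 := by rw [abs_le]; constructor <;> linarith [hc.1, hc.2]
  linarith

lemma fin_arith (p1 p2 p3 p4 n A B ln l1 l2 w L l5 : ℝ) {x y : ℝ}
    (h : p1 - p2 ≤ n * A * (ln + l1) + n * B * (ln + l2) + w - 5 * n)
    (u1 : p3 - p1 ≤ 2 * x) (u2 : p2 - p4 ≤ y) (q1 : x ≤ L) (q2 : y ≤ L) (hq : A + B = 5) :
    p3 - p4 ≤ 3 * L + (n * (A * l1 + B * l2 - 5 * l5) + w) - (-(5 * n * (l5 + ln)) + 5 * n) := by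
  have : n * A * (ln + l1) + n * B * (ln + l2) = n * (A * l1 + B * l2) + n * (A + B) * ln := by ring
  rw [this, hq] at h
  linarith

set_option maxHeartbeats 1000000 in
lemma block (n a : ℕ) (hn : 1 ≤ n) (ha : a ≤ 6) (t d : ℂ) (c0 σ : ℝ) (hσ : 0 < σ) (hd : 0 < d.im)
    (h1 : -(a : ℝ) ≤ c0) (h2 : c0 ≤ 5 - a) (hd2 : d.re ^ 2 ≤ d.im ^ 2) (hd3 : 0 ≤ ((c0 + a) - (5 - a - c0)) * d.re)
    (hT : 1 ≤ ((c0 * n : ℝ) + σ * d : ℂ).im) (hD : Dom t ((c0 * n : ℝ) + σ * d)) :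
    ‖(bP (5 * n) (a * n)).eval t‖ ≤ (‖((c0 * n : ℝ) + σ * d : ℂ)‖ + 6 * n + 2) ^ 3 *
      Real.exp (n * hb c0 d a + σ * (d * tb c0 d a).re) := by
  set T : ℂ := ((c0 * n : ℝ) + σ * d : ℂ) with hTd
  have hn' : (1 : ℝ) ≤ n := by exact_mod_cast hn
  have hn0 : (0 : ℝ) < n := by linarith
  have ha' : (a : ℝ) ≤ 6 := by exact_mod_cast ha
  have ha0 : (0 : ℝ) ≤ a := by positivity
  have hev : ‖(bP (5 * n) (a * n)).eval t‖ = (∏ i ∈ Finset.range (5 * n), ‖t - ((-(a * n : ℤ)) + i : ℤ)‖) / (5 * n).factorial := by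
    unfold bP
    rw [Polynomial.eval_mul, Polynomial.eval_prod, norm_mul, norm_prod]
    simp only [Polynomial.eval_C, Polynomial.eval_add, Polynomial.eval_X]
    rw [norm_div, norm_one, norm_natCast, mul_comm, mul_one_div]
    congr 1
    apply Finset.prod_congr rfl
    intro i _
    congr 1
    push_cast
    ring
  rw [hev]
  have hp := prod_le hT hD (-(a * n : ℤ)) (5 * n)
  set lo : ℝ := -(a * n) with hlo
  set hi : ℝ := (5 - a) * n with hhi
  have e1 : (((-(a * n : ℤ) : ℤ)) : ℝ) = lo := by push_cast; rfl
  have e2 : lo + ((5 * n : ℕ) : ℝ) = hi := by push_cast; rw [hlo, hhi]; ring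
  rw [e1, e2] at hp
  have htan := tangent_log (c0 * n) lo hi d hd (by rw [hlo]; nlinarith) (by rw [hhi]; nlinarith) hd2
    (by
      have : ((c0 * n - lo) - (hi - c0 * n)) * d.re = n * (((c0 + a) - (5 - a - c0)) * d.re) := by rw [hlo, hhi]; ring
      rw [this]; positivity) σ n hσ hn0
  have u1 := Psi_up hT hi 2 (by norm_num)
  have u2 := Psi_down hT lo
  -- rewriting
  have him : ∀ x : ℝ, 0 < (c0 + d + x : ℂ).im := by intro x; simpa using hd
  have s1 : ((c0 * n : ℝ) + (n : ℝ) * d - lo : ℂ) = (n : ℝ) * (c0 + d + a) := by rw [hlo]; push_cast; ring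
  have s2 : ((c0 * n : ℝ) + (n : ℝ) * d - hi : ℂ) = (n : ℝ) * (c0 + d + a - 5) := by rw [hhi]; push_cast; ring
  have z1 : (c0 + d + a : ℂ) ≠ 0 := by
    intro h; have := him a; push_cast at this; rw [h] at this; simp at this
  have z2 : (c0 + d + a - 5 : ℂ) ≠ 0 := by
    intro h; have := him (a - 5); push_cast at this; rw [← add_sub_assoc, h] at this; simp at this
  rw [s1, s2, Complex.log_ofReal_mul hn0 z1, Complex.log_ofReal_mul hn0 z2, add_sub_add_left_eq_sub,
    norm_mul, norm_mul, norm_real, Real.norm_eq_abs, abs_of_pos hn0, Real.log_mul hn0.ne' (norm_ne_zero_iff.2 z1),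
    Real.log_mul hn0.ne' (norm_ne_zero_iff.2 z2)] at htan
  have hf := fact_lower (5 * n)
  have hfl : ((5 * n : ℕ) : ℝ) * Real.log ((5 * n : ℕ) : ℝ) = 5 * n * (Real.log 5 + Real.log n) := by
    push_cast; rw [Real.log_mul (by norm_num) hn0.ne']
  rw [hfl] at hf
  have q1 : Real.log (‖T - hi‖ + 2) ≤ Real.log (‖T‖ + 6 * n + 2) := by
    apply Real.log_le_log (by positivity)
    have := norm_sub_le T hi
    have h3 : ‖(hi : ℂ)‖ ≤ 6 * n := by
      rw [norm_real, Real.norm_eq_abs, hhi, abs_le]; constructor <;> nlinarith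
    linarith
  have q2 : Real.log (‖T - lo‖ + 1) ≤ Real.log (‖T‖ + 6 * n + 2) := by
    apply Real.log_le_log (by positivity)
    have := norm_sub_le T lo
    have h3 : ‖(lo : ℂ)‖ ≤ 6 * n := by
      rw [norm_real, Real.norm_eq_abs, hlo, abs_le]; constructor <;> nlinarith
    linarith
  have qpos : 0 < ‖T‖ + 6 * n + 2 := by positivity
  have fin : Psi T (hi + 2) - Psi T (lo - 1) ≤ 3 * Real.log (‖T‖ + 6 * n + 2) + (n * hb c0 d a + σ * (d * tb c0 d a).re) - (-(5 * n * (Real.log 5 + Real.log n)) + ((5 * n : ℕ) : ℝ)) := by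
    unfold hb tb
    push_cast
    have ea : c0 * n - lo = n * (c0 + a) := by rw [hlo]; ring
    have eb : hi - c0 * n = n * (5 - a - c0) := by rw [hhi]; ring
    have ec : hi - lo = 5 * n := by rw [hhi, hlo]; ring
    rw [ea, eb, ec] at htan
    exact fin_arith _ _ _ _ _ _ _ _ _ _ _ _ _ htan u1 u2 q1 q2 (by ring)
  rw [div_le_iff₀ (by positivity)]
  refine hp.trans ((Real.exp_le_exp.2 fin).trans ?_)
  rw [sub_eq_add_neg, Real.exp_add, Real.exp_add, show 3 * Real.log (‖T‖ + 6 * n + 2) = Real.log ((‖T‖ + 6 * n + 2) ^ 3) by rw [Real.log_pow]; norm_num,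
    Real.exp_log (by positivity), Real.exp_neg]
  apply mul_le_mul_of_nonneg_left _ (by positivity)
  rw [inv_le_iff_one_le_mul₀ (by positivity), mul_comm]
  exact hf

noncomputable def HB (c0 : ℝ) (d : ℂ) : ℝ := hb c0 d 6 + hb c0 d 5 + hb c0 d 4
noncomputable def TB (c0 : ℝ) (d : ℂ) : ℂ := tb c0 d 6 + tb c0 d 5 + tb c0 d 4

lemma RR_bound (n : ℕ) (hn : 1 ≤ n) (t d : ℂ) (c0 σ : ℝ) (hσ : 0 < σ) (hd : 0 < d.im)
    (h1 : -4 ≤ c0) (h2 : c0 ≤ -1) (hd2 : d.re ^ 2 ≤ d.im ^ 2) (hd3 : d.re = 0 ∨ (d.re < 0 ∧ c0 ≤ -7 / 2))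
    (hT : 1 ≤ ((c0 * n : ℝ) + σ * d : ℂ).im) (hD : Dom t ((c0 * n : ℝ) + σ * d)) :
    ‖(RR n).eval t‖ ≤ (‖((c0 * n : ℝ) + σ * d : ℂ)‖ + 6 * n + 2) ^ 9 *
      Real.exp (n * HB c0 d + σ * (d * TB c0 d).re) := by
  have hh : ∀ a : ℕ, 4 ≤ a → a ≤ 6 → ‖(bP (5 * n) (a * n)).eval t‖ ≤ (‖((c0 * n : ℝ) + σ * d : ℂ)‖ + 6 * n + 2) ^ 3 *
      Real.exp (n * hb c0 d a + σ * (d * tb c0 d a).re) := by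
    intro a ha4 ha
    have ha' : (a : ℝ) ≤ 6 := by exact_mod_cast ha
    have ha4' : (4 : ℝ) ≤ a := by exact_mod_cast ha4
    refine block n a hn ha t d c0 σ hσ hd (by linarith) (by linarith) hd2 ?_ hT hD
    rcases hd3 with h | h
    · rw [h]; simp
    · apply mul_nonneg_of_nonpos_of_nonpos <;> linarith [h.1, h.2]
  have b6 := hh 6 (by norm_num) (by norm_num)
  have b5 := hh 5 (by norm_num) (by norm_num)
  have b4 := hh 4 (by norm_num) (by norm_num)
  unfold RR
  rw [Polynomial.eval_mul, Polynomial.eval_mul, norm_mul, norm_mul]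
  simp only [Nat.cast_ofNat] at b6 b5 b4
  refine (mul_le_mul (mul_le_mul b6 b5 (norm_nonneg _) (by positivity)) b4 (norm_nonneg _) (by positivity)).trans (le_of_eq ?_)
  have : n * HB c0 d + σ * (d * TB c0 d).re = (n * hb c0 d 6 + σ * (d * tb c0 d 6).re) + (n * hb c0 d 5 + σ * (d * tb c0 d 5).re) + (n * hb c0 d 4 + σ * (d * tb c0 d 4).re) := by
    unfold HB TB
    rw [mul_add d, mul_add d, add_re, add_re]; ring
  rw [this]
  generalize (n * hb c0 d 6 + σ * (d * tb c0 d 6).re) = e6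
  generalize (n * hb c0 d 5 + σ * (d * tb c0 d 5).re) = e5
  generalize (n * hb c0 d 4 + σ * (d * tb c0 d 4).re) = e4
  rw [Real.exp_add, Real.exp_add]
  generalize (‖((c0 * n : ℝ) + σ * d : ℂ)‖ + 6 * n + 2) = Q
  ring

end

section
open Filter Topology Set Complex

lemma dec (δ : ℝ) (hδ : 0 < δ) : ∃ C : ℝ, 0 < C ∧ ∀ y : ℝ, (1 + |y|) ^ 11 * Real.exp (-(δ * |y|)) ≤ C / (1 + y ^ 2) := by
  refine ⟨Real.exp δ * (Nat.factorial 13) / δ ^ 13, by positivity, fun y => ?_⟩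
  have h := Real.pow_div_factorial_le_exp (δ * (1 + |y|)) (by positivity) 13
  have h2 : 1 + y ^ 2 ≤ (1 + |y|) ^ 2 := by nlinarith [sq_abs y, abs_nonneg y]
  rw [le_div_iff₀ (by positivity)]
  have h3 : (1 + |y|) ^ 13 * Real.exp (-(δ * |y|)) ≤ Real.exp δ * (Nat.factorial 13) / δ ^ 13 := by
    rw [Real.exp_neg, ← div_eq_mul_inv, div_le_iff₀ (by positivity), div_mul_eq_mul_div, le_div_iff₀ (by positivity)]
    rw [div_le_iff₀ (by positivity), mul_pow, mul_add, Real.exp_add, mul_one] at h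
    linarith
  calc _ ≤ (1 + |y|) ^ 11 * Real.exp (-(δ * |y|)) * (1 + |y|) ^ 2 := by gcongr
    _ = (1 + |y|) ^ 13 * Real.exp (-(δ * |y|)) := by ring
    _ ≤ _ := h3

lemma int_bd {f : ℝ → ℂ} {a b M : ℝ} (hab : a ≤ b) (hM : 0 ≤ M) (h : ∀ y ∈ Ioc a b, ‖f y‖ ≤ M / (1 + y ^ 2)) :
    ‖∫ y in a..b, f y‖ ≤ M * Real.pi := by
  have hc : Continuous fun y : ℝ => M / (1 + y ^ 2) := by
    apply Continuous.div continuous_const (by fun_prop)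
    intro y; positivity
  refine (intervalIntegral.norm_integral_le_of_norm_le hab (Filter.Eventually.of_forall h) (hc.intervalIntegrable _ _)).trans ?_
  simp only [div_eq_mul_inv]
  rw [intervalIntegral.integral_const_mul, integral_inv_one_add_sq]
  apply mul_le_mul_of_nonneg_left _ hM
  linarith [Real.arctan_lt_pi_div_two b, Real.neg_pi_div_two_lt_arctan a]

lemma vert_Dom (k0 : ℤ) (u y : ℝ) (h1 : (k0 : ℝ) - 2 ≤ u) (h2 : u ≤ k0) :
    Dom (u + y * I) ((k0 : ℝ) + (|y| + 1 : ℝ) * I) := by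
  have hy : |y| ≤ |(|y| + 1)| := (by linarith : |y| ≤ |y| + 1).trans (le_abs_self _)
  intro r
  simp only [add_re, mul_re, ofReal_re, I_re, ofReal_im, I_im, mul_zero, zero_mul, sub_zero, add_zero]
  constructor
  · intro h
    have h' : r + 1 ≤ k0 := by have : r < k0 := by exact_mod_cast h
                               omega
    have h3 : (r : ℝ) + 1 ≤ k0 := by exact_mod_cast h'
    apply norm_mono
    · simp
      rw [abs_of_nonneg (show (0 : ℝ) ≤ (k0 : ℝ) - r by linarith)]
      rw [abs_le]; constructor <;> linarith
    · simpa using hy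
  · intro h
    apply norm_mono
    · simp
      rw [abs_of_nonpos (show u - (r : ℝ) ≤ 0 by linarith), abs_of_nonpos (by linarith)]
      linarith
    · simpa using hy

lemma vert (n j : ℕ) (hn : 1 ≤ n) (hj : j < 3) (c0 y2 : ℝ) (hy2 : 0 < y2) (h1 : -4 ≤ c0) (h2 : c0 ≤ -1) (k0 : ℤ)
    (hk : (k0 : ℝ) = c0 * n) (u : ℝ) (hu1 : (k0 : ℝ) - 2 ≤ u) (hu2 : u ≤ k0) (y : ℝ) :
    ‖PE n j (u + y * I)‖ ≤ (13 * n * (1 + |y|)) ^ 11 *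
      Real.exp (n * (HB c0 (y2 * I) + c0 * Real.log 3 / 2) + (|y| + 1) * (I * TB c0 (y2 * I)).re + Real.pi / 6 * y) := by
  have hn' : (1 : ℝ) ≤ n := by exact_mod_cast hn
  have hn0 : (0 : ℝ) < n := by linarith
  have hay := abs_nonneg y
  set σ : ℝ := (|y| + 1) / y2 with hσ
  have hσd : (σ : ℂ) * (y2 * I) = (|y| + 1 : ℝ) * I := by
    rw [← mul_assoc, ← ofReal_mul, hσ, div_mul_cancel₀ _ hy2.ne']
  have hTe : ((c0 * n : ℝ) + σ * (y2 * I) : ℂ) = (k0 : ℝ) + (|y| + 1 : ℝ) * I := by rw [hσd, hk]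
  have hR := RR_bound n hn (u + y * I) (y2 * I) c0 σ (by positivity) (by simpa using hy2) h1 h2 (by simp; positivity)
    (Or.inl (by simp)) (by rw [hTe]; simp) (by rw [hTe]; exact vert_Dom k0 u y hu1 hu2)
  rw [hTe] at hR
  have e1 : σ * ((y2 * I : ℂ) * TB c0 (y2 * I)).re = (|y| + 1) * (I * TB c0 (y2 * I)).re := by
    rw [← re_ofReal_mul, ← mul_assoc, hσd, mul_assoc, re_ofReal_mul]
  rw [e1] at hR
  have hk4 : |(k0 : ℝ)| ≤ 4 * n := by rw [hk, abs_le]; constructor <;> nlinarith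
  have hy1 : (1 : ℝ) ≤ 1 + |y| := by linarith
  have hny : n * |y| ≥ |y| := by nlinarith
  have hQ : ‖((k0 : ℝ) + (|y| + 1 : ℝ) * I : ℂ)‖ + 6 * n + 2 ≤ 13 * n * (1 + |y|) := by
    have := norm_add_le ((k0 : ℝ) : ℂ) ((|y| + 1 : ℝ) * I)
    rw [norm_mul, norm_I, norm_real, norm_real, Real.norm_eq_abs, Real.norm_eq_abs, abs_of_nonneg (by positivity : 0 ≤ |y| + 1)] at this
    nlinarith
  have ht : ‖(u + y * I : ℂ)‖ ≤ 13 * n * (1 + |y|) := by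
    have := norm_add_le (u : ℂ) (y * I)
    rw [norm_mul, norm_I, norm_real, norm_real, Real.norm_eq_abs, Real.norm_eq_abs] at this
    have h3 : |u| ≤ 4 * n + 2 := by
      rw [abs_le] at hk4 ⊢; constructor <;> linarith [hk4.1, hk4.2]
    nlinarith
  have hb1 : 1 ≤ 13 * n * (1 + |y|) := by nlinarith
  have htj : ‖(u + y * I : ℂ)‖ ^ j ≤ (13 * n * (1 + |y|)) ^ 2 :=
    (pow_le_pow_left₀ (norm_nonneg _) ht j).trans (pow_le_pow_right₀ hb1 (by omega))
  unfold PE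
  rw [Polynomial.eval_mul, Polynomial.eval_pow, Polynomial.eval_X, norm_mul, norm_mul, norm_pow, Complex.norm_exp]
  have e2 : (lam * (u + y * I)).re = Real.log 3 / 2 * u + Real.pi / 6 * y := by
    rw [mul_re, lam_re, lam_im]; simp
  rw [e2]
  have hl : 0 < Real.log 3 := Real.log_pos (by norm_num)
  have e3 : Real.exp (Real.log 3 / 2 * u + Real.pi / 6 * y) ≤ Real.exp (n * (c0 * Real.log 3 / 2) + Real.pi / 6 * y) := by
    apply Real.exp_le_exp.2
    have : Real.log 3 / 2 * u ≤ Real.log 3 / 2 * k0 := by gcongr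
    rw [hk] at this; linarith
  have hQ9 := pow_le_pow_left₀ (by positivity) hQ 9
  calc _ ≤ ((13 * n * (1 + |y|)) ^ 9 * Real.exp (n * HB c0 (y2 * I) + (|y| + 1) * (I * TB c0 (y2 * I)).re)) * (13 * n * (1 + |y|)) ^ 2 * Real.exp (n * (c0 * Real.log 3 / 2) + Real.pi / 6 * y) := by
        gcongr
        exact hR.trans (by gcongr)
    _ = (13 * n * (1 + |y|)) ^ 11 * (Real.exp (n * HB c0 (y2 * I) + (|y| + 1) * (I * TB c0 (y2 * I)).re) * Real.exp (n * (c0 * Real.log 3 / 2) + Real.pi / 6 * y)) := by ring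
    _ = _ := by rw [← Real.exp_add]; congr 2; ring

lemma vert_ker (c0 y2 : ℝ) (hy2 : 0 < y2) (h1 : -4 ≤ c0) (h2 : c0 ≤ -1) (hΘ : (I * TB c0 (y2 * I)).re < 11 * Real.pi / 6) :
    ∃ C : ℝ, 0 < C ∧ ∀ (n j : ℕ) (k0 : ℤ) (u y κ : ℝ), 1 ≤ n → j < 3 → (k0 : ℝ) = c0 * n → (k0 : ℝ) - 2 ≤ u → u ≤ k0 →
      |κ| ≤ 4 * Real.pi ^ 2 * Real.exp (-(2 * Real.pi * |y|)) →
      ‖PE n j (u + y * I) * (κ : ℂ)‖ ≤ C * n ^ 11 * Real.exp (n * (HB c0 (y2 * I) + c0 * Real.log 3 / 2)) / (1 + y ^ 2) := by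
  set Θ := (I * TB c0 (y2 * I)).re with hΘd
  obtain ⟨C, hC, hd⟩ := dec (11 * Real.pi / 6 - Θ) (by linarith)
  refine ⟨13 ^ 11 * Real.exp Θ * (4 * Real.pi ^ 2) * C, by positivity, ?_⟩
  intro n j k0 u y κ hn hj hk hu1 hu2 hκ
  have hv := vert n j hn hj c0 y2 hy2 h1 h2 k0 hk u hu1 hu2 y
  rw [← hΘd] at hv
  rw [norm_mul, norm_real, Real.norm_eq_abs]
  have hy := le_abs_self y
  set H := (HB c0 (y2 * I) + c0 * Real.log 3 / 2) with hH
  have hv2 : ‖PE n j (u + y * I)‖ ≤ (13 * n * (1 + |y|)) ^ 11 * Real.exp (n * H + (|y| + 1) * Θ + Real.pi / 6 * |y|) := by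
    refine hv.trans ?_
    gcongr
  calc _ ≤ ((13 * n * (1 + |y|)) ^ 11 * Real.exp (n * H + (|y| + 1) * Θ + Real.pi / 6 * |y|)) * (4 * Real.pi ^ 2 * Real.exp (-(2 * Real.pi * |y|))) := by
        gcongr
    _ = 13 ^ 11 * (4 * Real.pi ^ 2) * n ^ 11 * (1 + |y|) ^ 11 * (Real.exp (n * H + (|y| + 1) * Θ + Real.pi / 6 * |y|) * Real.exp (-(2 * Real.pi * |y|))) := by ring
    _ = 13 ^ 11 * (4 * Real.pi ^ 2) * n ^ 11 * (1 + |y|) ^ 11 * (Real.exp (n * H) * Real.exp Θ * Real.exp (-((11 * Real.pi / 6 - Θ) * |y|))) := by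
        rw [← Real.exp_add, ← Real.exp_add, ← Real.exp_add]; congr 2; ring
    _ = 13 ^ 11 * (4 * Real.pi ^ 2) * n ^ 11 * Real.exp (n * H) * Real.exp Θ * ((1 + |y|) ^ 11 * Real.exp (-((11 * Real.pi / 6 - Θ) * |y|))) := by ring
    _ ≤ 13 ^ 11 * (4 * Real.pi ^ 2) * n ^ 11 * Real.exp (n * H) * Real.exp Θ * (C / (1 + y ^ 2)) := by
        gcongr; exact hd y
    _ = _ := by ring

lemma ker_cosh (y : ℝ) : |Real.pi ^ 2 / Real.cosh (Real.pi * y) ^ 2| ≤ 4 * Real.pi ^ 2 * Real.exp (-(2 * Real.pi * |y|)) := by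
  rw [abs_of_nonneg (by positivity)]
  have h : Real.exp (Real.pi * |y|) / 2 ≤ Real.cosh (Real.pi * y) := by
    rw [← Real.cosh_abs, abs_mul, abs_of_pos Real.pi_pos, Real.cosh_eq]
    linarith [Real.exp_pos (-(Real.pi * |y|))]
  have h2 := pow_le_pow_left₀ (by positivity) h 2
  have h3 : Real.exp (-(2 * Real.pi * |y|)) * Real.exp (Real.pi * |y|) ^ 2 = 1 := by
    rw [← Real.exp_nat_mul, ← Real.exp_add, ← Real.exp_zero]; congr 1; push_cast; ring
  rw [div_le_iff₀ (pow_pos (Real.cosh_pos _) 2)]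
  calc Real.pi ^ 2 = 4 * Real.pi ^ 2 * Real.exp (-(2 * Real.pi * |y|)) * (Real.exp (Real.pi * |y|) / 2) ^ 2 := by
        rw [div_pow]; linear_combination (-Real.pi ^ 2) * h3
    _ ≤ _ := by gcongr

lemma I_bound (c0 y2 : ℝ) (hy2 : 0 < y2) (h1 : -4 ≤ c0) (h2 : c0 ≤ -1) (hΘ : (I * TB c0 (y2 * I)).re < 11 * Real.pi / 6) :
    ∃ C : ℝ, 0 < C ∧ ∀ (n j : ℕ) (k : ℤ), 1 ≤ n → j < 3 → (k : ℝ) = c0 * n →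
      ‖(Polynomial.derivative (Sj n j)).eval 0 + lam * (Sj n j).eval 0‖ ≤
        C * n ^ 11 * Real.exp (n * (HB c0 (y2 * I) + c0 * Real.log 3 / 2)) := by
  obtain ⟨C, hC, hv⟩ := vert_ker c0 y2 hy2 h1 h2 hΘ
  refine ⟨C, hC, fun n j k hn hj hk => ?_⟩
  have hn' : (1 : ℝ) ≤ n := by exact_mod_cast hn
  set M := C * n ^ 11 * Real.exp (n * (HB c0 (y2 * I) + c0 * Real.log 3 / 2)) with hM
  have hM0 : 0 < M := by positivity
  have hid := id_I n j hj k (by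
      have : (-5 * (n : ℤ) : ℝ) ≤ k := by rw [hk]; push_cast; nlinarith
      exact_mod_cast this) (by
      have : (k : ℝ) ≤ 0 := by rw [hk]; nlinarith
      exact_mod_cast this)
  have hle := le_of_tendsto hid.norm (b := M * Real.pi) (by
    filter_upwards [eventually_ge_atTop (0 : ℝ)] with R hR
    apply int_bd (by linarith) hM0.le
    intro y _
    have := hv n j k (k - 1 / 2) y (Real.pi ^ 2 / Real.cosh (Real.pi * y) ^ 2) hn hj hk (by linarith) (by linarith) (ker_cosh y)
    push_cast at this ⊢
    exact this)
  rw [norm_mul, norm_mul, norm_real, Real.norm_eq_abs, abs_of_pos Real.pi_pos, Complex.norm_ofNat] at hle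
  have hpi := Real.pi_pos
  set X := ‖(Polynomial.derivative (Sj n j)).eval 0 + lam * (Sj n j).eval 0‖
  have hX : 0 ≤ X := norm_nonneg _
  have : Real.pi * X ≤ Real.pi * M := by nlinarith [mul_nonneg hpi.le hX]
  exact le_of_mul_le_mul_left this hpi

end

section
open Filter Topology Set Complex

lemma lam_ne : lam ≠ 0 := by
  intro h; have := lam_im; rw [h] at this; simp at this

lemma prim_monom (m : ℕ) : ∃ Q : Polynomial ℂ, Polynomial.derivative Q + Polynomial.C lam * Q = Polynomial.X ^ m := by
  induction m with
  | zero =>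
    refine ⟨Polynomial.C (1 / lam), ?_⟩
    rw [Polynomial.derivative_C, ← Polynomial.C_mul, mul_one_div_cancel lam_ne]; simp
  | succ m ih =>
    obtain ⟨Q, hQ⟩ := ih
    refine ⟨Polynomial.C (1 / lam) * (Polynomial.X ^ (m + 1) - Polynomial.C ((m : ℂ) + 1) * Q), ?_⟩
    have h1 : Polynomial.C lam * Polynomial.C (1 / lam) = 1 := by
      rw [← Polynomial.C_mul, mul_one_div_cancel lam_ne]; simp
    have h2 : Polynomial.derivative (Polynomial.X ^ (m + 1) : Polynomial ℂ) = Polynomial.C ((m : ℂ) + 1) * Polynomial.X ^ m := by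
      rw [Polynomial.derivative_X_pow]; simp
    rw [Polynomial.derivative_C_mul, Polynomial.derivative_sub, Polynomial.derivative_C_mul, h2]
    linear_combination (-Polynomial.C (1 / lam) * Polynomial.C ((m : ℂ) + 1)) * hQ + Polynomial.X ^ (m + 1) * h1

lemma prim (P : Polynomial ℂ) : ∃ Q : Polynomial ℂ, Polynomial.derivative Q + Polynomial.C lam * Q = P := by
  induction P using Polynomial.induction_on' with
  | add p q hp hq =>
    obtain ⟨a, ha⟩ := hp
    obtain ⟨b, hb⟩ := hq
    exact ⟨a + b, by rw [Polynomial.derivative_add, ← ha, ← hb]; ring⟩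
  | monomial m c =>
    obtain ⟨a, ha⟩ := prim_monom m
    exact ⟨Polynomial.C c * a, by rw [Polynomial.derivative_C_mul, ← Polynomial.C_mul_X_pow_eq_monomial, ← ha]; ring⟩

lemma G_tendsto (Q : Polynomial ℂ) (u e : ℂ) (he : (lam * e).re < 0) :
    Tendsto (fun R : ℝ => Q.eval (u + R * e) * Complex.exp (lam * (u + R * e))) atTop (𝓝 0) := by
  have e0 : 0 < ‖e‖ := by
    rw [norm_pos_iff]; intro h; rw [h] at he; simp at he
  set a := -(lam * e).re with ha
  have ha0 : 0 < a := by linarith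
  obtain ⟨C, hC, hb⟩ := poly_bound Q (a / (2 * ‖e‖)) (by positivity)
  have hlim : Tendsto (fun R : ℝ => C * Real.exp (a / (2 * ‖e‖) * ‖u‖ + (lam * u).re) * Real.exp (-(a / 2 * R))) atTop (𝓝 0) := by
    rw [show (0 : ℝ) = C * Real.exp (a / (2 * ‖e‖) * ‖u‖ + (lam * u).re) * 0 by ring]
    apply Tendsto.const_mul
    exact Real.tendsto_exp_neg_atTop_nhds_zero.comp (tendsto_id.const_mul_atTop (by positivity))
  apply squeeze_zero_norm' _ hlim
  filter_upwards [eventually_ge_atTop (0 : ℝ)] with R hR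
  rw [norm_mul, Complex.norm_exp]
  have h1 : ‖u + R * e‖ ≤ ‖u‖ + R * ‖e‖ := by
    refine (norm_add_le _ _).trans ?_
    rw [norm_mul, norm_real, Real.norm_eq_abs, abs_of_nonneg hR]
  have h2 : (lam * (u + R * e)).re = (lam * u).re - a * R := by
    rw [mul_add, add_re, show lam * (R * e) = (R : ℂ) * (lam * e) by ring, re_ofReal_mul, ha]; ring
  rw [h2]
  calc _ ≤ C * Real.exp (a / (2 * ‖e‖) * (‖u‖ + R * ‖e‖)) * Real.exp ((lam * u).re - a * R) := by
        gcongr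
        exact (hb _).trans (by gcongr)
    _ = C * (Real.exp (a / (2 * ‖e‖) * (‖u‖ + R * ‖e‖)) * Real.exp ((lam * u).re - a * R)) := by ring
    _ = C * (Real.exp (a / (2 * ‖e‖) * ‖u‖ + (lam * u).re) * Real.exp (-(a / 2 * R))) := by
        rw [← Real.exp_add, ← Real.exp_add]
        congr 2
        field_simp
        ring
    _ = _ := by ring

lemma G_deriv (n j : ℕ) (Q : Polynomial ℂ) (hQ : Polynomial.derivative Q + Polynomial.C lam * Q = RR n * Polynomial.X ^ j) (u e : ℂ) (s : ℝ) :
    HasDerivAt (fun s : ℝ => Q.eval (u + s * e) * Complex.exp (lam * (u + s * e))) (e * PE n j (u + s * e)) s := by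
  have h0 : HasDerivAt (fun s : ℝ => (u + s * e : ℂ)) e s := by
    simpa using ((hasDerivAt_id s).ofReal_comp.mul_const e).const_add u
  have h1 := (Q.hasDerivAt (u + s * e)).comp s h0
  have h2 := (h0.const_mul lam).cexp
  refine (h1.mul h2).congr_deriv ?_
  unfold PE
  rw [← hQ]
  simp only [Polynomial.eval_add, Polynomial.eval_mul, Polynomial.eval_C, Function.comp]
  ring

/- both integrals -/
lemma rot (n j : ℕ) (u : ℝ) (e : ℂ) (he : (lam * e).re < 0) (M : ℝ) (hM : 0 ≤ M)
    (hb : ∀ s : ℝ, 0 ≤ s → ‖PE n j (u + s * e)‖ ≤ M / (1 + s ^ 2)) :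
    ∃ L : ℂ, Tendsto (fun R : ℝ => ∫ y in (-R)..0, PE n j (u + y * I)) atTop (𝓝 L) ∧ ‖L‖ ≤ ‖e‖ * (M * Real.pi) := by
  obtain ⟨Q, hQ⟩ := prim (RR n * Polynomial.X ^ j)
  set G : ℂ → ℂ := fun t => Q.eval t * Complex.exp (lam * t) with hG
  have hPc : ∀ e : ℂ, Continuous fun s : ℝ => PE n j (u + s * e) := fun e => (PE_cont n j).comp (by fun_prop)
  have i1 : ∀ (e : ℂ) (a b : ℝ), e * ∫ s in a..b, PE n j (u + s * e) = G (u + b * e) - G (u + a * e) := by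
    intro e a b
    rw [← intervalIntegral.integral_const_mul]
    exact intervalIntegral.integral_eq_sub_of_hasDerivAt (fun s _ => G_deriv n j Q hQ u e s)
      ((continuous_const.mul (hPc e)).intervalIntegrable _ _)
  have hGu : ‖G u‖ ≤ ‖e‖ * (M * Real.pi) := by
    have t1 : Tendsto (fun R : ℝ => G (u + R * e) - G u) atTop (𝓝 (0 - G u)) := (G_tendsto Q u e he).sub_const _
    have := le_of_tendsto t1.norm (b := ‖e‖ * (M * Real.pi)) (by
      filter_upwards [eventually_ge_atTop (0 : ℝ)] with R hR
      have h2 := i1 e 0 R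
      simp only [ofReal_zero, zero_mul, add_zero] at h2
      rw [← h2, norm_mul]
      apply mul_le_mul_of_nonneg_left _ (norm_nonneg _)
      exact int_bd hR hM fun y hy => hb y hy.1.le)
    rwa [zero_sub, norm_neg] at this
  refine ⟨-I * G u, ?_, by rwa [norm_mul, norm_neg, norm_I, one_mul]⟩
  have t2 : Tendsto (fun R : ℝ => -I * (G u - G (u + R * (-I)))) atTop (𝓝 (-I * (G u - 0))) := by
    apply Tendsto.const_mul
    refine tendsto_const_nhds.sub (G_tendsto Q u (-I) ?_)
    simp [lam_im]; positivity
  rw [sub_zero] at t2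
  refine t2.congr fun R => ?_
  have h2 := i1 I (-R) 0
  simp only [ofReal_zero, zero_mul, add_zero] at h2
  rw [show (u + R * -I : ℂ) = u + ((-R : ℝ) : ℂ) * I by push_cast; ring, ← h2, ← mul_assoc]
  simp

set_option maxHeartbeats 1000000 in
lemma ray (n j : ℕ) (hn : 1 ≤ n) (hj : j < 3) (c0 : ℝ) (d : ℂ) (hd : 0 < d.im) (hd1 : d.re < 0) (hd2 : d.re ^ 2 ≤ d.im ^ 2)
    (h1 : -4 ≤ c0) (h2 : c0 ≤ -7 / 2) (k0 : ℤ) (hk : (k0 : ℝ) = c0 * n) (s : ℝ) (hs : 0 ≤ s)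
    (hν : (d * (TB c0 d + (starRingEnd ℂ) lam)).re < 0) (K : ℝ) (hK : K = 12 + ‖d‖ / d.im + 3 / 2 * ‖d‖ / (-d.re)) :
    ‖PE n j ((k0 - 3 / 2 : ℝ) + s * ((d.re / d.im : ℝ) - I))‖ ≤ (K * n * (1 + |s|)) ^ 11 *
      Real.exp (n * (HB c0 d + c0 * Real.log 3 / 2) + Real.pi / 4 * (d.im / (-d.re))) *
        Real.exp (-(-(d * (TB c0 d + (starRingEnd ℂ) lam)).re / d.im * |s|)) := by
  rw [abs_of_nonneg hs]
  have hn' : (1 : ℝ) ≤ n := by exact_mod_cast hn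
  have hn0 : (0 : ℝ) < n := by linarith
  have hr : 0 < -d.re := by linarith
  set σ : ℝ := s / d.im + 3 / 2 / (-d.re) with hσ
  set t : ℂ := ((k0 - 3 / 2 : ℝ) + s * ((d.re / d.im : ℝ) - I)) with ht
  set T : ℂ := ((c0 * n : ℝ) + σ * d : ℂ) with hT
  have hσ0 : 0 < σ := by positivity
  have Tre : T.re = c0 * n + s * (d.re / d.im) - 3 / 2 := by
    simp only [hT, add_re, ofReal_re, re_ofReal_mul, hσ]
    rw [add_mul, div_mul_eq_mul_div, div_mul_eq_mul_div, div_neg, mul_div_assoc (3 / 2 : ℝ), div_self hd1.ne]; ring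
  have Tim : T.im = s + 3 / 2 * (d.im / (-d.re)) := by
    simp only [hT, add_im, ofReal_im, im_ofReal_mul, hσ]
    field_simp
    ring
  have tre : t.re = T.re := by
    rw [Tre, ht]; simp [hk]; ring
  have tim : t.im = -s := by rw [ht]; simp
  have hh : 1 ≤ d.im / (-d.re) := by
    rw [le_div_iff₀ hr, one_mul]; nlinarith
  have him : |t.im| ≤ |T.im| := by
    rw [tim, Tim, abs_neg, abs_of_nonneg hs, abs_of_nonneg (by positivity)]; linarith
  have hD : Dom t T := by
    intro r
    constructor
    · intro _
      apply norm_mono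
      · simp [tre]
      · simpa using him
    · intro h
      apply norm_mono
      · simp [tre]
        rw [abs_of_nonpos (by linarith), abs_of_nonpos (by linarith)]
        linarith
      · simpa using him
  have hR := RR_bound n hn t d c0 σ hσ0 hd h1 (by linarith) hd2 (Or.inr ⟨hd1, h2⟩) (by rw [← hT, Tim]; linarith) hD
  rw [← hT] at hR
  have hTn : ‖T‖ + 6 * n + 2 ≤ K * n * (1 + s) := by
    have := norm_add_le ((c0 * n : ℝ) : ℂ) (σ * d)
    rw [norm_mul, norm_real, norm_real, Real.norm_eq_abs, Real.norm_eq_abs, abs_of_pos hσ0] at this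
    have h3 : |c0 * n| ≤ 4 * n := by rw [abs_le]; constructor <;> nlinarith
    have h4 : σ * ‖d‖ = s * (‖d‖ / d.im) + 3 / 2 * ‖d‖ / (-d.re) := by rw [hσ]; ring
    rw [h4] at this
    set α := ‖d‖ / d.im
    set β := 3 / 2 * ‖d‖ / (-d.re)
    have hα : 0 ≤ α := by positivity
    have hβ : 0 ≤ β := by positivity
    rw [hK]
    have e1 : (12 + α + β) * n * (1 + s) = 12 * n + 12 * n * s + (α * n + β * n) * (1 + s) := by ring
    have e2 : (α * 1 + β * 1) * (1 + s) ≤ (α * n + β * n) * (1 + s) := by gcongr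
    have e3 : 0 ≤ n * s := by positivity
    have e4 : 0 ≤ β * s := by positivity
    have e6 : (α * 1 + β * 1) * (1 + s) = α + β + s * α + β * s := by ring
    rw [e1]
    linarith
  have htn : ‖t‖ ≤ K * n * (1 + s) := by
    have : ‖t‖ ≤ ‖T‖ := norm_mono (by rw [tre]) him
    linarith
  have hb1 : 1 ≤ K * n * (1 + s) := by linarith [norm_nonneg T]
  have htj : ‖t‖ ^ j ≤ (K * n * (1 + s)) ^ 2 :=
    (pow_le_pow_left₀ (norm_nonneg _) htn j).trans (pow_le_pow_right₀ hb1 (by omega))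
  unfold PE
  rw [Polynomial.eval_mul, Polynomial.eval_pow, Polynomial.eval_X, norm_mul, norm_mul, norm_pow, Complex.norm_exp]
  have e2 : (lam * t).re = n * (c0 * Real.log 3 / 2) + σ * (d * (starRingEnd ℂ) lam).re + Real.pi / 4 * (d.im / (-d.re)) := by
    rw [mul_re, mul_re, conj_re, conj_im, lam_re, lam_im, tim, tre]
    have a1 : T.re = c0 * n + σ * d.re := by simp [hT]
    have a2 : T.im = σ * d.im := by simp [hT]
    rw [a1]
    linear_combination -Real.pi / 6 * a2 + Real.pi / 6 * Tim
  have e5 : σ * (d * TB c0 d).re + σ * (d * (starRingEnd ℂ) lam).re ≤ -(-(d * (TB c0 d + (starRingEnd ℂ) lam)).re / d.im * s) := by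
    rw [mul_add d, add_re] at hν ⊢
    set A := (d * TB c0 d).re
    set B := (d * (starRingEnd ℂ) lam).re
    have : -(-(A + B) / d.im * s) = (s / d.im) * (A + B) := by ring
    rw [this, ← mul_add]
    apply mul_le_mul_of_nonpos_right _ hν.le
    rw [hσ]; linarith [show 0 < 3 / 2 / (-d.re) by positivity]
  have hQ9 := pow_le_pow_left₀ (by positivity) hTn 9
  rw [e2]
  calc _ ≤ ((K * n * (1 + s)) ^ 9 * Real.exp (n * HB c0 d + σ * (d * TB c0 d).re)) * (K * n * (1 + s)) ^ 2 * Real.exp (n * (c0 * Real.log 3 / 2) + σ * (d * (starRingEnd ℂ) lam).re + Real.pi / 4 * (d.im / (-d.re))) := by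
        gcongr
        exact hR.trans (by gcongr)
    _ = (K * n * (1 + s)) ^ 11 * (Real.exp (n * HB c0 d + σ * (d * TB c0 d).re) * Real.exp (n * (c0 * Real.log 3 / 2) + σ * (d * (starRingEnd ℂ) lam).re + Real.pi / 4 * (d.im / (-d.re)))) := by ring
    _ ≤ _ := by
        rw [mul_assoc ((K * n * (1 + s)) ^ 11), ← Real.exp_add, ← Real.exp_add]
        have : 0 ≤ K * n * (1 + s) := by linarith
        apply mul_le_mul_of_nonneg_left _ (pow_nonneg this 11)
        apply Real.exp_le_exp.2
        linarith

lemma ker_pos (y : ℝ) (hy : 0 ≤ y) : |1 / (1 + Real.exp (2 * Real.pi * y))| ≤ 4 * Real.pi ^ 2 * Real.exp (-(2 * Real.pi * |y|)) := by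
  rw [abs_of_nonneg hy, abs_of_nonneg (by positivity), div_le_iff₀ (by positivity), Real.exp_neg]
  have h := Real.exp_pos (2 * Real.pi * y)
  have h3 : 1 ≤ 4 * Real.pi ^ 2 := by nlinarith [Real.pi_gt_three]
  have : (Real.exp (2 * Real.pi * y))⁻¹ * (1 + Real.exp (2 * Real.pi * y)) ≥ 1 := by
    rw [mul_add, inv_mul_cancel₀ h.ne']; have : 0 < (Real.exp (2 * Real.pi * y))⁻¹ := by positivity
    linarith
  rw [mul_assoc]; nlinarith

lemma ker_neg (y : ℝ) (hy : y ≤ 0) : |1 / (1 + Real.exp (2 * Real.pi * y)) - 1| ≤ 4 * Real.pi ^ 2 * Real.exp (-(2 * Real.pi * |y|)) := by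
  have h := Real.exp_pos (2 * Real.pi * y)
  have h3 : 1 ≤ 4 * Real.pi ^ 2 := by nlinarith [Real.pi_gt_three]
  have e1 : 1 / (1 + Real.exp (2 * Real.pi * y)) - 1 = -(Real.exp (2 * Real.pi * y) / (1 + Real.exp (2 * Real.pi * y))) := by
    field_simp; ring
  rw [e1, abs_neg, abs_of_nonneg (by positivity), abs_of_nonpos hy, div_le_iff₀ (by positivity),
    show -(2 * Real.pi * -y) = 2 * Real.pi * y by ring]
  nlinarith [mul_pos h h, mul_le_mul_of_nonneg_right h3 (mul_pos h h).le, mul_le_mul_of_nonneg_right h3 h.le]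

set_option maxHeartbeats 1000000 in
lemma B_bound (c0 y2 : ℝ) (hy2 : 0 < y2) (d : ℂ) (hd : 0 < d.im) (hd1 : d.re < 0) (hd2 : d.re ^ 2 ≤ d.im ^ 2)
    (h1 : -4 ≤ c0) (h2 : c0 ≤ -7 / 2) (hΘ : (I * TB c0 (y2 * I)).re < 11 * Real.pi / 6)
    (hν : (d * (TB c0 d + (starRingEnd ℂ) lam)).re < 0) (H : ℝ) (hH1 : HB c0 (y2 * I) + c0 * Real.log 3 / 2 ≤ H)
    (hH2 : HB c0 d + c0 * Real.log 3 / 2 ≤ H) :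
    ∃ C : ℝ, 0 < C ∧ ∀ (n j : ℕ) (k0 : ℤ), 1 ≤ n → j < 3 → (k0 : ℝ) = c0 * n →
      ‖(Sj n j).eval 0‖ ≤ C * n ^ 11 * Real.exp (n * H) := by
  obtain ⟨C, hC, hv⟩ := vert_ker c0 y2 hy2 h1 (by linarith) hΘ
  have hr : 0 < -d.re := by linarith
  obtain ⟨K, hK⟩ : ∃ K, K = 12 + ‖d‖ / d.im + 3 / 2 * ‖d‖ / (-d.re) := ⟨_, rfl⟩
  have hK0 : 0 < K := by rw [hK]; positivity
  set ν := -(d * (TB c0 d + (starRingEnd ℂ) lam)).re / d.im with hνd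
  have hν0 : 0 < ν := by rw [hνd]; apply div_pos _ hd; linarith
  obtain ⟨C2, hC2, hdc⟩ := dec ν hν0
  set e : ℂ := ((d.re / d.im : ℝ) - I) with he
  set W := Real.exp (Real.pi / 4 * (d.im / (-d.re))) with hW
  have hW0 : 0 < W := Real.exp_pos _
  refine ⟨C * Real.pi + C * Real.pi + ‖e‖ * (K ^ 11 * W * C2 * Real.pi) , by have := Real.pi_pos; positivity, ?_⟩
  intro n j k0 hn hj hk
  have hn' : (1 : ℝ) ≤ n := by exact_mod_cast hn
  set u : ℝ := k0 - 3 / 2 with hu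
  set E := n ^ 11 * Real.exp (n * H) with hE
  have hE0 : 0 < E := by positivity
  have hray : ∀ s : ℝ, 0 ≤ s → ‖PE n j (u + s * e)‖ ≤ (K ^ 11 * W * C2 * E) / (1 + s ^ 2) := by
    intro s hs
    refine (ray n j hn hj c0 d hd hd1 hd2 h1 h2 k0 hk s hs hν K hK).trans ?_
    rw [← hνd, Real.exp_add, ← hW]
    have q1 : Real.exp (n * (HB c0 d + c0 * Real.log 3 / 2)) ≤ Real.exp (n * H) := by
      apply Real.exp_le_exp.2; gcongr
    calc _ = K ^ 11 * n ^ 11 * Real.exp (n * (HB c0 d + c0 * Real.log 3 / 2)) * W * ((1 + |s|) ^ 11 * Real.exp (-(ν * |s|))) := by ring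
      _ ≤ K ^ 11 * n ^ 11 * Real.exp (n * H) * W * (C2 / (1 + s ^ 2)) := by
        gcongr
        exact hdc s
      _ = _ := by rw [hE]; ring
  obtain ⟨L, hL, hLb⟩ := rot n j u e (by
    rw [mul_re, lam_re, lam_im, he]
    simp
    have : d.re / d.im < 0 := div_neg_of_neg_of_pos hd1 hd
    have hl : 0 < Real.log 3 := Real.log_pos (by norm_num)
    nlinarith [Real.pi_pos]) _ (by positivity) hray
  have hvert : ∀ y κ : ℝ, |κ| ≤ 4 * Real.pi ^ 2 * Real.exp (-(2 * Real.pi * |y|)) → ‖PE n j (u + y * I) * (κ : ℂ)‖ ≤ (C * E) / (1 + y ^ 2) := by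
    intro y κ hκ
    refine (hv n j k0 u y κ hn hj hk (by linarith) (by linarith) hκ).trans ?_
    rw [hE, ← mul_assoc]
    gcongr
  have hid := id_B n j hj (k0 - 1) (by
      have : (-5 * (n : ℤ) : ℝ) ≤ (k0 : ℝ) - 1 := by rw [hk]; push_cast; nlinarith
      exact_mod_cast this) (by
      have : (k0 : ℝ) - 1 ≤ 0 := by rw [hk]; nlinarith
      exact_mod_cast this)
  have hu2 : ∀ y : ℝ, (((k0 - 1 : ℤ) : ℂ) - 1 / 2 + y * I) = (u + y * I : ℂ) := by
    intro y; rw [hu]; push_cast; ring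
  simp only [hu2] at hid
  have hc1 : Continuous fun y : ℝ => PE n j (u + y * I) := (PE_cont n j).comp (by fun_prop)
  have hc2 : Continuous fun y : ℝ => ((1 / (1 + Real.exp (2 * Real.pi * y)) : ℝ) : ℂ) := by
    apply continuous_ofReal.comp
    apply Continuous.div continuous_const (by fun_prop)
    intro y; positivity
  have hc3 : Continuous fun y : ℝ => PE n j (u + y * I) * ((1 / (1 + Real.exp (2 * Real.pi * y)) : ℝ) : ℂ) := hc1.mul hc2
  have hle := le_of_tendsto (hid.sub hL).norm (b := C * E * Real.pi + C * E * Real.pi) (by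
    filter_upwards [eventually_ge_atTop (0 : ℝ)] with R hR
    have hs : (∫ y in (-R)..R, PE n j (u + y * I) * ((1 / (1 + Real.exp (2 * Real.pi * y)) : ℝ) : ℂ)) - ∫ y in (-R)..0, PE n j (u + y * I)
      = (∫ y in (-R)..0, PE n j (u + y * I) * ((1 / (1 + Real.exp (2 * Real.pi * y)) - 1 : ℝ) : ℂ)) + ∫ y in (0)..R, PE n j (u + y * I) * ((1 / (1 + Real.exp (2 * Real.pi * y)) : ℝ) : ℂ) := by
      rw [← intervalIntegral.integral_add_adjacent_intervals (a := -R) (b := 0) (c := R) (hc3.intervalIntegrable _ _) (hc3.intervalIntegrable _ _),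
        add_sub_right_comm, ← intervalIntegral.integral_sub (hc3.intervalIntegrable _ _) (hc1.intervalIntegrable _ _)]
      congr 1
      apply intervalIntegral.integral_congr
      intro y _
      simp only
      rw [ofReal_sub (1 / (1 + Real.exp (2 * Real.pi * y))) 1, ofReal_one]; ring
    rw [hs]
    refine (norm_add_le _ _).trans (add_le_add ?_ ?_)
    · exact int_bd (by linarith) (by positivity) fun y hy => hvert y _ (ker_neg y hy.2)
    · exact int_bd hR (by positivity) fun y hy => hvert y _ (ker_pos y hy.1.le))
  have : ‖(Sj n j).eval 0‖ = ‖-I * (Sj n j).eval 0‖ := by rw [norm_mul, norm_neg, norm_I, one_mul]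
  rw [this]
  have h9 := norm_add_le (-I * (Sj n j).eval 0 - L) L
  rw [sub_add_cancel] at h9
  refine h9.trans ((add_le_add hle hLb).trans (le_of_eq ?_))
  rw [hE]; ring

end

section
open Filter Topology Set Complex

lemma arg_ge {z : ℂ} (hz : 0 < z.im) {θ : ℝ} (h1 : θ ≤ Real.pi) (h : 0 ≤ z.im * Real.cos θ - z.re * Real.sin θ) : θ ≤ z.arg := by
  by_contra! hlt
  have hz0 : z ≠ 0 := by intro h0; rw [h0] at hz; simp at hz
  have hr : 0 < ‖z‖ := norm_pos_iff.2 hz0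
  have ha : 0 ≤ z.arg := Complex.arg_nonneg_iff.2 hz.le
  have ha0 : z.arg ≠ 0 := by
    intro h0; rw [Complex.arg_eq_zero_iff] at h0; linarith [h0.2]
  have ha1 : 0 < z.arg := lt_of_le_of_ne ha (Ne.symm ha0)
  have hs := Real.sin_pos_of_pos_of_lt_pi (x := θ - z.arg) (by linarith) (by linarith)
  rw [Real.sin_sub] at hs
  have e1 := Complex.norm_mul_cos_arg z
  have e2 := Complex.norm_mul_sin_arg z
  rw [← e1, ← e2] at h
  nlinarith

lemma arg_bd {z : ℂ} (hz : 0 < z.im) : 0 < z.arg ∧ z.arg < Real.pi := by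
  constructor
  · apply lt_of_le_of_ne (Complex.arg_nonneg_iff.2 hz.le)
    intro h0; rw [eq_comm, Complex.arg_eq_zero_iff] at h0; linarith [h0.2]
  · rw [Complex.arg_lt_pi_iff]; right; exact hz.ne'

def uu (c0 : ℝ) (d : ℂ) (a : ℝ) : ℝ := (c0 + d.re + a) ^ 2 - 5 * (c0 + d.re + a) + d.im ^ 2

lemma exp_tb (c0 : ℝ) (d : ℂ) (hd : 0 < d.im) (a : ℕ) : ∃ r : ℝ, 0 < r ∧ Complex.exp (tb c0 d a) = r * (uu c0 d a - (5 * d.im : ℝ) * I) := by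
  unfold tb
  have i1 : (c0 + d + a : ℂ).im = d.im := by simp
  have i2 : (c0 + d + a - 5 : ℂ).im = d.im := by simp
  have z1 : (c0 + d + a : ℂ) ≠ 0 := by intro h; rw [h] at i1; simp at i1; linarith
  have z2 : (c0 + d + a - 5 : ℂ) ≠ 0 := by intro h; rw [h] at i2; simp at i2; linarith
  rw [Complex.exp_sub, Complex.exp_log z1, Complex.exp_log z2]
  refine ⟨(normSq (c0 + d + a - 5))⁻¹, inv_pos.2 (normSq_pos.2 z2), ?_⟩
  rw [div_eq_mul_inv, inv_def, ofReal_inv, mul_comm ((starRingEnd ℂ) _), mul_left_comm]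
  congr 1
  apply Complex.ext
  · simp; unfold uu; ring
  · simp; ring

def Wr (c0 : ℝ) (d : ℂ) : ℝ := uu c0 d 6 * uu c0 d 5 * uu c0 d 4 - 25 * d.im ^ 2 * (uu c0 d 6 + uu c0 d 5 + uu c0 d 4)
def Wi (c0 : ℝ) (d : ℂ) : ℝ := -(5 * d.im) * (uu c0 d 6 * uu c0 d 5 + uu c0 d 6 * uu c0 d 4 + uu c0 d 5 * uu c0 d 4) + 125 * d.im ^ 3

lemma exp_TB (c0 : ℝ) (d : ℂ) (hd : 0 < d.im) : ∃ r : ℝ, 0 < r ∧ Complex.exp (TB c0 d) = r * (Wr c0 d + Wi c0 d * I) := by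
  obtain ⟨r6, h6, e6⟩ := exp_tb c0 d hd 6
  obtain ⟨r5, h5, e5⟩ := exp_tb c0 d hd 5
  obtain ⟨r4, h4, e4⟩ := exp_tb c0 d hd 4
  refine ⟨r6 * r5 * r4, by positivity, ?_⟩
  unfold TB Wr Wi
  rw [Complex.exp_add, Complex.exp_add, e6, e5, e4]
  simp only [Nat.cast_ofNat]
  push_cast
  generalize (uu c0 d 6 : ℂ) = a
  generalize (uu c0 d 5 : ℂ) = b
  generalize (uu c0 d 4 : ℂ) = c
  generalize (d.im : ℂ) = y
  linear_combination (r6 * r5 * r4 * (25 * y ^ 2 * (a + b + c) - 125 * y ^ 3 * I)) * I_sq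

lemma TB_im (c0 : ℝ) (d : ℂ) : (TB c0 d).im = ((c0 + d + (6 : ℕ) : ℂ).arg - (c0 + d + (6 : ℕ) - 5 : ℂ).arg) +
    ((c0 + d + (5 : ℕ) : ℂ).arg - (c0 + d + (5 : ℕ) - 5 : ℂ).arg) + ((c0 + d + (4 : ℕ) : ℂ).arg - (c0 + d + (4 : ℕ) - 5 : ℂ).arg) := by
  unfold TB tb
  simp only [add_im, sub_im, log_im]

lemma xx_re : xx.re = 3 / 2 := by unfold xx ww; simp; norm_num
lemma xx_im : xx.im = -(Real.sqrt 3 / 2) := by unfold xx ww; simp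

lemma Theta (c0 y2 : ℝ) (hy : 0 < y2) (h4 : c0 + 4 ≤ y2)
    (h : 0 < 3 * Wi c0 (y2 * I) - Real.sqrt 3 * Wr c0 (y2 * I)) : (I * TB c0 (y2 * I)).re < 11 * Real.pi / 6 := by
  have hd : 0 < (y2 * I : ℂ).im := by simpa using hy
  obtain ⟨r, hr, e⟩ := exp_TB c0 (y2 * I) hd
  have e2 : Complex.exp (TB c0 (y2 * I) + lam) = r * (Wr c0 (y2 * I) + Wi c0 (y2 * I) * I) * xx := by
    rw [Complex.exp_add, e, exp_lam]
  have e3 : (Complex.exp (TB c0 (y2 * I) + lam)).im = r / 2 * (3 * Wi c0 (y2 * I) - Real.sqrt 3 * Wr c0 (y2 * I)) := by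
    rw [e2, mul_assoc, im_ofReal_mul, mul_im, xx_re, xx_im]
    simp; ring
  rw [exp_im, add_im, lam_im] at e3
  have hpos : 0 < Real.sin ((TB c0 (y2 * I)).im + -(Real.pi / 6)) := by
    have : 0 < Real.exp (TB c0 (y2 * I) + lam).re * Real.sin ((TB c0 (y2 * I)).im + -(Real.pi / 6)) := by rw [e3]; positivity
    exact pos_of_mul_pos_right this (Real.exp_pos _).le
  have hI : (I * TB c0 (y2 * I)).re = -(TB c0 (y2 * I)).im := by simp
  rw [hI]
  by_contra! hc
  have him := TB_im c0 (y2 * I)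
  have ipos : ∀ a : ℕ, 0 < (c0 + y2 * I + a : ℂ).im := by intro a; simpa using hy
  have ipos2 : ∀ a : ℕ, 0 < (c0 + y2 * I + a - 5 : ℂ).im := by intro a; simpa using hy
  have a4 : Real.pi / 4 ≤ (c0 + y2 * I + (4 : ℕ) : ℂ).arg := by
    apply arg_ge (ipos 4) (by linarith [Real.pi_pos])
    rw [Real.cos_pi_div_four, Real.sin_pi_div_four]
    simp only [Nat.cast_ofNat, add_re, add_im, mul_re, mul_im, ofReal_re, ofReal_im, I_re, I_im, re_ofNat, im_ofNat]
    have := Real.sqrt_pos.2 (show (0 : ℝ) < 2 by norm_num)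
    nlinarith
  have b6 := arg_bd (ipos 6)
  have b5 := arg_bd (ipos 5)
  have b6' := arg_bd (ipos2 6)
  have b5' := arg_bd (ipos2 5)
  have b4' := arg_bd (ipos2 4)
  have hp := Real.pi_pos
  simp only [Nat.cast_ofNat] at him a4 b6 b5 b6' b5' b4'
  have : Real.sin ((TB c0 (y2 * I)).im + -(Real.pi / 6)) ≤ 0 := by
    rw [← Real.sin_add_two_pi]
    apply Real.sin_nonpos_of_nonpos_of_neg_pi_le
    · linarith
    · linarith [b6.1, b6.2, b5.1, b5.2, b6'.1, b6'.2, b5'.1, b5'.2, b4'.1, b4'.2]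
  linarith

lemma nu (c0 : ℝ) (d : ℂ) (hd : 0 < d.im) (hd1 : d.re < 0) (h6 : 0 ≤ -(c0 + d.re + 6) * Real.sqrt 3 - d.im)
    (h : 0 < 3 * Wi c0 d + Real.sqrt 3 * Wr c0 d)
    (hn : ((c0 + d.re + 1) ^ 2 + d.im ^ 2) * ((c0 + d.re + 0) ^ 2 + d.im ^ 2) * ((c0 + d.re + -1) ^ 2 + d.im ^ 2) ≤
      3 * (((c0 + d.re + 6) ^ 2 + d.im ^ 2) * ((c0 + d.re + 5) ^ 2 + d.im ^ 2) * ((c0 + d.re + 4) ^ 2 + d.im ^ 2))) :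
    (d * (TB c0 d + (starRingEnd ℂ) lam)).re < 0 := by
  obtain ⟨r, hr, e⟩ := exp_TB c0 d hd
  set X := TB c0 d + (starRingEnd ℂ) lam with hX
  have e2 : Complex.exp X = r * (Wr c0 d + Wi c0 d * I) * (starRingEnd ℂ) xx := by
    rw [hX, Complex.exp_add, e, ← exp_lam, exp_conj]
  have e3 : (Complex.exp X).im = r / 2 * (3 * Wi c0 d + Real.sqrt 3 * Wr c0 d) := by
    rw [e2, mul_assoc, im_ofReal_mul, mul_im, conj_re, conj_im, xx_re, xx_im]
    simp; ring
  rw [exp_im] at e3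
  have hpos : 0 < Real.sin X.im := by
    have : 0 < Real.exp X.re * Real.sin X.im := by rw [e3]; positivity
    exact pos_of_mul_pos_right this (Real.exp_pos _).le
  have hXi : X.im = (TB c0 d).im + Real.pi / 6 := by rw [hX, add_im, conj_im, lam_im]; ring
  have hp := Real.pi_pos
  have ipos : ∀ a : ℕ, 0 < (c0 + d + a : ℂ).im := by intro a; simpa using hd
  have ipos2 : ∀ a : ℕ, 0 < (c0 + d + a - 5 : ℂ).im := by intro a; simpa using hd
  have s3 := Real.sqrt_pos.2 (show (0 : ℝ) < 3 by norm_num)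
  have aa : ∀ a : ℕ, a ≤ 6 → 2 * Real.pi / 3 ≤ (c0 + d + a : ℂ).arg := by
    intro a ha
    have ha' : (a : ℝ) ≤ 6 := by exact_mod_cast ha
    apply arg_ge (ipos a) (by linarith)
    rw [show 2 * Real.pi / 3 = Real.pi - Real.pi / 3 by ring, Real.cos_pi_sub, Real.sin_pi_sub, Real.cos_pi_div_three, Real.sin_pi_div_three]
    simp only [add_re, add_im, ofReal_re, ofReal_im, natCast_re, natCast_im]
    nlinarith [mul_nonneg s3.le (sub_nonneg.2 ha')]
  have hXpos : 0 < X.im := by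
    by_contra! hc
    have him := TB_im c0 d
    have b6' := arg_bd (ipos2 6)
    have b5' := arg_bd (ipos2 5)
    have b4' := arg_bd (ipos2 4)
    have a6 := aa 6 (by norm_num)
    have a5 := aa 5 (by norm_num)
    have a4 := aa 4 (by norm_num)
    simp only [Nat.cast_ofNat] at him a6 a5 a4 b6' b5' b4'
    have := Real.sin_nonpos_of_nonpos_of_neg_pi_le hc (by
      linarith [b6'.2, b5'.2, b4'.2])
    linarith
  have hXre : 0 ≤ X.re := by
    have ln : ∀ z : ℂ, Real.log ‖z‖ = 1 / 2 * Real.log (z.re ^ 2 + z.im ^ 2) := by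
      intro z; rw [Complex.norm_eq_sqrt_sq_add_sq, Real.log_sqrt (by positivity)]; ring
    have e6 : X.re = Real.log ‖(c0 + d + (6 : ℕ) : ℂ)‖ - Real.log ‖(c0 + d + (6 : ℕ) - 5 : ℂ)‖ + (Real.log ‖(c0 + d + (5 : ℕ) : ℂ)‖ - Real.log ‖(c0 + d + (5 : ℕ) - 5 : ℂ)‖)
      + (Real.log ‖(c0 + d + (4 : ℕ) : ℂ)‖ - Real.log ‖(c0 + d + (4 : ℕ) - 5 : ℂ)‖) + Real.log 3 / 2 := by
      rw [hX, add_re, conj_re, lam_re]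
      unfold TB tb
      simp only [add_re, sub_re, log_re]
    rw [e6]
    simp only [ln, Nat.cast_ofNat, add_re, sub_re, sub_im, add_im, ofReal_re, ofReal_im, re_ofNat, im_ofNat]
    have hl := Real.log_le_log (by positivity) hn
    rw [Real.log_mul (by positivity) (by positivity), Real.log_mul (by positivity) (by positivity), Real.log_mul (by positivity) (by positivity),
      Real.log_mul (by positivity) (by positivity), Real.log_mul (by positivity) (by positivity)] at hl
    simp only [zero_add, sub_zero, add_zero] at hl ⊢
    rw [show c0 + d.re + 6 - 5 = c0 + d.re + 1 by ring, show c0 + d.re + 5 - 5 = c0 + d.re by ring, show c0 + d.re + 4 - 5 = c0 + d.re + -1 by ring]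
    linarith
  rw [mul_re]
  nlinarith [mul_pos hd hXpos]

lemma sqrt3_bd : 1.7320508075 < Real.sqrt 3 ∧ Real.sqrt 3 < 1.7320508076 := by
  constructor
  · apply Real.lt_sqrt_of_sq_lt; norm_num
  · rw [Real.sqrt_lt' (by norm_num)]; norm_num

lemma Theta1 : (I * TB (-2.8307) ((1.5964365 : ℝ) * I)).re < 11 * Real.pi / 6 := by
  apply Theta _ _ (by norm_num) (by norm_num)
  unfold Wi Wr uu
  simp only [mul_re, mul_im, ofReal_re, ofReal_im, I_re, I_im]
  obtain ⟨h1, h2⟩ := sqrt3_bd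
  norm_num
  norm_num at h1 h2
  linarith

lemma Theta2 : (I * TB (-3.6) ((3 : ℝ) * I)).re < 11 * Real.pi / 6 := by
  apply Theta _ _ (by norm_num) (by norm_num)
  unfold Wi Wr uu
  simp only [mul_re, mul_im, ofReal_re, ofReal_im, I_re, I_im]
  obtain ⟨h1, h2⟩ := sqrt3_bd
  norm_num
  norm_num at h1 h2
  linarith

lemma nu1 : ((⟨-13.30807, 13.541763⟩ : ℂ) * (TB (-3.6) ⟨-13.30807, 13.541763⟩ + (starRingEnd ℂ) lam)).re < 0 := by
  obtain ⟨h1, h2⟩ := sqrt3_bd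
  norm_num at h1 h2
  apply nu
  · norm_num
  · norm_num
  · norm_num; linarith
  · unfold Wi Wr uu
    norm_num
    linarith
  · norm_num

end

section
open Filter Topology Set Complex

lemma log_up (q : ℝ) (a b c : ℤ) (U : ℝ) (hq : (2 : ℝ) ^ a * 3 ^ b * 5 ^ c ≤ q)
    (hU : 2 * ((q - 2 ^ a * 3 ^ b * 5 ^ c) / (q + 2 ^ a * 3 ^ b * 5 ^ c) + ((q - 2 ^ a * 3 ^ b * 5 ^ c) / (q + 2 ^ a * 3 ^ b * 5 ^ c)) ^ 3 /
      (1 - ((q - 2 ^ a * 3 ^ b * 5 ^ c) / (q + 2 ^ a * 3 ^ b * 5 ^ c)) ^ 2)) ≤ U) :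
    Real.log q ≤ a * Real.log 2 + b * Real.log 3 + c * Real.log 5 + U := by
  have hr : (0 : ℝ) < 2 ^ a * 3 ^ b * 5 ^ c := by positivity
  have hl : Real.log ((2 : ℝ) ^ a * 3 ^ b * 5 ^ c) = a * Real.log 2 + b * Real.log 3 + c * Real.log 5 := by
    rw [Real.log_mul (by positivity) (by positivity), Real.log_mul (by positivity) (by positivity), Real.log_zpow, Real.log_zpow, Real.log_zpow]
  rw [← hl]
  set r : ℝ := 2 ^ a * 3 ^ b * 5 ^ c
  have hq0 : 0 < q := by linarith
  have h := Real.log_div_le_sum_range_add (x := (q - r) / (q + r)) (div_nonneg (by linarith) (by linarith))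
    (by rw [div_lt_one (by linarith)]; linarith) 1
  have e : (1 + (q - r) / (q + r)) / (1 - (q - r) / (q + r)) = q / r := by
    have : q + r ≠ 0 := by positivity
    have e1 : 1 + (q - r) / (q + r) = 2 * q / (q + r) := by field_simp; ring
    have e2 : 1 - (q - r) / (q + r) = 2 * r / (q + r) := by field_simp; ring
    rw [e1, e2]; field_simp
  rw [e, Real.log_div hq0.ne' hr.ne'] at h
  simp only [Finset.sum_range_one, Nat.cast_zero, mul_zero, zero_add, pow_one, div_one, mul_one] at h
  norm_num at h
  linarith

lemma hb_eq (c0 : ℝ) (d : ℂ) (a : ℕ) : hb c0 d a = (c0 + a) * (Real.log ((c0 + d.re + a) ^ 2 + d.im ^ 2) / 2) +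
    (5 - a - c0) * (Real.log ((c0 + d.re + a - 5) ^ 2 + d.im ^ 2) / 2) - 5 * Real.log 5 := by
  have ln : ∀ z : ℂ, Real.log ‖z‖ = Real.log (z.re ^ 2 + z.im ^ 2) / 2 := by
    intro z; rw [Complex.norm_eq_sqrt_sq_add_sq, Real.log_sqrt (by positivity)]
  unfold hb
  rw [ln, ln]
  simp

lemma num_H1 : HB (-2.8307) ((1.5964365 : ℝ) * I) + (-2.8307) * Real.log 3 / 2 ≤ -8.3223693 := by
  unfold HB
  rw [hb_eq, hb_eq, hb_eq]
  simp only [mul_re, mul_im, ofReal_re, ofReal_im, I_re, I_im]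
  have l1 := log_up (((31693/10000) : ℝ) ^ 2 + (3192873/2000000) ^ 2) (-7) (-5) (8) (2735231757/1000000000000) (by norm_num) (by norm_num)
  have l2 := log_up (((-18307/10000) : ℝ) ^ 2 + (3192873/2000000) ^ 2) (11) (2) (-5) (77637741/250000000000) (by norm_num) (by norm_num)
  have l3 := log_up (((21693/10000) : ℝ) ^ 2 + (3192873/2000000) ^ 2) (-4) (-3) (5) (2854134661/1000000000000) (by norm_num) (by norm_num)
  have l4 := log_up (((-28307/10000) : ℝ) ^ 2 + (3192873/2000000) ^ 2) (-6) (3) (2) (691527173/500000000000) (by norm_num) (by norm_num)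
  have l5 := log_up (((11693/10000) : ℝ) ^ 2 + (3192873/2000000) ^ 2) (-5) (0) (3) (2460202771/1000000000000) (by norm_num) (by norm_num)
  have l6 := log_up (((-38307/10000) : ℝ) ^ 2 + (3192873/2000000) ^ 2) (10) (8) (-8) (1371452197/1000000000000) (by norm_num) (by norm_num)
  have a2 := Real.log_two_gt_d9
  have b2 := Real.log_two_lt_d9
  have a3 := Real.log_three_gt_d9
  have b3 := Real.log_three_lt_d9
  have a5 := Real.log_five_gt_d9
  have b5 := Real.log_five_lt_d9
  norm_num at l1 l2 l3 l4 l5 l6 a2 b2 a3 b3 a5 b5 ⊢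
  linarith

lemma num_H2 : HB (-3.6) ⟨-13.30807, 13.541763⟩ + (-3.6) * Real.log 3 / 2 ≤ 19.242185 := by
  unfold HB
  rw [hb_eq, hb_eq, hb_eq]
  have l1 := log_up (((-1090807/100000) : ℝ) ^ 2 + (13541763/1000000) ^ 2) (4) (10) (-5) (113962259/1000000000000) (by norm_num) (by norm_num)
  have l2 := log_up (((-1590807/100000) : ℝ) ^ 2 + (13541763/1000000) ^ 2) (-2) (-2) (6) (5556231837/1000000000000) (by norm_num) (by norm_num)
  have l3 := log_up (((-1190807/100000) : ℝ) ^ 2 + (13541763/1000000) ^ 2) (11) (-9) (5) (17092941/200000000000) (by norm_num) (by norm_num)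
  have l4 := log_up (((-1690807/100000) : ℝ) ^ 2 + (13541763/1000000) ^ 2) (-2) (1) (4) (546023217/500000000000) (by norm_num) (by norm_num)
  have l5 := log_up (((-1290807/100000) : ℝ) ^ 2 + (13541763/1000000) ^ 2) (2) (7) (-2) (110893443/500000000000) (by norm_num) (by norm_num)
  have l6 := log_up (((-1790807/100000) : ℝ) ^ 2 + (13541763/1000000) ^ 2) (4) (9) (-4) (95993731/250000000000) (by norm_num) (by norm_num)
  have a2 := Real.log_two_gt_d9
  have b2 := Real.log_two_lt_d9
  have a3 := Real.log_three_gt_d9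
  have b3 := Real.log_three_lt_d9
  have a5 := Real.log_five_gt_d9
  have b5 := Real.log_five_lt_d9
  norm_num at l1 l2 l3 l4 l5 l6 a2 b2 a3 b3 a5 b5 ⊢
  linarith

lemma num_H3 : HB (-3.6) ((3 : ℝ) * I) + (-3.6) * Real.log 3 / 2 ≤ 19.242185 := by
  unfold HB
  rw [hb_eq, hb_eq, hb_eq]
  simp only [mul_re, mul_im, ofReal_re, ofReal_im, I_re, I_im]
  have h : ∀ x : ℝ, 0 < x → x ≤ 50 → Real.log x ≤ 2 * Real.log 5 + 1 := by
    intro x h0 hx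
    have e : x = 5 ^ 2 * (x / 25) := by ring
    rw [e, Real.log_mul (by norm_num) (by positivity), Real.log_pow]
    have := Real.log_le_sub_one_of_pos (show 0 < x / 25 by positivity)
    push_cast
    linarith
  have a5 := Real.log_five_gt_d9
  have b5 := Real.log_five_lt_d9
  have a3 := Real.log_three_gt_d9
  have l0 := h ((2.4 : ℝ) ^ 2 + 3 ^ 2) (by norm_num) (by norm_num)
  have l1 := h (((-2.6) : ℝ) ^ 2 + 3 ^ 2) (by norm_num) (by norm_num)
  have l2 := h ((1.4 : ℝ) ^ 2 + 3 ^ 2) (by norm_num) (by norm_num)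
  have l3 := h (((-3.6) : ℝ) ^ 2 + 3 ^ 2) (by norm_num) (by norm_num)
  have l4 := h ((0.4 : ℝ) ^ 2 + 3 ^ 2) (by norm_num) (by norm_num)
  have l5 := h (((-4.6) : ℝ) ^ 2 + 3 ^ 2) (by norm_num) (by norm_num)
  norm_num at l0 l1 l2 l3 l4 l5 a3 a5 b5 ⊢
  linarith

end

section
section
open Filter Topology Set Complex

lemma absorb (C : ℝ) (δ : ℝ) (hδ : 0 < δ) :
    ∀ᶠ n : ℕ in atTop, C * (n:ℝ)^11 ≤ Real.exp (δ * n) := by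
  have h := (isLittleO_pow_exp_pos_mul_atTop (k := 11) hδ).def
    (c := 1/(|C|+1)) (by positivity)
  have h2 := tendsto_natCast_atTop_atTop (R := ℝ) |>.eventually h
  filter_upwards [h2] with n hn
  have hn0 : (0:ℝ) ≤ (n:ℝ)^11 := by positivity
  rw [Real.norm_of_nonneg hn0, Real.norm_of_nonneg (Real.exp_pos _).le] at hn
  have hC : 0 < |C| + 1 := by positivity
  have h3 : (|C|+1) * (n:ℝ)^11 ≤ Real.exp (δ * n) := by
    calc (|C|+1) * (n:ℝ)^11 ≤ (|C|+1) * (1/(|C|+1) * Real.exp (δ*n)) := by gcongr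
      _ = Real.exp (δ * n) := by field_simp
  refine le_trans ?_ h3
  gcongr
  linarith [le_abs_self C]

lemma main_bounds : ∃ K : ℕ, 1 ≤ K ∧ ∀ᶠ m : ℕ in atTop, 5*K^2 ≤ 10000*m ∧
    ∀ j < 3, cc (10000*m) K * ‖(Polynomial.derivative (Sj (10000*m) j)).eval 0
        + lam * (Sj (10000*m) j).eval 0‖ ≤ Real.exp (-7.1402995 * (10000*m)) ∧
      cc (10000*m) K * ‖(Sj (10000*m) j).eval 0‖ ≤ Real.exp (20.424255 * (10000*m)) := by
  obtain ⟨K, hK, hD⟩ := Dsum_num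
  refine ⟨K, hK, ?_⟩
  obtain ⟨C1, hC1, hI⟩ := I_bound (-2.8307) 1.5964365 (by norm_num) (by norm_num) (by norm_num) Theta1
  obtain ⟨C2, hC2, hB⟩ := B_bound (-3.6) 3 (by norm_num) ⟨-13.30807,13.541763⟩ (by norm_num)
    (by norm_num) (by norm_num) (by norm_num) (by norm_num) Theta2 nu1 19.242185 num_H3 num_H2
  have hcc := log_cc K 1.1820692 (by linarith)
  have hm : Tendsto (fun m : ℕ => 10000*m) atTop atTop :=
    tendsto_id.const_mul_atTop' (by norm_num)
  filter_upwards [hm.eventually hcc, hm.eventually (absorb C1 0.0000001 (by norm_num)),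
    hm.eventually (absorb C2 0.0000001 (by norm_num)), hm.eventually (eventually_ge_atTop (5*K^2)),
    eventually_ge_atTop 1] with m h1 h2 h3 h4 h5
  refine ⟨h4, fun j hj => ?_⟩
  have hn1 : 1 ≤ 10000*m := by omega
  have hccb : cc (10000*m) K ≤ Real.exp (1.1820692 * ((10000*m : ℕ):ℝ)) := by
    rw [← Real.log_le_iff_le_exp (cc_pos _ _)]; exact h1
  have i1 := hI (10000*m) j (-28307*m) hn1 hj (by push_cast; ring)
  have i2 := hB (10000*m) j (-36000*m) hn1 hj (by push_cast; ring)
  have hH1 := num_H1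
  have hmp : (0:ℝ) ≤ ((10000*m:ℕ):ℝ) := by positivity
  constructor
  · calc _ ≤ Real.exp (1.1820692 * ((10000*m : ℕ):ℝ)) * (Real.exp (0.0000001 * ((10000*m : ℕ):ℝ)) *
          Real.exp (((10000*m : ℕ):ℝ) * (-8.3223693))) := by
            refine mul_le_mul hccb (i1.trans ?_) (norm_nonneg _) (Real.exp_pos _).le
            gcongr
      _ ≤ _ := by
        rw [← Real.exp_add, ← Real.exp_add, Real.exp_le_exp]
        push_cast at hmp ⊢
        nlinarith
  · calc _ ≤ Real.exp (1.1820692 * ((10000*m : ℕ):ℝ)) * (Real.exp (0.0000001 * ((10000*m : ℕ):ℝ)) *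
          Real.exp (((10000*m : ℕ):ℝ) * (19.242185))) := by
            refine mul_le_mul hccb (i2.trans ?_) (norm_nonneg _) (Real.exp_pos _).le
            gcongr
      _ ≤ _ := by
        rw [← Real.exp_add, ← Real.exp_add, Real.exp_le_exp]
        push_cast at hmp ⊢
        nlinarith

lemma arith_step (n K : ℕ) (hK : 1 ≤ K) (hn : 5*K^2 ≤ n) (q p₁ p₂ : ℤ) (hq : 0 < q) (E F : ℝ)
    (hE : ∀ j < 3, cc n K * ‖(Polynomial.derivative (Sj n j)).eval 0
        + lam * (Sj n j).eval 0‖ ≤ E)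
    (hF : ∀ j < 3, cc n K * ‖(Sj n j).eval 0‖ ≤ F) :
    1 ≤ 6 * (q:ℝ) * E + 6 * (q:ℝ) * (max |Real.log 3 - (p₁ : ℝ) / (q : ℝ)|
      |Real.pi / Real.sqrt 3 - (p₂ : ℝ) / (q : ℝ)|) * F := by
  set M := max |Real.log 3 - (p₁ : ℝ) / (q : ℝ)| |Real.pi / Real.sqrt 3 - (p₂ : ℝ) / (q : ℝ)| with hM
  have hqR : (0:ℝ) < q := by exact_mod_cast hq
  have hqC : (q:ℂ) ≠ 0 := by exact_mod_cast hq.ne'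
  have hs3 : Real.sqrt 3 * Real.sqrt 3 = 3 := Real.mul_self_sqrt (by norm_num)
  have hs3p : 0 < Real.sqrt 3 := Real.sqrt_pos.mpr (by norm_num)
  set P : ℂ := (p₁:ℂ)/2 - (2*ww+1)/6 * p₂ with hP
  obtain ⟨j, hj, hne⟩ := nonvan n (q:ℂ) P hqC
  set A := (Polynomial.derivative (Sj n j)).eval 0 with hA
  set B := (Sj n j).eval 0 with hB
  have hAi : EisInt ((cc n K : ℂ) * A) := by
    have := Sop_int (P := Polynomial.derivative (RR n * Polynomial.X^j)) (c := (cc n K : ℂ))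
      (fun k => (cc_int n K hK hn j k).2) (15*n+3)
    rw [hA]; unfold Sj; rw [Sop_derivative]; exact this
  have hBi : EisInt ((cc n K : ℂ) * B) := by
    have := Sop_int (P := (RR n * Polynomial.X^j)) (c := (cc n K : ℂ))
      (fun k => (cc_int n K hK hn j k).1) (15*n+3)
    rw [hB]; unfold Sj; exact this
  have h6P : EisInt (6*P) := ⟨3*p₁ - p₂, -2*p₂, by rw [hP]; push_cast; ring⟩
  have h6q : EisInt (6*(q:ℂ)) := ⟨6*q, 0, by push_cast; ring⟩
  have hL : EisInt (6 * (cc n K:ℂ) * ((q:ℂ)*A + P*B)) := by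
    have := (h6q.mul hAi).add (h6P.mul hBi)
    convert this using 1; ring
  have hccp := cc_pos n K
  have hcc0 : (cc n K : ℂ) ≠ 0 := by exact_mod_cast hccp.ne'
  have h1 := hL.one_le (mul_ne_zero (mul_ne_zero (by norm_num) hcc0) hne)
  have hdec : 6 * (cc n K:ℂ) * ((q:ℂ)*A + P*B) =
      6 * (q:ℂ) * ((cc n K:ℂ) * (A + lam*B)) - 6 * (q:ℂ) * (lam - P/q) * ((cc n K:ℂ) * B) := by
    field_simp; ring
  have hδ : ‖lam - P/q‖ ≤ M := by
    have e : lam - P/q = (((1/2) * (Real.log 3 - (p₁ : ℝ) / (q : ℝ)) : ℝ) : ℂ)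
        - (((Real.sqrt 3/6) * (Real.pi / Real.sqrt 3 - (p₂ : ℝ) / (q : ℝ)) : ℝ) : ℂ) * I := by
      have e1 : Real.sqrt 3/6 * (Real.pi / Real.sqrt 3 - (p₂ : ℝ) / (q : ℝ))
        = Real.pi/6 - Real.sqrt 3/6 * ((p₂ : ℝ) / (q : ℝ)) := by field_simp
      rw [e1, hP]; unfold lam ww; push_cast; field_simp; ring
    rw [e]
    refine (norm_sub_le _ _).trans ?_
    rw [norm_mul, Complex.norm_I, mul_one, Complex.norm_real, Complex.norm_real, norm_mul, norm_mul,
      Real.norm_of_nonneg (by norm_num : (0:ℝ) ≤ 1/2),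
      Real.norm_of_nonneg (by positivity : (0:ℝ) ≤ Real.sqrt 3/6), Real.norm_eq_abs, Real.norm_eq_abs]
    have m1 : |Real.log 3 - (p₁ : ℝ) / (q : ℝ)| ≤ M := le_max_left _ _
    have m2 : |Real.pi / Real.sqrt 3 - (p₂ : ℝ) / (q : ℝ)| ≤ M := le_max_right _ _
    have hs : Real.sqrt 3 / 6 ≤ 1/2 := by nlinarith
    have := mul_le_mul hs m2 (abs_nonneg _) (by norm_num)
    linarith
  have hM0 : 0 ≤ M := (norm_nonneg _).trans hδ
  rw [hdec] at h1
  refine h1.trans ((norm_sub_le _ _).trans ?_)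
  have hqn : ‖(q:ℂ)‖ = q := by
    rw [Complex.norm_intCast, abs_of_pos hqR]
  have hccn : ‖(cc n K:ℂ)‖ = cc n K := by
    rw [Complex.norm_real, Real.norm_of_nonneg hccp.le]
  have h6 : ‖(6:ℂ)‖ = 6 := by norm_num
  rw [norm_mul, norm_mul, norm_mul (6*(q:ℂ) * _), norm_mul (6*(q:ℂ)), norm_mul (6:ℂ), hqn, h6,
    norm_mul, norm_mul _ B, hccn]
  have := hE j hj
  have := hF j hj
  gcongr

theorem simultaneous_approximation_log3_pi_div_sqrt3 :
    ∀ ε : ℝ, ε > 0 → ∃ q₀ : ℤ, 0 < q₀ ∧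
      ∀ q : ℤ, q ≥ q₀ → ∀ p₁ p₂ : ℤ,
        max |Real.log 3 - (p₁ : ℝ) / (q : ℝ)| |Real.pi / Real.sqrt 3 - (p₂ : ℝ) / (q : ℝ)| ≥
          (q : ℝ) ^ (-3.86042 - ε) := by
  intro ε hε
  obtain ⟨K, hK, hm⟩ := main_bounds
  obtain ⟨M0, hM0⟩ := eventually_atTop.mp hm
  have hlog : Tendsto (fun q : ℤ => Real.log (q:ℝ)) atTop atTop :=
    Real.tendsto_log_atTop.comp tendsto_intCast_atTop_atTop
  have hev : ∀ᶠ q : ℤ in atTop, 0 < q ∧ 71402.995 * M0 ≤ Real.log (q:ℝ) ∧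
      (2.86042 * (Real.log 12 + 71402.995) + Real.log 12 + 1)/ε ≤ Real.log (q:ℝ) := by
    filter_upwards [eventually_gt_atTop 0, hlog.eventually (eventually_ge_atTop _),
      hlog.eventually (eventually_ge_atTop _)] with q h1 h2 h3
    exact ⟨h1, h2, h3⟩
  obtain ⟨q1, hq1⟩ := eventually_atTop.mp hev
  refine ⟨max q1 1, by positivity, fun q hq p₁ p₂ => ?_⟩
  obtain ⟨hq0, hqM, hqe⟩ := hq1 q ((le_max_left _ _).trans hq)
  have hqR : (0:ℝ) < q := by exact_mod_cast hq0
  set L := Real.log (q:ℝ) with hL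
  have hl12 : 0 < Real.log 12 := Real.log_pos (by norm_num)
  rw [div_le_iff₀ hε] at hqe
  have hLp : 0 ≤ L := le_trans (by positivity) hqM
  set m := ⌈(Real.log 12 + L)/71402.995⌉₊ with hmdef
  have hm1 : Real.log 12 + L ≤ 71402.995 * m := by
    have := Nat.le_ceil ((Real.log 12 + L)/71402.995)
    rw [div_le_iff₀ (by norm_num), ← hmdef] at this
    linarith
  have hm2 : 71402.995 * (m:ℝ) ≤ Real.log 12 + L + 71402.995 := by
    have := (Nat.ceil_lt_add_one (a := (Real.log 12 + L)/71402.995) (by positivity)).le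
    rw [← hmdef] at this
    have h2 := mul_le_mul_of_nonneg_left this (by norm_num : (0:ℝ) ≤ 71402.995)
    refine h2.trans (le_of_eq ?_)
    field_simp
  have hmM : M0 ≤ m := by
    have : (M0:ℝ) ≤ m := by
      have : 71402.995 * (M0:ℝ) ≤ 71402.995 * m := by linarith
      linarith
    exact_mod_cast this
  obtain ⟨hn, hb⟩ := hM0 m hmM
  have key := arith_step (10000*m) K hK hn q p₁ p₂ hq0 _ _ (fun j hj => (hb j hj).1)
    (fun j hj => (hb j hj).2)
  set M := max |Real.log 3 - (p₁ : ℝ) / (q : ℝ)| |Real.pi / Real.sqrt 3 - (p₂ : ℝ) / (q : ℝ)|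
  by_contra hcon
  have hlt : M < (q:ℝ)^(-3.86042-ε) := not_le.mp hcon
  rw [Real.rpow_def_of_pos hqR, ← hL] at hlt
  have hqexp : (q:ℝ) = Real.exp L := (Real.exp_log hqR).symm
  have h12 : (12:ℝ) = Real.exp (Real.log 12) := (Real.exp_log (by norm_num)).symm
  have t1 : 12 * ((q:ℝ) * Real.exp (-7.1402995 * (10000*m))) ≤ 1 := by
    rw [hqexp]; nth_rewrite 1 [h12]
    rw [← Real.exp_add, ← Real.exp_add, Real.exp_le_one_iff]
    linarith
  have t2 : 12 * ((q:ℝ) * Real.exp (L * (-3.86042 - ε)) * Real.exp (20.424255 * (10000*m))) < 1 := by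
    rw [hqexp]; nth_rewrite 1 [h12]
    rw [← Real.exp_add, ← Real.exp_add, ← Real.exp_add, Real.exp_lt_one_iff]
    have : (20.424255 * (10000*m) : ℝ) ≤ 2.86042 * (71402.995 * m) := by
      have : (0:ℝ) ≤ m := by positivity
      nlinarith
    nlinarith
  have t3 : (q:ℝ) * M * Real.exp (20.424255 * (10000*m)) ≤
      (q:ℝ) * Real.exp (L * (-3.86042 - ε)) * Real.exp (20.424255 * (10000*m)) := by
    gcongr
  linarith
end

end
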